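/- Let φ be holomorphic and injective on the exterior disk Δ = {z ∈ ℂ : |z| > 1}, with Laurent expansion φ(z) = z + φ₀ + ∑_{k≥1} φ_{-k} z^{-k} at infinity, let a_{kℓ} be its Grunsky coefficients, and assume ∑_{k,ℓ≥1} kℓ |a_{kℓ}|² < ∞ (Weil–Petersson quasicircle). Set b_{kℓ} = √(kℓ) a_{kℓ} and B_m = (b_{kℓ})_{1≤k,ℓ≤m}, and for each n ≥ 1 let Z̃_n = lim_{r→1+} Z_n(r)/(2π)^n (which exists in (0,∞] by monotonicity in r). Then det(I_m − B_m* B_m) ∈ (0, 1] for every m, the limit D = lim_{m→∞} det(I_m − B_m* B_m) exists in (0, 1], each Z̃_n is finite, and lim_{n→∞} log Z̃_n = −(1/2) log D. -/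

import Mathlib

open MeasureTheory Filter

/-- The partition function `Z_n(γ_r)` of the Coulomb gas (at `β = 2`) on the analytic
curve `γ_r`, the image of the unit circle under `φ_r(z) = φ(rz)/r`:
`Z_n(r) = (1/(n! r^{n(n-1)})) ∫_{[−π,π]^n} ∏_{μ<ν} |φ(re^{iθ_μ}) − φ(re^{iθ_ν})|²
∏_μ |φ'(re^{iθ_μ})| dθ`. -/
noncomputable def Zn (φ : ℂ → ℂ) (n : ℕ) (r : ℝ) : ℝ :=
  (1 / (n.factorial * r ^ (n * (n - 1)))) *
    ∫ θ in Set.pi Set.univ (fun _ : Fin n => Set.Icc (-Real.pi) Real.pi),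
      (∏ p ∈ Finset.univ.filter (fun p : Fin n × Fin n => p.1 < p.2),
        norm (φ ((r : ℂ) * Complex.exp (Complex.I * (θ p.1 : ℂ)))
          - φ ((r : ℂ) * Complex.exp (Complex.I * (θ p.2 : ℂ)))) ^ 2) *
      ∏ μ, norm (deriv φ ((r : ℂ) * Complex.exp (Complex.I * (θ μ : ℂ))))

/-- `E_n(r) = log(Z_n(r)/(2π)^n)`, the "finite `n` Loewner energy" of `γ_r`. -/
noncomputable def En (φ : ℂ → ℂ) (n : ℕ) (r : ℝ) : ℝ :=
  Real.log (Zn φ n r / (2 * Real.pi) ^ n)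

/-- Taylor coefficients at the origin. -/
noncomputable def tayC (f : ℂ → ℂ) (j : ℕ) : ℂ := (j.factorial : ℂ)⁻¹ * iteratedDeriv j f 0

lemma tayC_hasSum {f : ℂ → ℂ} {R : ℝ} (hf : DifferentiableOn ℂ f (Metric.ball 0 R)) {s : ℂ}
    (hs : ‖s‖ < R) : HasSum (fun j => tayC f j * s ^ j) (f s) := by
  have := Complex.hasSum_taylorSeries_on_ball hf (z := s) (by simpa using hs)
  refine this.congr_fun ?_ |> fun h => h
  intro j
  simp [tayC]
  ring

lemma pow_hasFPowerSeries {q : ℕ → ℂ} {f : ℂ → ℂ} {R : ℝ} (hR : 0 < R)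
    (h : ∀ s : ℂ, ‖s‖ < R → HasSum (fun j => q j * s ^ j) (f s)) :
    HasFPowerSeriesOnBall f (FormalMultilinearSeries.ofScalars ℂ q) 0 (ENNReal.ofReal R) := by
  refine ⟨?_, by simpa using hR, ?_⟩
  · refine ENNReal.le_of_forall_nnreal_lt fun r hr => ?_
    have hr' : (r : ℝ) < R := by
      rw [ENNReal.lt_ofReal_iff_toReal_lt (by simp)] at hr; simpa using hr
    refine FormalMultilinearSeries.le_radius_of_summable _ ?_
    have h1 := (h (r : ℂ) (by simpa using hr')).summable.norm
    refine h1.congr fun j => ?_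
    simp [FormalMultilinearSeries.ofScalars_norm]
  · intro y hy
    have hy' : ‖y‖ < R := by
      rw [Metric.mem_eball, edist_zero_right, ← ofReal_norm_eq_enorm] at hy
      exact (ENNReal.ofReal_lt_ofReal_iff hR).1 hy
    have := h y hy'
    simp only [zero_add, FormalMultilinearSeries.ofScalars_apply_eq]
    refine this.congr_fun ?_ |> fun h => h
    intro j; simp

lemma pow_differentiableOn {q : ℕ → ℂ} {f : ℂ → ℂ} {R : ℝ} (hR : 0 < R)
    (h : ∀ s : ℂ, ‖s‖ < R → HasSum (fun j => q j * s ^ j) (f s)) :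
    DifferentiableOn ℂ f (Metric.ball 0 R) := by
  have := (pow_hasFPowerSeries hR h).differentiableOn
  rwa [Metric.eball_ofReal] at this

lemma tayC_eq {q : ℕ → ℂ} {f : ℂ → ℂ} {R : ℝ} (hR : 0 < R)
    (h : ∀ s : ℂ, ‖s‖ < R → HasSum (fun j => q j * s ^ j) (f s)) (j : ℕ) : tayC f j = q j := by
  have h1 := (pow_hasFPowerSeries hR h).hasFPowerSeriesAt
  have h2 := (pow_hasFPowerSeries hR (fun s hs => tayC_hasSum (pow_differentiableOn hR h) hs)).hasFPowerSeriesAt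
  have h3 := h1.eq_formalMultilinearSeries h2
  have h4 : FormalMultilinearSeries.coeff (FormalMultilinearSeries.ofScalars ℂ q) j
    = FormalMultilinearSeries.coeff (FormalMultilinearSeries.ofScalars ℂ (tayC f)) j := by rw [h3]
  simp [FormalMultilinearSeries.coeff_ofScalars] at h4
  exact h4.symm

lemma tayC_zero (f : ℂ → ℂ) : tayC f 0 = f 0 := by simp [tayC]

/-- recursion for the Taylor coefficients of a solution of the exponential equation. -/
lemma tayC_rec {q g : ℂ → ℂ} {R : ℝ} (hR : 0 < R) (hq : DifferentiableOn ℂ q (Metric.ball 0 R))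
    (hg : DifferentiableOn ℂ g (Metric.ball 0 R))
    (h : ∀ s : ℂ, ‖s‖ < R → deriv g s = deriv q s * g s) (j : ℕ) :
    ((j : ℂ) + 1) * tayC g (j + 1) =
      ∑ i ∈ Finset.range (j + 1), ((i : ℂ) + 1) * tayC q (i + 1) * tayC g (j - i) := by
  have hb : Metric.ball (0 : ℂ) R ∈ nhds 0 := Metric.ball_mem_nhds _ hR
  have hqa : AnalyticAt ℂ q 0 := hq.analyticAt hb
  have hga : AnalyticAt ℂ g 0 := hg.analyticAt hb
  have e : deriv g =ᶠ[nhds 0] fun s => deriv q s * g s := by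
    filter_upwards [hb] with s hs using h s (by simpa using hs)
  have h1 : iteratedDeriv (j + 1) g 0 = ∑ i ∈ Finset.range (j + 1),
      (j.choose i : ℂ) * iteratedDeriv (i + 1) q 0 * iteratedDeriv (j - i) g 0 := by
    rw [iteratedDeriv_succ', e.iteratedDeriv_eq j,
      iteratedDeriv_fun_mul hqa.deriv.contDiffAt hga.contDiffAt]
    simp [iteratedDeriv_succ']
  simp only [tayC]
  rw [h1, Finset.mul_sum, Finset.mul_sum]
  refine Finset.sum_congr rfl fun i hi => ?_
  have hi' : i ≤ j := by simpa [Nat.lt_succ_iff] using hi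
  rw [Nat.cast_choose ℂ hi', Nat.factorial_succ, Nat.factorial_succ]
  have a1 : (j.factorial : ℂ) ≠ 0 := by exact_mod_cast j.factorial_ne_zero
  have a2 : (i.factorial : ℂ) ≠ 0 := by exact_mod_cast i.factorial_ne_zero
  have a3 : ((j-i).factorial : ℂ) ≠ 0 := by exact_mod_cast (j-i).factorial_ne_zero
  have a4 : (j : ℂ) + 1 ≠ 0 := by exact_mod_cast j.succ_ne_zero
  have a5 : (i : ℂ) + 1 ≠ 0 := by exact_mod_cast i.succ_ne_zero
  push_cast
  field_simp

/-- The main power series lemma: exponentials of power series. -/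
lemma exp_series_rec {q : ℕ → ℂ} {f : ℂ → ℂ} {R : ℝ} (hR : 0 < R)
    (h : ∀ s : ℂ, ‖s‖ < R → HasSum (fun j => q j * s ^ j) (f s)) (e : ℕ → ℂ)
    (h0 : e 0 = Complex.exp (f 0))
    (hrec : ∀ j : ℕ, ((j : ℂ) + 1) * e (j + 1) =
      ∑ i ∈ Finset.range (j + 1), ((i : ℂ) + 1) * q (i + 1) * e (j - i)) (s : ℂ) (hs : ‖s‖ < R) :
    HasSum (fun j => e j * s ^ j) (Complex.exp (f s)) := by
  have hf := pow_differentiableOn hR h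
  have hg : DifferentiableOn ℂ (fun s => Complex.exp (f s)) (Metric.ball 0 R) := hf.cexp
  have hd : ∀ s : ℂ, ‖s‖ < R → deriv (fun s => Complex.exp (f s)) s = deriv f s * Complex.exp (f s) := by
    intro s hs
    have : DifferentiableAt ℂ f s :=
      hf.differentiableAt (Metric.isOpen_ball.mem_nhds (by simpa using hs))
    rw [(this.hasDerivAt.cexp).deriv, mul_comm]
  have key : ∀ j, ∀ i ≤ j, tayC (fun s => Complex.exp (f s)) i = e i := by
    intro j
    induction j with
    | zero => intro i hi; obtain rfl : i = 0 := by omega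
              rw [tayC_zero, h0]
    | succ j ih =>
      intro i hi
      rcases Nat.lt_or_ge i (j+1) with hlt | hge
      · exact ih i (by omega)
      · obtain rfl : i = j + 1 := by omega
        have a4 : (j : ℂ) + 1 ≠ 0 := by exact_mod_cast j.succ_ne_zero
        have := tayC_rec hR hf hg hd j
        apply mul_left_cancel₀ a4
        rw [this, hrec]
        refine Finset.sum_congr rfl fun i hi => ?_
        rw [ih (j - i) (by omega), tayC_eq hR h]
  have := tayC_hasSum hg hs
  refine this.congr_fun ?_ |> fun h => h
  intro j
  rw [key j j le_rfl]

/-- Converse direction: if `exp (∑ q) = ∑ g` then recursion holds. -/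
lemma exp_series_rec' {q g : ℕ → ℂ} {f : ℂ → ℂ} {R : ℝ} (hR : 0 < R)
    (h : ∀ s : ℂ, ‖s‖ < R → HasSum (fun j => q j * s ^ j) (f s))
    (hg : ∀ s : ℂ, ‖s‖ < R → HasSum (fun j => g j * s ^ j) (Complex.exp (f s))) (j : ℕ) :
    ((j : ℂ) + 1) * g (j + 1) =
      ∑ i ∈ Finset.range (j + 1), ((i : ℂ) + 1) * q (i + 1) * g (j - i) := by
  have hf := pow_differentiableOn hR h
  have hgd : DifferentiableOn ℂ (fun s => Complex.exp (f s)) (Metric.ball 0 R) := hf.cexp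
  have hd : ∀ s : ℂ, ‖s‖ < R → deriv (fun s => Complex.exp (f s)) s = deriv f s * Complex.exp (f s) := by
    intro s hs
    have : DifferentiableAt ℂ f s :=
      hf.differentiableAt (Metric.isOpen_ball.mem_nhds (by simpa using hs))
    rw [(this.hasDerivAt.cexp).deriv, mul_comm]
  have := tayC_rec hR hf hgd hd j
  simpa only [tayC_eq hR h, tayC_eq hR hg] using this

/-- The standing hypotheses. -/
structure GH (φ : ℂ → ℂ) (φ₀ : ℂ) (c : ℕ → ℂ) (a : ℕ → ℕ → ℂ) : Prop where
  hφ : DifferentiableOn ℂ φ {z : ℂ | 1 < norm z}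
  hinj : Set.InjOn φ {z : ℂ | 1 < norm z}
  hLaurent : ∀ z : ℂ, 1 < norm z →
      Summable (fun k : ℕ => norm (c k * z ^ (-(k : ℤ) - 1))) ∧
      φ z = z + φ₀ + ∑' k : ℕ, c k * z ^ (-(k : ℤ) - 1)
  hsym : ∀ k l, a k l = a l k
  hGrunsky : ∀ z ζ : ℂ, 1 < norm z → 1 < norm ζ →
      Summable (fun p : ℕ × ℕ =>
        norm (a (p.1 + 1) (p.2 + 1) * ζ ^ (-(p.1 : ℤ) - 1) * z ^ (-(p.2 : ℤ) - 1))) ∧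
      φ ζ - φ z = (ζ - z) * Complex.exp
        (-∑' p : ℕ × ℕ, a (p.1 + 1) (p.2 + 1) * ζ ^ (-(p.1 : ℤ) - 1) * z ^ (-(p.2 : ℤ) - 1))
  hWP : Summable (fun p : ℕ × ℕ =>
      (((p.1 + 1) * (p.2 + 1) : ℕ) : ℝ) * norm (a (p.1 + 1) (p.2 + 1)) ^ 2)

lemma hasSum_cng {ι : Type*} {f g : ι → ℂ} {x y : ℂ} (h : HasSum f x) (h1 : ∀ i, g i = f i)
    (h2 : y = x) : HasSum g y := by
  obtain rfl : g = f := funext h1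
  rw [h2]; exact h

/-- The Grunsky double series in inverted variables. -/
noncomputable def AA (a : ℕ → ℕ → ℂ) (s u : ℂ) : ℂ :=
  ∑' p : ℕ × ℕ, a (p.1 + 1) (p.2 + 1) * s ^ (p.1 + 1) * u ^ (p.2 + 1)

/-- Row sums of the Grunsky series. -/
noncomputable def alp (a : ℕ → ℕ → ℂ) (k : ℕ) (u : ℂ) : ℂ :=
  ∑' l : ℕ, a (k + 1) (l + 1) * u ^ (l + 1)

lemma zpow_inv_aux (z : ℂ) (k : ℕ) : z ^ (-(k : ℤ) - 1) = (z⁻¹) ^ (k + 1) := by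
  rw [show (-(k : ℤ) - 1) = -((k + 1 : ℕ) : ℤ) by push_cast; ring, zpow_neg, zpow_natCast, inv_pow]

lemma norm_inv_lt {z : ℂ} (hz : 1 < ‖z‖) : ‖z⁻¹‖ < 1 := by
  rw [norm_inv]; exact inv_lt_one_of_one_lt₀ hz

lemma one_lt_norm_inv {s : ℂ} (hs : ‖s‖ < 1) (h0 : s ≠ 0) : 1 < ‖s⁻¹‖ := by
  rw [norm_inv]; exact (one_lt_inv₀ (norm_pos_iff.2 h0)).2 hs

namespace GH

variable {φ : ℂ → ℂ} {φ₀ : ℂ} {c : ℕ → ℂ} {a : ℕ → ℕ → ℂ}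

lemma summ (G : GH φ φ₀ c a) {s u : ℂ} (hs : ‖s‖ < 1) (hu : ‖u‖ < 1) :
    Summable (fun p : ℕ × ℕ => ‖a (p.1 + 1) (p.2 + 1) * s ^ (p.1 + 1) * u ^ (p.2 + 1)‖) := by
  by_cases hs0 : s = 0
  · simp [hs0, summable_zero]
  by_cases hu0 : u = 0
  · simp [hu0, summable_zero]
  have := (G.hGrunsky u⁻¹ s⁻¹ (one_lt_norm_inv hu hu0) (one_lt_norm_inv hs hs0)).1
  simpa only [zpow_inv_aux, inv_inv] using this

lemma gru (G : GH φ φ₀ c a) {z ζ : ℂ} (hz : 1 < ‖z‖) (hζ : 1 < ‖ζ‖) :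
    φ ζ - φ z = (ζ - z) * Complex.exp (-AA a ζ⁻¹ z⁻¹) := by
  have := (G.hGrunsky z ζ hz hζ).2
  unfold AA
  simpa only [zpow_inv_aux] using this

lemma alp_hasSum (G : GH φ φ₀ c a) (k : ℕ) {u : ℂ} (hu : ‖u‖ < 1) :
    HasSum (fun l => a (k + 1) (l + 1) * u ^ (l + 1)) (alp a k u) := by
  have h1 := (G.summ (s := 1/2) (u := u) (by norm_num) hu).of_norm.prod_factor k
  have h2 : Summable (fun l => a (k + 1) (l + 1) * u ^ (l + 1)) := by
    refine (h1.mul_left ((1/2 : ℂ) ^ (k+1))⁻¹).congr fun l => ?_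
    field_simp
  exact h2.hasSum

lemma AA_hasSum (G : GH φ φ₀ c a) {s u : ℂ} (hs : ‖s‖ < 1) (hu : ‖u‖ < 1) :
    HasSum (fun k => alp a k u * s ^ (k + 1)) (AA a s u) := by
  have h1 := (G.summ hs hu).of_norm.hasSum
  refine h1.prod_fiberwise fun k => ?_
  have := (G.alp_hasSum k hu).mul_right (s ^ (k + 1))
  refine this.congr_fun ?_ |> fun h => h
  intro l
  ring

lemma AA_hasSum' (G : GH φ φ₀ c a) {s u : ℂ} (hs : ‖s‖ < 1) (hu : ‖u‖ < 1) :
    HasSum (fun k => (if k = 0 then 0 else alp a (k - 1) u) * s ^ k) (AA a s u) := by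
  rw [← hasSum_nat_add_iff' 1]
  simpa using G.AA_hasSum hs hu

lemma AA_diff (G : GH φ φ₀ c a) {u : ℂ} (hu : ‖u‖ < 1) :
    DifferentiableOn ℂ (fun s => AA a s u) (Metric.ball 0 1) :=
  pow_differentiableOn one_pos fun _ hs => G.AA_hasSum' hs hu

lemma isOpen_dom : IsOpen {z : ℂ | 1 < ‖z‖} := isOpen_lt continuous_const continuous_norm

lemma hasDerivAt (G : GH φ φ₀ c a) {z : ℂ} (hz : 1 < ‖z‖) :
    HasDerivAt φ (Complex.exp (-AA a z⁻¹ z⁻¹)) z := by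
  rw [hasDerivAt_iff_tendsto_slope]
  have hz0 : z ≠ 0 := by rintro rfl; simp at hz; linarith
  have h1 : ContinuousAt (fun ζ => Complex.exp (-AA a ζ⁻¹ z⁻¹)) z := by
    have h2 : ContinuousAt (fun s => AA a s z⁻¹) z⁻¹ :=
      ((G.AA_diff (norm_inv_lt hz)).differentiableAt
        (Metric.isOpen_ball.mem_nhds (by simpa using norm_inv_lt hz))).continuousAt
    have h3 : ContinuousAt (fun ζ : ℂ => AA a ζ⁻¹ z⁻¹) z :=
      ContinuousAt.comp (f := fun ζ : ℂ => ζ⁻¹) h2 (continuousAt_inv₀ hz0)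
    exact h3.neg.cexp
  refine (h1.tendsto.mono_left nhdsWithin_le_nhds).congr' ?_
  filter_upwards [self_mem_nhdsWithin, mem_nhdsWithin_of_mem_nhds (isOpen_dom.mem_nhds hz)] with ζ h4 h5
  have h6 : ζ - z ≠ 0 := sub_ne_zero.2 h4
  rw [slope_def_field, G.gru hz h5]
  field_simp

lemma deriv_eq (G : GH φ φ₀ c a) {z : ℂ} (hz : 1 < ‖z‖) :
    deriv φ z = Complex.exp (-AA a z⁻¹ z⁻¹) := (G.hasDerivAt hz).deriv

lemma deriv_ne (G : GH φ φ₀ c a) {z : ℂ} (hz : 1 < ‖z‖) : deriv φ z ≠ 0 := by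
  rw [G.deriv_eq hz]; exact Complex.exp_ne_zero _

/-- coefficients of `s φ(1/s) - s w`, as polynomials in `w`. -/
noncomputable def gcoef (φ₀ : ℂ) (c : ℕ → ℂ) : ℕ → Polynomial ℂ
  | 0 => 1
  | 1 => Polynomial.C φ₀ - Polynomial.X
  | (j + 2) => Polynomial.C (c j)

/-- The values `S_{k+1}(z) = z^{k+1} + (k+1) ∑ a z^{-l}`. -/
noncomputable def SS (a : ℕ → ℕ → ℂ) (k : ℕ) (z : ℂ) : ℂ := z ^ (k + 1) + (k + 1) * alp a k z⁻¹

lemma laurent_hasSum (G : GH φ φ₀ c a) {s w : ℂ} (hs : ‖s‖ < 1) (hs0 : s ≠ 0) :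
    HasSum (fun j => (gcoef φ₀ c j).eval w * s ^ j) (s * φ s⁻¹ - s * w) := by
  obtain ⟨h1, h2⟩ := G.hLaurent s⁻¹ (one_lt_norm_inv hs hs0)
  rw [← hasSum_nat_add_iff' 2]
  have h3 := h1.of_norm.hasSum.mul_left s
  simp only [zpow_inv_aux, inv_inv] at h3 h2
  rw [h2]
  simp only [Finset.sum_range_succ, Finset.sum_range_zero, gcoef, Polynomial.eval_one, pow_zero, pow_one, zero_add,
    Polynomial.eval_sub, Polynomial.eval_C, Polynomial.eval_X]
  refine hasSum_cng h3 (fun j => ?_) ?_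
  · ring
  · rw [mul_add, mul_add, mul_inv_cancel₀ hs0]; ring

lemma SS_rec (G : GH φ φ₀ c a) {z : ℂ} (hz : 1 < ‖z‖) (j : ℕ) :
    ((j : ℂ) + 1) * (gcoef φ₀ c (j + 1)).eval (φ z) =
      - ∑ i ∈ Finset.range (j + 1), SS a i z * (gcoef φ₀ c (j - i)).eval (φ z) := by
  have hz0 : z ≠ 0 := by rintro rfl; simp at hz; linarith
  have hu := norm_inv_lt hz
  have hR : 0 < ‖z⁻¹‖ := by simpa using hz0
  have hlog : ∀ s : ℂ, ‖s‖ < ‖z⁻¹‖ → ‖z * s‖ < 1 := by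
    intro s hs
    have hzp : 0 < ‖z‖ := norm_pos_iff.2 hz0
    rw [norm_mul]
    rw [norm_inv] at hs
    calc ‖z‖ * ‖s‖ < ‖z‖ * ‖z‖⁻¹ := by gcongr
      _ = 1 := mul_inv_cancel₀ hzp.ne'
  have hq : ∀ s : ℂ, ‖s‖ < ‖z⁻¹‖ → HasSum
      (fun k => (-(z ^ k / k + (if k = 0 then 0 else alp a (k - 1) z⁻¹))) * s ^ k)
      (Complex.log (1 - z * s) - AA a s z⁻¹) := by
    intro s hs
    have h1 := (Complex.hasSum_taylorSeries_neg_log (hlog s hs)).neg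
    have h2 := G.AA_hasSum' (s := s) (u := z⁻¹) (hs.trans hu) hu
    rw [neg_neg] at h1
    refine hasSum_cng (h1.sub h2) (fun k => ?_) rfl
    rw [mul_pow]; ring
  have hg : ∀ s : ℂ, ‖s‖ < ‖z⁻¹‖ → HasSum
      (fun j => (gcoef φ₀ c j).eval (φ z) * s ^ j)
      (Complex.exp (Complex.log (1 - z * s) - AA a s z⁻¹)) := by
    intro s hs
    have hne : 1 - z * s ≠ 0 := by
      intro h
      have := hlog s hs
      rw [show z * s = 1 by linear_combination -h] at this
      simp at this
    rw [Complex.exp_sub, Complex.exp_log hne]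
    by_cases hs0 : s = 0
    · subst hs0
      have : AA a 0 z⁻¹ = 0 := by simp [AA]
      simp only [this]
      have h := hasSum_single (f := fun j => (gcoef φ₀ c j).eval (φ z) * (0:ℂ) ^ j) 0 (by
        intro j hj; simp [hj])
      simpa [gcoef] using h
    · have h1 := G.laurent_hasSum (s := s) (w := φ z) (hs.trans hu) hs0
      convert h1 using 1
      have h2 := G.gru hz (one_lt_norm_inv (hs.trans hu) hs0)
      rw [inv_inv] at h2
      rw [← mul_sub, h2, Complex.exp_neg]
      field_simp
  have := exp_series_rec' hR hq hg j
  rw [this, ← Finset.sum_neg_distrib]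
  refine Finset.sum_congr rfl fun i _ => ?_
  have : (i : ℂ) + 1 ≠ 0 := by exact_mod_cast i.succ_ne_zero
  simp [SS]
  field_simp
  ring

/-- Existence of Faber polynomials. -/
lemma faber (G : GH φ φ₀ c a) : ∃ Φ : ℕ → Polynomial ℂ, ∀ k, ∀ z : ℂ, 1 < ‖z‖ →
    (Φ k).eval (φ z) = SS a k z := by
  have : ∀ k, ∃ Φ : Polynomial ℂ, ∀ z : ℂ, 1 < ‖z‖ → Φ.eval (φ z) = SS a k z := by
    intro k
    induction k using Nat.strong_induction_on with
    | _ k ih =>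
      choose! Φ hΦ using ih
      refine ⟨- (Polynomial.C ((k : ℂ) + 1) * gcoef φ₀ c (k + 1)) -
        ∑ i ∈ Finset.range k, Φ i * gcoef φ₀ c (k - i), fun z hz => ?_⟩
      have := G.SS_rec hz k
      rw [Finset.sum_range_succ] at this
      simp only [Polynomial.eval_sub, Polynomial.eval_neg, Polynomial.eval_mul, Polynomial.eval_C,
        Polynomial.eval_finsetSum]
      rw [this]
      have h2 : ∀ i ∈ Finset.range k, (Φ i).eval (φ z) * (gcoef φ₀ c (k - i)).eval (φ z) =
          SS a i z * (gcoef φ₀ c (k - i)).eval (φ z) := by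
        intro i hi
        rw [hΦ i (by simpa using hi) z hz]
      rw [Finset.sum_congr rfl h2]
      simp [gcoef]
  choose Φ hΦ using this
  exact ⟨Φ, hΦ⟩

end GH

namespace GH

variable {φ : ℂ → ℂ} {φ₀ : ℂ} {c : ℕ → ℂ} {a : ℕ → ℕ → ℂ}

lemma analyticAt (G : GH φ φ₀ c a) {z : ℂ} (hz : 1 < ‖z‖) : AnalyticAt ℂ φ z :=
  G.hφ.analyticAt (isOpen_dom.mem_nhds hz)

/-- `φ(z) - z` is bounded away from the unit circle. -/
lemma bdd (G : GH φ φ₀ c a) {r : ℝ} (hr : 1 < r) : ∃ M, ∀ z : ℂ, r ≤ ‖z‖ → ‖φ z - z‖ ≤ M := by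
  have h0 : ((r : ℝ) : ℂ) ≠ 0 := by
    have : r ≠ 0 := by linarith
    exact_mod_cast this
  have hr' : 1 < ‖(r : ℂ)‖ := by
    rw [Complex.norm_real, Real.norm_eq_abs, abs_of_pos (by linarith)]; exact hr
  have h1 := (G.hLaurent r hr').1
  refine ⟨‖φ₀‖ + ∑' k : ℕ, ‖c k * (r : ℂ) ^ (-(k : ℤ) - 1)‖, fun z hz => ?_⟩
  obtain ⟨h2, h3⟩ := G.hLaurent z (by linarith)
  rw [h3, show z + φ₀ + ∑' k : ℕ, c k * z ^ (-(k : ℤ) - 1) - z =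
    φ₀ + ∑' k : ℕ, c k * z ^ (-(k : ℤ) - 1) by ring]
  refine (norm_add_le _ _).trans ?_
  gcongr
  refine (norm_tsum_le_tsum_norm h2).trans ?_
  refine h2.tsum_le_tsum (fun k => ?_) h1
  simp only [zpow_inv_aux, norm_mul, norm_pow, norm_inv]
  rw [Complex.norm_real, Real.norm_eq_abs, abs_of_pos (by linarith)]
  gcongr

lemma closed_image (G : GH φ φ₀ c a) {r : ℝ} (hr : 1 < r) :
    IsClosed (φ '' {z : ℂ | r ≤ ‖z‖}) := by
  obtain ⟨M, hM⟩ := G.bdd hr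
  rw [← isSeqClosed_iff_isClosed]
  intro w w0 hw hlim
  choose z hz hzw using hw
  have hb : Bornology.IsBounded (Set.range w) := Metric.isBounded_range_of_tendsto w hlim
  obtain ⟨C, hC⟩ := hb.exists_norm_le
  have hzb : ∀ n, z n ∈ Metric.closedBall (0:ℂ) (C + M) := by
    intro n
    have h1 := hM _ (hz n)
    have h2 := hC _ ⟨n, rfl⟩
    rw [← hzw n] at h2
    have : ‖z n‖ ≤ ‖φ (z n)‖ + ‖φ (z n) - z n‖ := by
      calc ‖z n‖ = ‖φ (z n) - (φ (z n) - z n)‖ := by ring_nf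
        _ ≤ _ := norm_sub_le _ _
    simp only [Metric.mem_closedBall, dist_zero_right]
    linarith
  obtain ⟨z0, -, s, hs, hz0⟩ := (isCompact_closedBall (0:ℂ) (C+M)).tendsto_subseq hzb
  have h1 : r ≤ ‖z0‖ := ge_of_tendsto' hz0.norm (fun n => hz _)
  refine ⟨z0, h1, ?_⟩
  have h2 : ContinuousAt φ z0 := (G.analyticAt (hr.trans_le h1)).continuousAt
  have h3 := h2.tendsto.comp hz0
  have h4 := hlim.comp hs.tendsto_atTop
  refine tendsto_nhds_unique h3 (h4.congr fun n => ?_)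
  simp [Function.comp, hzw]

lemma exterior (G : GH φ φ₀ c a) (r : ℝ) :
    ∃ M, ∀ w : ℂ, M < ‖w‖ → ∃ z : ℂ, r < ‖z‖ ∧ 1 < ‖z‖ ∧ φ z = w := by
  set h : ℂ → ℂ := fun s => ∑' j, (gcoef φ₀ c j).eval 0 * s ^ j with hh
  have hsum : ∀ s : ℂ, ‖s‖ < 1 → HasSum (fun j => (gcoef φ₀ c j).eval 0 * s ^ j) (h s) := by
    intro s hs
    by_cases hs0 : s = 0
    · subst hs0
      have h1 : HasSum (fun j => (gcoef φ₀ c j).eval 0 * (0:ℂ) ^ j) _ := hasSum_single 0 (by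
        intro j hj; simp [hj])
      exact h1.summable.hasSum
    · exact (G.laurent_hasSum (w := 0) hs hs0).summable.hasSum
  have hval : ∀ s : ℂ, ‖s‖ < 1 → s ≠ 0 → h s = s * φ s⁻¹ := by
    intro s hs hs0
    have := (hsum s hs).unique (G.laurent_hasSum (w := 0) hs hs0)
    simpa using this
  have h0 : h 0 = 1 := by
    have h1 : HasSum (fun j => (gcoef φ₀ c j).eval 0 * (0:ℂ) ^ j) _ := hasSum_single 0 (by
        intro j hj; simp [hj])
    rw [hh]; simp only; rw [h1.tsum_eq]; simp [gcoef]
  have hd : DifferentiableOn ℂ h (Metric.ball 0 1) := pow_differentiableOn one_pos hsum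
  have han : AnalyticAt ℂ h 0 := hd.analyticAt (Metric.ball_mem_nhds 0 one_pos)
  have han2 : AnalyticAt ℂ (fun s => s / h s) 0 := analyticAt_id.div han (by rw [h0]; exact one_ne_zero)
  have hd1 : HasDerivAt (fun s => s / h s) 1 0 := by
    have := (hasDerivAt_id (0:ℂ)).div han.differentiableAt.hasDerivAt (by rw [h0]; exact one_ne_zero)
    simp only [id, h0, one_mul, zero_mul, sub_zero, one_pow, div_one] at this
    exact this
  have hstr : HasStrictDerivAt (fun s => s / h s) 1 0 := by
    have := han2.hasStrictDerivAt
    rwa [hd1.deriv] at this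
  have hmap := hstr.map_nhds_eq one_ne_zero
  simp only [zero_div] at hmap
  have hU : Metric.ball (0:ℂ) (min 1 (|r| + 1)⁻¹) ∈ nhds (0:ℂ) := Metric.ball_mem_nhds _ (by positivity)
  have hne : ∀ᶠ s in nhds (0:ℂ), h s ≠ 0 := han.continuousAt.eventually_ne (by rw [h0]; exact one_ne_zero)
  have himg : (fun s => s / h s) '' (Metric.ball (0:ℂ) (min 1 (|r| + 1)⁻¹) ∩ {s | h s ≠ 0}) ∈ nhds (0:ℂ) := by
    rw [← hmap]; exact image_mem_map (inter_mem hU hne)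
  obtain ⟨ε, hε, hsub⟩ := Metric.mem_nhds_iff.1 himg
  refine ⟨ε⁻¹, fun w hw => ?_⟩
  have hw0 : 0 < ‖w‖ := lt_trans (by positivity) hw
  have : w⁻¹ ∈ Metric.ball (0:ℂ) ε := by
    simp only [Metric.mem_ball, dist_zero_right, norm_inv]
    exact inv_lt_of_inv_lt₀ hε hw
  obtain ⟨s, ⟨hs1, hs2⟩, hs3⟩ := hsub this
  simp only [Metric.mem_ball, dist_zero_right, lt_min_iff] at hs1
  have hs0 : s ≠ 0 := by
    rintro rfl
    simp at hs3
    have : w = 0 := by simpa using hs3.symm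
    simp [this] at hw0
  refine ⟨s⁻¹, ?_, one_lt_norm_inv hs1.1 hs0, ?_⟩
  · rw [norm_inv]
    have : |r| + 1 < ‖s‖⁻¹ := by
      rw [lt_inv_comm₀ (by positivity) (norm_pos_iff.2 hs0)]; exact hs1.2
    linarith [le_abs_self r]
  · have h5 := hval s hs1.1 hs0
    simp only at hs3
    rw [← inv_inv w, ← hs3, h5]
    rw [inv_div, mul_comm, mul_div_assoc, div_self hs0, mul_one]

end GH

/-- A cutoff profile. -/
structure Cut (η : ℝ → ℝ) (r₁ r₂ : ℝ) : Prop where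
  h1 : 1 < r₁
  cd : ContDiff ℝ 1 η
  zero : ∀ s, s ≤ r₁ → η s = 0
  one : ∀ s, r₂ ≤ s → η s = 1
  nonneg : ∀ s, 0 ≤ η s
  le_one : ∀ s, η s ≤ 1

open Classical in
/-- The cutoff function transported by `φ`. -/
noncomputable def Psi (φ : ℂ → ℂ) (η : ℝ → ℝ) (w : ℂ) : ℝ :=
  if h : ∃ z : ℂ, 1 < ‖z‖ ∧ φ z = w then η ‖h.choose‖ else 0

namespace GH

variable {φ : ℂ → ℂ} {φ₀ : ℂ} {c : ℕ → ℂ} {a : ℕ → ℕ → ℂ} {η : ℝ → ℝ} {r₁ r₂ : ℝ}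

lemma Psi_apply (G : GH φ φ₀ c a) {z : ℂ} (hz : 1 < ‖z‖) : Psi φ η (φ z) = η ‖z‖ := by
  have h : ∃ z' : ℂ, 1 < ‖z'‖ ∧ φ z' = φ z := ⟨z, hz, rfl⟩
  rw [Psi, dif_pos h, G.hinj h.choose_spec.1 hz h.choose_spec.2]

lemma Psi_off {w : ℂ} (h : ¬ ∃ z : ℂ, 1 < ‖z‖ ∧ φ z = w) : Psi φ η w = 0 := by
  rw [Psi, dif_neg h]

lemma Psi_nonneg (C : Cut η r₁ r₂) (w : ℂ) : 0 ≤ Psi φ η w := by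
  unfold Psi; split_ifs
  · exact C.nonneg _
  · exact le_rfl

lemma Psi_le (C : Cut η r₁ r₂) (w : ℂ) : Psi φ η w ≤ 1 := by
  unfold Psi; split_ifs
  · exact C.le_one _
  · exact zero_le_one

lemma Psi_far (G : GH φ φ₀ c a) (C : Cut η r₁ r₂) : ∃ M, ∀ w : ℂ, M < ‖w‖ → Psi φ η w = 1 := by
  obtain ⟨M, hM⟩ := G.exterior r₂
  refine ⟨M, fun w hw => ?_⟩
  obtain ⟨z, h1, h2, rfl⟩ := hM w hw
  rw [G.Psi_apply h2, C.one _ h1.le]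

lemma Psi_contDiffAt_off (G : GH φ φ₀ c a) (C : Cut η r₁ r₂) {w : ℂ}
    (h : ¬ ∃ z : ℂ, 1 < ‖z‖ ∧ φ z = w) : Psi φ η =ᶠ[nhds w] fun _ => 0 := by
  have hc := (G.closed_image C.h1).isOpen_compl.mem_nhds (x := w) (by
    rintro ⟨z, hz, rfl⟩
    exact h ⟨z, C.h1.trans_le hz, rfl⟩)
  filter_upwards [hc] with w' hw'
  by_cases h' : ∃ z : ℂ, 1 < ‖z‖ ∧ φ z = w'
  · obtain ⟨z, hz, rfl⟩ := h'
    rw [G.Psi_apply hz]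
    apply C.zero
    by_contra hlt
    exact hw' ⟨z, (not_le.1 hlt).le, rfl⟩
  · exact Psi_off h'

lemma Psi_contDiff (G : GH φ φ₀ c a) (C : Cut η r₁ r₂) : ContDiff ℝ 1 (Psi φ η) := by
  rw [contDiff_iff_contDiffAt]
  intro w
  by_cases h : ∃ z : ℂ, 1 < ‖z‖ ∧ φ z = w
  · obtain ⟨z, hz, rfl⟩ := h
    have hz0 : z ≠ 0 := by rintro rfl; simp at hz; linarith
    have hcd : ContDiffAt ℂ 1 φ z := (G.analyticAt hz).contDiffAt
    have hd := (G.hasDerivAt hz).hasFDerivAt_equiv (Complex.exp_ne_zero _)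
    have hL := hcd.to_localInverse hd one_ne_zero
    set g := hcd.localInverse hd one_ne_zero with hg
    have hgz : g (φ z) = z := hcd.localInverse_apply_image hd one_ne_zero
    have hri : ∀ᶠ w in nhds (φ z), φ (g w) = w :=
      (hcd.hasStrictFDerivAt' hd one_ne_zero).eventually_right_inverse
    have hcont : ContinuousAt g (φ z) := hL.continuousAt
    have hdom : ∀ᶠ w in nhds (φ z), 1 < ‖g w‖ := by
      have := hcont.tendsto
      rw [hgz] at this
      exact this.eventually (isOpen_dom.mem_nhds hz)
    have heq : Psi φ η =ᶠ[nhds (φ z)] fun w => η ‖g w‖ := by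
      filter_upwards [hri, hdom] with w h1 h2
      rw [← G.Psi_apply (η := η) h2, h1]
    refine ContDiffAt.congr_of_eventuallyEq ?_ heq
    have h1 : ContDiffAt ℝ 1 g (φ z) := hL.restrict_scalars ℝ
    have h2 : ContDiffAt ℝ 1 (fun w => ‖g w‖) (φ z) := h1.norm ℝ (by rw [hgz]; exact hz0)
    exact C.cd.contDiffAt.comp _ h2
  · exact contDiffAt_const.congr_of_eventuallyEq (G.Psi_contDiffAt_off C h)

/-- The (doubled) d-bar operator. -/
noncomputable def Dbar (f : ℂ → ℂ) (w : ℂ) : ℂ := fderiv ℝ f w 1 + Complex.I * fderiv ℝ f w Complex.I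

lemma Psi_Dbar (G : GH φ φ₀ c a) (C : Cut η r₁ r₂) {z : ℂ} (hz : 1 < ‖z‖) :
    Dbar (fun w => (Psi φ η w : ℂ)) (φ z) * (starRingEnd ℂ) (deriv φ z) = deriv η ‖z‖ * (z / ‖z‖) := by
  have hz0 : z ≠ 0 := by rintro rfl; simp at hz; linarith
  have hnz : (‖z‖ : ℝ) ≠ 0 := by positivity
  set L := fderiv ℝ (Psi φ η) (φ z) with hL
  have h1 : HasFDerivAt (Psi φ η) L (φ z) :=
    ((G.Psi_contDiff C).differentiable one_ne_zero _).hasFDerivAt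
  have h2 : HasFDerivAt (fun w => (Psi φ η w : ℂ)) (Complex.ofRealCLM.comp L) (φ z) :=
    Complex.ofRealCLM.hasFDerivAt.comp _ h1
  have hφ' : HasFDerivAt φ ((ContinuousLinearMap.toSpanSingleton ℂ (deriv φ z)).restrictScalars ℝ) z :=
    (by simpa [G.deriv_eq hz] using (G.hasDerivAt hz).hasFDerivAt.restrictScalars ℝ)
  have h3 := h1.comp z hφ'
  have h4 : (Psi φ η ∘ φ) =ᶠ[nhds z] fun z => η ‖z‖ := by
    filter_upwards [isOpen_dom.mem_nhds hz] with z' hz'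
    exact G.Psi_apply hz'
  have h5 : HasFDerivAt (fun z : ℂ => ‖z‖) (fderiv ℝ (fun z : ℂ => ‖z‖) z) z :=
    ((contDiffAt_norm ℝ hz0 (n := 1)).differentiableAt one_ne_zero).hasFDerivAt
  have h6 : HasFDerivAt (fun z : ℂ => η ‖z‖) _ z :=
    ((C.cd.differentiable one_ne_zero ‖z‖).hasDerivAt.comp_hasFDerivAt z h5)
  have h7 := (h3.congr_of_eventuallyEq h4.symm).unique h6
  have h9 : ∀ v : ℂ, fderiv ℝ (fun z : ℂ => ‖z‖) z v = (z.re * v.re + z.im * v.im) / ‖z‖ := by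
    intro v
    have e1 := (h5.pow 2).unique (hasStrictFDerivAt_norm_sq (F := ℂ) z).hasFDerivAt
    have e2 := congrArg (fun T => T v) e1
    simp [Complex.inner] at e2
    field_simp
    linarith
  have h8 : ∀ v : ℂ, L (deriv φ z * v) = deriv η ‖z‖ * ((z.re * v.re + z.im * v.im) / ‖z‖) := by
    intro v
    have := congrArg (fun T => T v) h7
    simpa [h9, mul_comm] using this
  have h10 : ∀ x y : ℝ, L (x + y * Complex.I) = x * L 1 + y * L Complex.I := by
    intro x y
    have e1 : (x : ℂ) + y * Complex.I = x • (1 : ℂ) + y • Complex.I := by simp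
    rw [e1, map_add, map_smul, map_smul]; rfl
  set d := deriv φ z with hd
  have e1 := h8 1
  have e2 := h8 Complex.I
  rw [show d * 1 = (d.re : ℂ) + d.im * Complex.I by simp, h10] at e1
  rw [show d * Complex.I = ((-d.im : ℝ) : ℂ) + d.re * Complex.I by
    conv_lhs => rw [← Complex.re_add_im d]
    push_cast
    linear_combination (d.im : ℂ) * Complex.I_sq, h10] at e2
  rw [Dbar, h2.fderiv]
  simp only [ContinuousLinearMap.comp_apply, Complex.ofRealCLM_apply]
  simp only [Complex.one_re, Complex.one_im, Complex.I_re, Complex.I_im] at e1 e2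
  apply Complex.ext
  · simp [Complex.div_re, Complex.div_im]
    field_simp
    field_simp at e1
    linarith
  · simp [Complex.div_re, Complex.div_im]
    field_simp
    field_simp at e2
    linarith

end GH

namespace GH

variable {φ : ℂ → ℂ} {φ₀ : ℂ} {c : ℕ → ℂ} {a : ℕ → ℕ → ℂ} {η : ℝ → ℝ} {r₁ r₂ : ℝ}

lemma Dbar_mul {f g : ℂ → ℂ} {w : ℂ} (hf : DifferentiableAt ℝ f w) (hg : DifferentiableAt ℝ g w) :
    Dbar (fun w => f w * g w) w = Dbar f w * g w + f w * Dbar g w := by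
  have := (hf.hasFDerivAt.mul hg.hasFDerivAt).fderiv
  unfold Dbar
  have h2 : fderiv ℝ (fun w => f w * g w) w = f w • fderiv ℝ g w + g w • fderiv ℝ f w := this
  rw [h2]
  simp only [add_apply, smul_apply, smul_eq_mul]
  ring

lemma Dbar_holo {f : ℂ → ℂ} {w : ℂ} (hf : DifferentiableAt ℂ f w) : Dbar f w = 0 := by
  have h : HasFDerivAt f ((ContinuousLinearMap.toSpanSingleton ℂ (deriv f w)).restrictScalars ℝ) w :=
    (by simpa using (hf.hasDerivAt).hasFDerivAt.restrictScalars ℝ)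
  rw [Dbar, h.fderiv]
  simp
  linear_combination (deriv f w) * Complex.I_sq

lemma Dbar_continuous {f : ℂ → ℂ} (hf : ContDiff ℝ 1 f) : Continuous (Dbar f) := by
  have h1 : Continuous (fderiv ℝ f) := hf.continuous_fderiv one_ne_zero
  unfold Dbar
  fun_prop

lemma integral_Dbar {f : ℂ → ℂ} (hf : ContDiff ℝ 1 f) (hc : HasCompactSupport f) :
    ∫ w, Dbar f w = 0 := by
  have h1 : Continuous (fderiv ℝ f) := hf.continuous_fderiv one_ne_zero
  have hi : ∀ v : ℂ, Integrable (fun w => fderiv ℝ f w v) := by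
    intro v
    refine Continuous.integrable_of_hasCompactSupport (by fun_prop) ?_
    exact (hc.fderiv ℝ).mono (fun w hw => by
      simp only [Function.mem_support] at hw ⊢
      intro h; apply hw; rw [h]; rfl)
  have hz : ∀ v : ℂ, ∫ w, fderiv ℝ f w v = 0 := by
    intro v
    have := integral_mul_fderiv_eq_neg_fderiv_mul_of_integrable (𝕜 := ℂ) (μ := (volume : Measure ℂ))
      (f := fun _ => (1:ℂ)) (g := f) (v := v) (by simp)
      (by simpa using hi v) (by simpa using hf.continuous.integrable_of_hasCompactSupport hc)
      (fun _ _ => by fun_prop)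
      (fun _ _ => hf.differentiable one_ne_zero _)
    simpa using this
  unfold Dbar
  rw [integral_add (hi 1) ((hi _).const_mul _), integral_const_mul, hz, hz]; simp

lemma det_mul (d : ℂ) : ((ContinuousLinearMap.toSpanSingleton ℂ d).restrictScalars ℝ).det = ‖d‖ ^ 2 := by
  rw [← Complex.normSq_eq_norm_sq, ← Algebra.norm_complex_apply, Algebra.norm_apply]
  unfold ContinuousLinearMap.det
  congr 1
  ext <;> simp [mul_comm]

lemma green (G : GH φ φ₀ c a) (C : Cut η r₁ r₂) {g : ℂ → ℂ} (hg : ContDiff ℝ 1 g) (q : Polynomial ℂ) :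
    ∫ w, ((1 - Psi φ η w : ℝ) : ℂ) * (Dbar g w * q.eval w) =
      ∫ z in {z : ℂ | 1 < ‖z‖}, ((deriv η ‖z‖ : ℝ) : ℂ) * (z / ‖z‖) * (g (φ z) * (q.eval (φ z) * deriv φ z)) := by
  obtain ⟨M, hM⟩ := G.Psi_far C
  have hP := G.Psi_contDiff C
  have hPc : ContDiff ℝ 1 (fun w => (Psi φ η w : ℂ)) := Complex.ofRealCLM.contDiff.comp hP
  have hq : ContDiff ℝ 1 (fun w => q.eval w) := by
    have : ContDiff ℂ 1 (fun w => q.eval w) := by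
      have := Polynomial.contDiff_aeval (𝕜 := ℂ) q 1
      simpa using this
    exact this.restrict_scalars ℝ
  have hχc : ContDiff ℝ 1 (fun w => ((1 - Psi φ η w : ℝ) : ℂ)) :=
    Complex.ofRealCLM.contDiff.comp (contDiff_const.sub hP)
  have hsupp : ∀ w : ℂ, w ∉ Metric.closedBall (0:ℂ) M → (1 - Psi φ η w) = 0 := by
    intro w hw
    rw [hM w (by simpa using hw)]; simp
  have hsuppD : ∀ w : ℂ, w ∉ Metric.closedBall (0:ℂ) M → Dbar (fun w => (Psi φ η w : ℂ)) w = 0 := by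
    intro w hw
    have : (fun w => (Psi φ η w : ℂ)) =ᶠ[nhds w] fun _ => 1 := by
      filter_upwards [Metric.isClosed_closedBall.isOpen_compl.mem_nhds hw] with w' hw'
      rw [hM w' (by simpa using hw')]; simp
    rw [Dbar, this.fderiv_eq]; simp
  have hK := isCompact_closedBall (0:ℂ) M
  have h1 := integral_Dbar (f := fun w => ((1 - Psi φ η w : ℝ) : ℂ) * (g w * q.eval w))
    (hχc.mul (hg.mul hq)) (HasCompactSupport.intro hK fun w hw => by rw [hsupp w hw]; simp)
  have h2 : ∀ w, Dbar (fun w => ((1 - Psi φ η w : ℝ) : ℂ) * (g w * q.eval w)) w =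
      ((1 - Psi φ η w : ℝ) : ℂ) * (Dbar g w * q.eval w) -
      Dbar (fun w => (Psi φ η w : ℂ)) w * (g w * q.eval w) := by
    intro w
    have d1 := hχc.differentiable one_ne_zero w
    have d2 := hg.differentiable one_ne_zero w
    have d3 := hq.differentiable one_ne_zero w
    have d4 := hPc.differentiable one_ne_zero w
    have d5 : DifferentiableAt ℝ (fun w => g w * q.eval w) w := d2.mul d3
    rw [Dbar_mul d1 d5, Dbar_mul d2 d3, Dbar_holo (f := fun w => q.eval w) q.differentiableAt]
    have : Dbar (fun w => ((1 - Psi φ η w : ℝ) : ℂ)) w = - Dbar (fun w => (Psi φ η w : ℂ)) w := by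
      have e : (fun w => ((1 - Psi φ η w : ℝ) : ℂ)) = fun w => 1 - (Psi φ η w : ℂ) := by
        funext w; simp
      rw [e, Dbar, Dbar, fderiv_const_sub]
      simp; ring
    rw [this]; ring
  have i1 : Integrable (fun w => ((1 - Psi φ η w : ℝ) : ℂ) * (Dbar g w * q.eval w)) :=
    Continuous.integrable_of_hasCompactSupport
      (hχc.continuous.mul ((Dbar_continuous hg).mul hq.continuous))
      (HasCompactSupport.intro hK fun w hw => by rw [hsupp w hw]; simp)
  have i2 : Integrable (fun w => Dbar (fun w => (Psi φ η w : ℂ)) w * (g w * q.eval w)) :=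
    Continuous.integrable_of_hasCompactSupport
      ((Dbar_continuous hPc).mul (hg.continuous.mul hq.continuous))
      (HasCompactSupport.intro hK fun w hw => by rw [hsuppD w hw]; simp)
  simp_rw [h2] at h1
  rw [integral_sub i1 i2, sub_eq_zero] at h1
  rw [h1]
  have h3 : ∫ w in φ '' {z : ℂ | 1 < ‖z‖}, Dbar (fun w => (Psi φ η w : ℂ)) w * (g w * q.eval w) =
      ∫ w, Dbar (fun w => (Psi φ η w : ℂ)) w * (g w * q.eval w) := by
    apply setIntegral_eq_integral_of_forall_compl_eq_zero
    intro w hw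
    have e := G.Psi_contDiffAt_off C (w := w) (fun ⟨z, h1, h2⟩ => hw ⟨z, h1, h2⟩)
    have : (fun w => (Psi φ η w : ℂ)) =ᶠ[nhds w] fun _ => 0 := by
      filter_upwards [e] with w' hw'
      rw [hw']; simp
    rw [Dbar, this.fderiv_eq]; simp
  rw [← h3, integral_image_eq_integral_abs_det_fderiv_smul volume isOpen_dom.measurableSet
    (f' := fun z => (ContinuousLinearMap.toSpanSingleton ℂ (deriv φ z)).restrictScalars ℝ) _ G.hinj]
  · refine setIntegral_congr_fun isOpen_dom.measurableSet fun z hz => ?_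
    rw [det_mul, abs_of_nonneg (by positivity)]
    have e1 := G.Psi_Dbar C (z := z) hz
    rw [← e1, Complex.real_smul]
    push_cast
    rw [← Complex.conj_mul']
    ring
  · intro z hz
    have := ((G.analyticAt hz).differentiableAt.hasDerivAt).hasFDerivAt.restrictScalars ℝ
    simpa using this.hasFDerivWithinAt

end GH

/-- point on the circle of radius `s` -/
noncomputable def cpt (s θ : ℝ) : ℂ := (s : ℂ) * Complex.exp (Complex.I * (θ : ℂ))

lemma norm_cpt {s : ℝ} (hs : 0 ≤ s) (θ : ℝ) : ‖cpt s θ‖ = s := by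
  rw [cpt, norm_mul, mul_comm Complex.I, Complex.norm_exp_ofReal_mul_I, Complex.norm_real, mul_one,
    Real.norm_eq_abs, abs_of_nonneg hs]

lemma cpt_continuous : Continuous (fun p : ℝ × ℝ => cpt p.1 p.2) := by
  unfold cpt; fun_prop

/-- circle average -/
noncomputable def CI (H : ℂ → ℂ) (s : ℝ) : ℂ := ∫ θ in (-Real.pi)..Real.pi, cpt s θ * H (cpt s θ)

lemma trunc_continuous {H : ℂ → ℂ} (hH : ContinuousOn H {z : ℂ | 1 < ‖z‖}) {r : ℝ} (hr : 1 < r) :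
    Continuous (fun p : ℝ × ℝ => cpt (max p.1 r) p.2 * H (cpt (max p.1 r) p.2)) := by
  have h1 : Continuous (fun p : ℝ × ℝ => cpt (max p.1 r) p.2) :=
    cpt_continuous.comp (f := fun p : ℝ × ℝ => (max p.1 r, p.2)) (by fun_prop)
  refine h1.mul (hH.comp_continuous h1 fun p => ?_)
  rw [Set.mem_ofPred_eq, norm_cpt (by have := le_max_right p.1 r; linarith)]
  exact lt_max_of_lt_right hr

lemma CI_continuousOn {H : ℂ → ℂ} (hH : ContinuousOn H {z : ℂ | 1 < ‖z‖}) {r : ℝ} (hr : 1 < r) :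
    Continuous (fun s => CI H (max s r)) := by
  unfold CI
  exact intervalIntegral.continuous_parametric_intervalIntegral_of_continuous'
    (f := fun s θ => cpt (max s r) θ * H (cpt (max s r) θ)) (trunc_continuous hH hr) _ _

lemma Cut.deriv_zero {η : ℝ → ℝ} {r₁ r₂ : ℝ} (C : Cut η r₁ r₂) {s : ℝ} (hs : s ∉ Set.Icc r₁ r₂) :
    deriv η s = 0 := by
  rw [Set.mem_Icc, not_and_or, not_le, not_le] at hs
  rcases hs with h | h
  · have : η =ᶠ[nhds s] fun _ => 0 := by
      filter_upwards [isOpen_Iio.mem_nhds h] with x hx using C.zero x (le_of_lt hx)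
    rw [this.deriv_eq]; simp
  · have : η =ᶠ[nhds s] fun _ => 1 := by
      filter_upwards [isOpen_Ioi.mem_nhds h] with x hx using C.one x (le_of_lt hx)
    rw [this.deriv_eq]; simp

lemma polar_int {η : ℝ → ℝ} {r₁ r₂ : ℝ} (C : Cut η r₁ r₂) {H : ℂ → ℂ}
    (hH : ContinuousOn H {z : ℂ | 1 < ‖z‖}) :
    ∫ z in {z : ℂ | 1 < ‖z‖}, ((deriv η ‖z‖ : ℝ) : ℂ) * (z / ‖z‖) * H z =
      ∫ s in Set.Icc r₁ r₂, deriv η s • CI H s := by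
  have hr := C.h1
  rw [← integral_indicator GH.isOpen_dom.measurableSet, ← Complex.integral_comp_polarCoord_symm]
  have hK : IsCompact (Set.Icc r₁ r₂ ×ˢ Set.Icc (-Real.pi) Real.pi) := isCompact_Icc.prod isCompact_Icc
  set F : ℝ × ℝ → ℂ := fun p => deriv η p.1 • (cpt (max p.1 r₁) p.2 * H (cpt (max p.1 r₁) p.2)) with hF
  have hFc : Continuous F := by
    have h1 : Continuous (deriv η) := C.cd.continuous_deriv le_rfl
    exact (h1.comp continuous_fst).smul (trunc_continuous hH hr)
  have hFz : ∀ p : ℝ × ℝ, p.1 ∉ Set.Icc r₁ r₂ → F p = 0 := by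
    intro p hp; simp only [hF]; rw [C.deriv_zero hp, zero_smul]
  have hi : IntegrableOn F (Set.Icc r₁ r₂ ×ˢ Set.Ioo (-Real.pi) Real.pi) :=
    (hFc.continuousOn.integrableOn_compact hK).mono_set (Set.prod_mono le_rfl Set.Ioo_subset_Icc_self)
  have e1 : ∫ p in polarCoord.target, p.1 • ({z : ℂ | 1 < ‖z‖}.indicator
      (fun z => ((deriv η ‖z‖ : ℝ) : ℂ) * (z / ‖z‖) * H z) (Complex.polarCoord.symm p)) =
      ∫ p in Set.Ioi (0:ℝ) ×ˢ Set.Ioo (-Real.pi) Real.pi, F p := by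
    refine setIntegral_congr_fun (measurableSet_Ioi.prod measurableSet_Ioo) fun p hp => ?_
    have hp0 : 0 < p.1 := hp.1
    have e2 : Complex.polarCoord.symm p = cpt p.1 p.2 := by
      rw [Complex.polarCoord_symm_apply, cpt, mul_comm Complex.I, Complex.exp_mul_I,
        Complex.ofReal_cos, Complex.ofReal_sin]
    simp only [e2]
    by_cases hp1 : p.1 ∈ Set.Icc r₁ r₂
    · have hp2 : 1 < ‖cpt p.1 p.2‖ := by rw [norm_cpt hp0.le]; exact hr.trans_le hp1.1
      rw [Set.indicator_of_mem (show cpt p.1 p.2 ∈ {z : ℂ | 1 < ‖z‖} from hp2), norm_cpt hp0.le]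
      simp only [hF]
      rw [max_eq_left hp1.1, Complex.real_smul, Complex.real_smul]
      have : (p.1 : ℂ) ≠ 0 := by exact_mod_cast hp0.ne'
      field_simp
    · rw [hFz p hp1]
      by_cases hp2 : 1 < ‖cpt p.1 p.2‖
      · rw [Set.indicator_of_mem (show cpt p.1 p.2 ∈ {z : ℂ | 1 < ‖z‖} from hp2), norm_cpt hp0.le,
          C.deriv_zero hp1]; simp
      · rw [Set.indicator_of_notMem (show cpt p.1 p.2 ∉ {z : ℂ | 1 < ‖z‖} from hp2)]; simp
  rw [e1]
  have e3 : ∫ p in Set.Ioi (0:ℝ) ×ˢ Set.Ioo (-Real.pi) Real.pi, F p =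
      ∫ p in Set.Icc r₁ r₂ ×ˢ Set.Ioo (-Real.pi) Real.pi, F p := by
    apply setIntegral_eq_of_subset_of_forall_sdiff_eq_zero (measurableSet_Ioi.prod measurableSet_Ioo)
    · refine Set.prod_mono (fun x hx => ?_) le_rfl
      have := hx.1
      show 0 < x
      linarith
    · rintro p ⟨h1, h2⟩
      apply hFz
      intro h3
      exact h2 ⟨h3, h1.2⟩
  rw [e3, Measure.volume_eq_prod, setIntegral_prod F (by rw [← Measure.volume_eq_prod]; exact hi)]
  refine setIntegral_congr_fun measurableSet_Icc fun s hs => ?_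
  simp only [hF]
  rw [integral_smul, CI, intervalIntegral.integral_of_le (by linarith [Real.pi_pos]), integral_Ioc_eq_integral_Ioo,
    max_eq_left hs.1]

/-- explicit cutoffs concentrating at `r` -/
noncomputable def eta (r : ℝ) (n : ℕ) (s : ℝ) : ℝ := Real.smoothTransition ((n + 1) * (s - r))

lemma eta_cut {r : ℝ} (hr : 1 < r) (n : ℕ) : Cut (eta r n) r (r + 1 / (n + 1)) where
  h1 := hr
  cd := by
    have : ContDiff ℝ 1 Real.smoothTransition := Real.smoothTransition.contDiff (n := 1)
    exact this.comp (by fun_prop)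
  zero s hs := Real.smoothTransition.zero_of_nonpos (mul_nonpos_of_nonneg_of_nonpos (by positivity) (by linarith))
  one s hs := Real.smoothTransition.one_of_one_le (by
    have : (1:ℝ) / (n + 1) ≤ s - r := by linarith
    rw [div_le_iff₀ (by positivity)] at this
    linarith)
  nonneg s := Real.smoothTransition.nonneg _
  le_one s := Real.smoothTransition.le_one _

lemma eta_mono (r : ℝ) (n : ℕ) : Monotone (eta r n) := by
  intro x y hxy
  apply Real.smoothTransition.monotone
  gcongr

lemma eta_limit {r : ℝ} (hr : 1 < r) {H : ℂ → ℂ} (hH : ContinuousOn H {z : ℂ | 1 < ‖z‖}) :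
    Tendsto (fun n : ℕ => ∫ s in Set.Icc r (r + 1 / (n + 1)), deriv (eta r n) s • CI H s) atTop
      (nhds (CI H r)) := by
  have hc := CI_continuousOn hH hr
  rw [Metric.tendsto_atTop]
  intro ε hε
  obtain ⟨δ, hδ, hcl⟩ := Metric.continuousAt_iff.1 (hc.continuousAt (x := r)) (ε/2) (by positivity)
  obtain ⟨N, hN⟩ := exists_nat_one_div_lt hδ
  refine ⟨N, fun n hn => ?_⟩
  have C := eta_cut hr n
  have hn1 : (1:ℝ) / (n + 1) < δ := lt_of_le_of_lt (by gcongr) hN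
  have hpos : (0:ℝ) < 1 / (n + 1) := by positivity
  have hder : Continuous (deriv (eta r n)) := C.cd.continuous_deriv le_rfl
  have hnn : ∀ s, 0 ≤ deriv (eta r n) s := fun s => (eta_mono r n).deriv_nonneg
  have e1 : ∫ s in Set.Icc r (r + 1 / (n + 1)), deriv (eta r n) s • CI H s =
      ∫ s in r..(r + 1 / (n + 1)), deriv (eta r n) s • CI H (max s r) := by
    rw [intervalIntegral.integral_of_le (by linarith), ← integral_Icc_eq_integral_Ioc]
    exact setIntegral_congr_fun measurableSet_Icc fun s hs => by simp only [max_eq_left hs.1]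
  have e2 : ∫ s in r..(r + 1 / (n + 1)), deriv (eta r n) s = 1 := by
    rw [intervalIntegral.integral_deriv_eq_sub (fun x _ => C.cd.differentiable one_ne_zero x)
      (hder.intervalIntegrable _ _), C.one _ le_rfl, C.zero _ le_rfl, sub_zero]
  have e3 : CI H r = ∫ s in r..(r + 1 / (n + 1)), deriv (eta r n) s • CI H r := by
    rw [intervalIntegral.integral_smul_const, e2, one_smul]
  rw [e1, dist_eq_norm]
  conv_lhs => rw [e3]
  have i1 : IntervalIntegrable (fun s => deriv (eta r n) s • CI H (max s r)) volume r (r + 1 / (n + 1)) :=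
    (hder.smul hc).intervalIntegrable _ _
  have i2 : IntervalIntegrable (fun s => deriv (eta r n) s • CI H r) volume r (r + 1 / (n + 1)) :=
    (hder.smul continuous_const).intervalIntegrable _ _
  rw [← intervalIntegral.integral_sub i1 i2]
  have e4 : ‖∫ s in r..(r + 1 / (n + 1)), (deriv (eta r n) s • CI H (max s r) - deriv (eta r n) s • CI H r)‖
      ≤ ∫ s in r..(r + 1 / (n + 1)), deriv (eta r n) s * (ε / 2) := by
    apply intervalIntegral.norm_integral_le_of_norm_le (by linarith)
    · refine Eventually.of_forall fun s hs => ?_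
      rw [← smul_sub, norm_smul, Real.norm_eq_abs, abs_of_nonneg (hnn s)]
      refine mul_le_mul_of_nonneg_left ?_ (hnn s)
      have := @hcl s (by rw [Real.dist_eq, abs_lt]; constructor <;> linarith [hs.1, hs.2])
      rw [max_self, dist_eq_norm] at this
      exact this.le
    · exact (hder.mul continuous_const).intervalIntegrable _ _
  rw [intervalIntegral.integral_mul_const, e2] at e4
  linarith

namespace GH

variable {φ : ℂ → ℂ} {φ₀ : ℂ} {c : ℕ → ℂ} {a : ℕ → ℕ → ℂ}

/-- boundary integrals -/
noncomputable def JJ (φ : ℂ → ℂ) (g : ℂ → ℂ) (q : Polynomial ℂ) (r : ℝ) : ℂ :=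
  CI (fun z => g (φ z) * (q.eval (φ z) * deriv φ z)) r

lemma green_limit (G : GH φ φ₀ c a) {g : ℂ → ℂ} (hg : ContDiff ℝ 1 g) (q : Polynomial ℂ)
    {r : ℝ} (hr : 1 < r) :
    Tendsto (fun n : ℕ => ∫ w, ((1 - Psi φ (eta r n) w : ℝ) : ℂ) * (Dbar g w * q.eval w)) atTop
      (nhds (JJ φ g q r)) := by
  have hH : ContinuousOn (fun z => g (φ z) * (q.eval (φ z) * deriv φ z)) {z : ℂ | 1 < ‖z‖} := by
    have h1 : ContinuousOn φ {z : ℂ | 1 < ‖z‖} := G.hφ.continuousOn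
    have h2 : ContinuousOn (deriv φ) {z : ℂ | 1 < ‖z‖} :=
      (G.hφ.deriv isOpen_dom).continuousOn
    exact (hg.continuous.comp_continuousOn h1).mul ((q.continuous.comp_continuousOn h1).mul h2)
  refine (eta_limit hr hH).congr fun n => ?_
  rw [G.green (eta_cut hr n) hg q, polar_int (eta_cut hr n) hH]

lemma hasFDerivAt_poly (P : Polynomial ℂ) (w : ℂ) :
    HasFDerivAt (fun w => P.eval w)
      ((ContinuousLinearMap.toSpanSingleton ℂ (P.derivative.eval w)).restrictScalars ℝ) w := by
  simpa using (P.hasDerivAt w).hasFDerivAt.restrictScalars ℝ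

lemma contDiff_poly (P : Polynomial ℂ) : ContDiff ℝ 1 (fun w => P.eval w) := by
  have : ContDiff ℂ 1 (fun w => P.eval w) := by
    have := Polynomial.contDiff_aeval (𝕜 := ℂ) P 1
    simpa using this
  exact this.restrict_scalars ℝ

lemma Dbar_conj (P : Polynomial ℂ) (w : ℂ) :
    Dbar (fun w => (starRingEnd ℂ) (P.eval w)) w = 2 * (starRingEnd ℂ) (P.derivative.eval w) := by
  have h := (Complex.conjCLE.toContinuousLinearMap).hasFDerivAt.comp w (hasFDerivAt_poly P w)
  have h2 : HasFDerivAt (fun w => (starRingEnd ℂ) (P.eval w)) _ w := h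
  rw [Dbar, h2.fderiv]
  simp
  ring_nf
  simp
  ring

lemma Dbar_exp (P : Polynomial ℂ) (t : ℝ) (w : ℂ) :
    Dbar (fun w => Complex.exp (Complex.I * ((t * (P.eval w).re : ℝ) : ℂ))) w =
      Complex.I * t * Complex.exp (Complex.I * ((t * (P.eval w).re : ℝ) : ℂ)) *
        (starRingEnd ℂ) (P.derivative.eval w) := by
  have h1 : HasFDerivAt (fun w => (P.eval w).re) _ w :=
    Complex.reCLM.hasFDerivAt.comp w (hasFDerivAt_poly P w)
  have h2 : HasFDerivAt (fun w => ((t * (P.eval w).re : ℝ) : ℂ)) _ w :=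
    Complex.ofRealCLM.hasFDerivAt.comp w (h1.const_mul t)
  have h3 := (h2.const_mul Complex.I).cexp
  rw [Dbar, h3.fderiv]
  simp
  apply Complex.ext <;> simp <;> ring

lemma contDiff_exp (P : Polynomial ℂ) (t : ℝ) :
    ContDiff ℝ 1 (fun w => Complex.exp (Complex.I * ((t * (P.eval w).re : ℝ) : ℂ))) := by
  have h1 : ContDiff ℝ 1 (fun w => (P.eval w).re) := Complex.reCLM.contDiff.comp (contDiff_poly P)
  have h2 : ContDiff ℝ 1 (fun w => ((t * (P.eval w).re : ℝ) : ℂ)) :=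
    Complex.ofRealCLM.contDiff.comp (contDiff_const.mul h1)
  have h3 : ContDiff ℝ 1 Complex.exp := Complex.contDiff_exp
  exact h3.comp (contDiff_const.mul h2)

lemma contDiff_conj (P : Polynomial ℂ) : ContDiff ℝ 1 (fun w => (starRingEnd ℂ) (P.eval w)) :=
  Complex.conjCLE.contDiff.comp (contDiff_poly P)

/-- The energy of a polynomial against the cutoff. -/
noncomputable def EN (φ : ℂ → ℂ) (η : ℝ → ℝ) (P : Polynomial ℂ) : ℝ :=
  ∫ w, (1 - Psi φ η w) * ‖P.derivative.eval w‖ ^ 2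

lemma chi_integrable (G : GH φ φ₀ c a) {η : ℝ → ℝ} {r₁ r₂ : ℝ} (C : Cut η r₁ r₂) {f : ℂ → ℝ}
    (hf : Continuous f) : Integrable (fun w => (1 - Psi φ η w) * f w) := by
  obtain ⟨M, hM⟩ := G.Psi_far C
  refine Continuous.integrable_of_hasCompactSupport
    ((continuous_const.sub (G.Psi_contDiff C).continuous).mul hf)
    (HasCompactSupport.intro (isCompact_closedBall (0:ℂ) M) fun w hw => ?_)
  rw [hM w (by simpa using hw)]; simp

lemma EN_limit (G : GH φ φ₀ c a) (P : Polynomial ℂ) {r : ℝ} (hr : 1 < r) :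
    Tendsto (fun n : ℕ => EN φ (eta r n) P) atTop
      (nhds ((JJ φ (fun w => (starRingEnd ℂ) (P.eval w)) P.derivative r).re / 2)) := by
  have h1 := G.green_limit (contDiff_conj P) P.derivative hr
  have h2 := ((Complex.continuous_re.tendsto _).comp h1).div_const 2
  refine h2.congr fun n => ?_
  have e : ∀ w, ((1 - Psi φ (eta r n) w : ℝ) : ℂ) *
      (Dbar (fun w => (starRingEnd ℂ) (P.eval w)) w * P.derivative.eval w) =
      ((2 * ((1 - Psi φ (eta r n) w) * ‖P.derivative.eval w‖ ^ 2) : ℝ) : ℂ) := by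
    intro w
    rw [Dbar_conj, mul_assoc, Complex.conj_mul']
    push_cast; ring
  simp only [Function.comp, e]
  rw [integral_complex_ofReal, Complex.ofReal_re, integral_const_mul, EN]
  ring

lemma EN_nonneg {η : ℝ → ℝ} {r₁ r₂ : ℝ} (C : Cut η r₁ r₂) (P : Polynomial ℂ) : 0 ≤ EN φ η P :=
  integral_nonneg fun w => mul_nonneg (by linarith [Psi_le (φ := φ) C w]) (by positivity)

theorem JJ_nonneg (G : GH φ φ₀ c a) (P : Polynomial ℂ) {r : ℝ} (hr : 1 < r) :
    0 ≤ (JJ φ (fun w => (starRingEnd ℂ) (P.eval w)) P.derivative r).re := by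
  have := ge_of_tendsto' (G.EN_limit P hr) fun n => EN_nonneg (eta_cut hr n) P
  linarith

theorem JJ_exp (G : GH φ φ₀ c a) (P Q : Polynomial ℂ) (t : ℝ) {L : ℝ} (hL : 0 < L) {r : ℝ} (hr : 1 < r) :
    ‖JJ φ (fun w => Complex.exp (Complex.I * ((t * (P.eval w).re : ℝ) : ℂ))) Q.derivative r‖ ≤
      L * t ^ 2 / 4 * (JJ φ (fun w => (starRingEnd ℂ) (P.eval w)) P.derivative r).re +
      1 / (4 * L) * (JJ φ (fun w => (starRingEnd ℂ) (Q.eval w)) Q.derivative r).re := by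
  have h1 := (G.green_limit (contDiff_exp P t) Q.derivative hr).norm
  have h2 := ((G.EN_limit P hr).const_mul (L * t ^ 2 / 2)).add ((G.EN_limit Q hr).const_mul (1 / (2 * L)))
  refine (le_of_tendsto_of_tendsto' h1 h2 fun n => ?_).trans (le_of_eq ?_)
  · have C := eta_cut hr n
    have i1 := (G.chi_integrable C (f := fun w => ‖P.derivative.eval w‖ ^ 2) (by fun_prop)).const_mul (L * t ^ 2 / 2)
    have i2 := (G.chi_integrable C (f := fun w => ‖Q.derivative.eval w‖ ^ 2) (by fun_prop)).const_mul (1 / (2 * L))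
    rw [EN, EN, ← integral_const_mul, ← integral_const_mul, ← integral_add i1 i2]
    refine norm_integral_le_of_norm_le (i1.add i2) (Eventually.of_forall fun w => ?_)
    have hχ : 0 ≤ 1 - Psi φ (eta r n) w := by linarith [Psi_le (φ := φ) C w]
    rw [Dbar_exp]
    simp only [norm_mul, Complex.norm_I, Complex.norm_exp_I_mul_ofReal, RCLike.norm_conj, Complex.norm_real,
      Real.norm_eq_abs, abs_of_nonneg hχ, one_mul, mul_one]
    set p := ‖P.derivative.eval w‖
    set q := ‖Q.derivative.eval w‖
    have key : |t| * p * q ≤ L * t ^ 2 / 2 * p ^ 2 + 1 / (2 * L) * q ^ 2 := by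
      have h0 : 0 ≤ (L * (|t| * p) - q) ^ 2 := sq_nonneg _
      have h3 : |t| ^ 2 = t ^ 2 := sq_abs t
      have h4 : L * t ^ 2 / 2 * p ^ 2 + 1 / (2 * L) * q ^ 2 - |t| * p * q =
        (L * (|t| * p) - q) ^ 2 / (2 * L) := by
        rw [← h3]; field_simp; ring
      have : 0 ≤ (L * (|t| * p) - q) ^ 2 / (2 * L) := by positivity
      linarith
    calc _ ≤ (1 - Psi φ (eta r n) w) * (L * t ^ 2 / 2 * p ^ 2 + 1 / (2 * L) * q ^ 2) :=
        mul_le_mul_of_nonneg_left key hχ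
      _ = _ := by simp only [p, q]; ring
  · field_simp; ring

end GH

instance fact2pi : Fact (0 < 2 * Real.pi) := ⟨Real.two_pi_pos⟩

/-- The circle. -/
abbrev TT : Type := AddCircle (2 * Real.pi)

/-- Normalized Haar measure on the circle. -/
noncomputable abbrev hm : Measure TT := AddCircle.haarAddCircle

/-- The point of the circle of radius `r`. -/
noncomputable def tpt (r : ℝ) (x : TT) : ℂ := (r : ℂ) * fourier 1 x

lemma norm_fourier_pt (n : ℤ) (x : TT) : ‖fourier n x‖ = 1 := by
  rw [fourier_apply]; exact Circle.norm_coe _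

lemma norm_tpt {r : ℝ} (hr : 0 ≤ r) (x : TT) : ‖tpt r x‖ = r := by
  rw [tpt, norm_mul, norm_fourier_pt, Complex.norm_real, Real.norm_eq_abs, abs_of_nonneg hr, mul_one]

lemma tpt_coe (r θ : ℝ) : tpt r (θ : TT) = cpt r θ := by
  rw [tpt, cpt, fourier_coe_apply]
  congr 2
  have : (Real.pi : ℂ) ≠ 0 := by exact_mod_cast Real.pi_ne_zero
  push_cast
  field_simp

lemma tpt_continuous (r : ℝ) : Continuous (tpt r) := by
  unfold tpt; fun_prop

lemma fourier_pow (n : ℕ) (x : TT) : fourier (n : ℤ) x = (fourier 1 x) ^ n := by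
  induction n with
  | zero => simp
  | succ n ih => rw [Nat.cast_succ, fourier_add, ih, pow_succ]

lemma fourier_neg_pow (n : ℕ) (x : TT) : fourier (-(n : ℤ)) x = ((fourier 1 x)⁻¹) ^ n := by
  rw [fourier_neg, fourier_pow, map_pow]
  congr 1
  rw [Complex.inv_def, Complex.normSq_eq_norm_sq, norm_fourier_pt]; simp

lemma tpt_pow (r : ℝ) (n : ℕ) (x : TT) : tpt r x ^ n = (r : ℂ) ^ n * fourier (n : ℤ) x := by
  rw [tpt, mul_pow, fourier_pow]

lemma tpt_inv_pow (r : ℝ) (n : ℕ) (x : TT) :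
    (tpt r x)⁻¹ ^ n = ((r : ℂ)⁻¹) ^ n * fourier (-(n : ℤ)) x := by
  rw [tpt, mul_inv, mul_pow, fourier_neg_pow]

lemma CI_eq (H : ℂ → ℂ) (r : ℝ) :
    CI H r = (2 * Real.pi : ℝ) * ∫ x : TT, tpt r x * H (tpt r x) ∂hm := by
  rw [AddCircle.integral_haarAddCircle]
  have h := AddCircle.intervalIntegral_preimage (2 * Real.pi) (-Real.pi) (fun x : TT => tpt r x * H (tpt r x))
  rw [← h, CI, show -Real.pi + 2 * Real.pi = Real.pi by ring, Complex.real_smul, ← mul_assoc,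
    ← Complex.ofReal_mul, mul_inv_cancel₀ Real.two_pi_pos.ne']
  simp [tpt_coe]

lemma parseval_cont (v : C(TT, ℂ)) :
    HasSum (fun n => ‖fourierCoeff v n‖ ^ 2) (∫ x, ‖v x‖ ^ 2 ∂hm) := by
  have h := hasSum_sq_fourierCoeff (ContinuousMap.toLp (E := ℂ) 2 hm ℂ v)
  have e : (ContinuousMap.toLp (E := ℂ) 2 hm ℂ v : TT → ℂ) =ᵐ[hm] v :=
    ContinuousMap.coeFn_toLp hm v
  have h2 : ∫ t, ‖(ContinuousMap.toLp (E := ℂ) 2 hm ℂ v : TT → ℂ) t‖ ^ 2 ∂hm = ∫ x, ‖v x‖ ^ 2 ∂hm := by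
    refine integral_congr_ae ?_
    filter_upwards [e] with x hx
    rw [hx]
  rw [h2] at h
  simpa only [fourierCoeff_toLp] using h

lemma pairing {ι : Type*} [Countable ι] (g : C(TT, ℂ)) (c : ι → ℂ) (e : ι → ℤ)
    (hc : Summable (fun i => ‖c i‖)) {F : TT → ℂ}
    (hF : ∀ x, HasSum (fun i => c i * fourier (e i) x) (F x)) :
    HasSum (fun i => c i * fourierCoeff g (-(e i))) (∫ x, g x * F x ∂hm) := by
  have h := hasSum_integral_of_summable_integral_norm (μ := hm)
    (F := fun i (x : TT) => g x * (c i * fourier (e i) x)) (fun i =>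
      (by fun_prop : Continuous fun x : TT => g x * (c i * fourier (e i) x)).integrable_of_hasCompactSupport
        (HasCompactSupport.of_compactSpace _)) ?_
  · have e1 : ∀ x, ∑' i, g x * (c i * fourier (e i) x) = g x * F x := fun x =>
      ((hF x).mul_left (g x)).tsum_eq
    simp only [e1] at h
    refine hasSum_cng h (fun i => ?_) rfl
    rw [fourierCoeff, ← integral_const_mul]
    congr 1; ext x
    rw [neg_neg, smul_eq_mul]; ring
  · refine Summable.of_nonneg_of_le (fun i => integral_nonneg fun x => norm_nonneg _) (fun i => ?_)
      (hc.mul_left ‖g‖)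
    have : ∀ x, ‖g x * (c i * fourier (e i) x)‖ ≤ ‖g‖ * ‖c i‖ := fun x => by
      rw [norm_mul, norm_mul, norm_fourier_pt, mul_one]
      exact mul_le_mul_of_nonneg_right (g.norm_coe_le_norm x) (norm_nonneg _)
    calc ∫ x, ‖g x * (c i * fourier (e i) x)‖ ∂hm ≤ ∫ x, ‖g‖ * ‖c i‖ ∂hm := by
          refine integral_mono ?_ (integrable_const _) this
          exact (by fun_prop : Continuous fun x : TT => ‖g x * (c i * fourier (e i) x)‖).integrable_of_hasCompactSupport
            (HasCompactSupport.of_compactSpace _)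
      _ = ‖g‖ * ‖c i‖ := by simp

/-- termwise derivative of a power series -/
lemma pow_deriv {q : ℕ → ℂ} {f : ℂ → ℂ} 
    (h : ∀ s : ℂ, ‖s‖ < 1 → HasSum (fun j => q j * s ^ j) (f s)) {s : ℂ} (hs : ‖s‖ < 1) :
    HasSum (fun j : ℕ => ((j : ℂ) + 1) * q (j + 1) * s ^ j) (deriv f s) := by
  have hd := pow_differentiableOn one_pos h
  have h1 := tayC_hasSum (hd.deriv Metric.isOpen_ball) hs
  refine hasSum_cng h1 (fun j => ?_) rfl
  congr 1
  rw [← tayC_eq one_pos h, tayC, tayC, iteratedDeriv_succ', Nat.factorial_succ]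
  have a1 : (j.factorial : ℂ) ≠ 0 := by exact_mod_cast j.factorial_ne_zero
  have a2 : (j : ℂ) + 1 ≠ 0 := by exact_mod_cast j.succ_ne_zero
  push_cast
  field_simp

/-- `√(k+1)` -/
noncomputable def sqk (k : ℕ) : ℝ := Real.sqrt ((k : ℝ) + 1)

lemma sqk_pos (k : ℕ) : 0 < sqk k := Real.sqrt_pos.2 (by positivity)
lemma sqk_sqk (k : ℕ) : sqk k * sqk k = (k : ℝ) + 1 := Real.mul_self_sqrt (by positivity)
lemma sqk_sqkC (k : ℕ) : (sqk k : ℂ) * sqk k = (k : ℂ) + 1 := by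
  rw [← Complex.ofReal_mul, sqk_sqk]; push_cast; rfl
lemma sqk_ne (k : ℕ) : (sqk k : ℂ) ≠ 0 := by exact_mod_cast (sqk_pos k).ne'

/-- normalized Grunsky coefficients -/
noncomputable def bb (a : ℕ → ℕ → ℂ) (k l : ℕ) : ℂ := ((sqk k * sqk l : ℝ) : ℂ) * a (k + 1) (l + 1)

/-- the image of a finite vector -/
noncomputable def yy (a : ℕ → ℕ → ℂ) (N : ℕ) (x : ℕ → ℂ) (l : ℕ) : ℂ := ∑ k ∈ Finset.range N, bb a k l * x k

/-- exponents -/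
def ee : ℕ ⊕ ℕ → ℤ := Sum.elim (fun k => ((k + 1 : ℕ) : ℤ)) (fun l => -((l + 1 : ℕ) : ℤ))

lemma ee_inj : Function.Injective ee := by
  rintro (k | k) (l | l) h <;> simp [ee] at h ⊢ <;> omega

lemma fcoef {f : C(TT, ℂ)} {c : ℕ ⊕ ℕ → ℂ} (hc : Summable (fun i => ‖c i‖))
    (hF : ∀ x, HasSum (fun i => c i * fourier (ee i) x) (f x)) (i : ℕ ⊕ ℕ) :
    fourierCoeff f (ee i) = c i := by
  have h := pairing (fourier (-(ee i))) c ee hc hF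
  have h2 : ∫ x, fourier (-(ee i)) x * f x ∂hm = fourierCoeff f (ee i) := rfl
  rw [h2] at h
  refine h.unique (hasSum_cng (hasSum_ite_eq i (c i)) (fun j => ?_) rfl)
  rw [fourierCoeff_fourier]
  by_cases hj : j = i
  · subst hj; simp
  · have : -ee j ≠ -ee i := fun h => hj (ee_inj (neg_injective h))
    simp [hj, this]

lemma fcoef_conj (f : C(TT, ℂ)) (n : ℤ) :
    fourierCoeff (star f : C(TT, ℂ)) n = (starRingEnd ℂ) (fourierCoeff f (-n)) := by
  rw [fourierCoeff, fourierCoeff, ← integral_conj]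
  congr 1; ext x
  simp

namespace GH

variable {φ : ℂ → ℂ} {φ₀ : ℂ} {c : ℕ → ℂ} {a : ℕ → ℕ → ℂ}

lemma bb_sym (G : GH φ φ₀ c a) (k l : ℕ) : bb a k l = bb a l k := by
  rw [bb, bb, G.hsym, mul_comm (sqk k)]

lemma bb_summ (G : GH φ φ₀ c a) : Summable (fun p : ℕ × ℕ => ‖bb a p.1 p.2‖ ^ 2) := by
  refine G.hWP.congr fun p => ?_
  rw [bb, norm_mul, mul_pow, Complex.norm_real, Real.norm_eq_abs, sq_abs]
  push_cast
  rw [mul_pow, pow_two (sqk p.1), pow_two (sqk p.2), sqk_sqk, sqk_sqk]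

lemma bb_bdd (G : GH φ φ₀ c a) : ∃ C : ℝ, 0 ≤ C ∧ ∀ k l, ‖bb a k l‖ ≤ C := by
  refine ⟨Real.sqrt (∑' p : ℕ × ℕ, ‖bb a p.1 p.2‖ ^ 2), Real.sqrt_nonneg _, fun k l => ?_⟩
  refine Real.le_sqrt_of_sq_le ?_
  exact G.bb_summ.le_tsum (k, l) fun j _ => by positivity

/-- combination of Faber polynomials -/
noncomputable def PP (Φ : ℕ → Polynomial ℂ) (N : ℕ) (x : ℕ → ℂ) : Polynomial ℂ :=
  ∑ k ∈ Finset.range N, Polynomial.C (x k / sqk k) * Φ k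

/-- The negative part. -/
noncomputable def hneg (a : ℕ → ℕ → ℂ) (N : ℕ) (x : ℕ → ℂ) (u : ℂ) : ℂ :=
  ∑ k ∈ Finset.range N, x k * sqk k * alp a k u

lemma hneg_hasSum (G : GH φ φ₀ c a) (N : ℕ) (x : ℕ → ℂ) {u : ℂ} (hu : ‖u‖ < 1) :
    HasSum (fun l => yy a N x l / sqk l * u ^ (l + 1)) (hneg a N x u) := by
  have := hasSum_sum (s := Finset.range N) (f := fun k l => x k * sqk k * (a (k + 1) (l + 1) * u ^ (l + 1)))
    (fun k _ => (G.alp_hasSum k hu).mul_left (x k * sqk k))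
  refine hasSum_cng this (fun l => ?_) rfl
  rw [yy, Finset.sum_div, Finset.sum_mul]
  refine Finset.sum_congr rfl fun k _ => ?_
  rw [bb]
  have := sqk_ne l
  push_cast
  field_simp

lemma PP_eval {Φ : ℕ → Polynomial ℂ}
    (hΦ : ∀ k, ∀ z : ℂ, 1 < ‖z‖ → (Φ k).eval (φ z) = SS a k z) (N : ℕ) (x : ℕ → ℂ) {z : ℂ} (hz : 1 < ‖z‖) :
    (PP Φ N x).eval (φ z) = ∑ k ∈ Finset.range N, x k / sqk k * z ^ (k + 1) + hneg a N x z⁻¹ := by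
  rw [PP, Polynomial.eval_finsetSum, hneg, ← Finset.sum_add_distrib]
  refine Finset.sum_congr rfl fun k _ => ?_
  rw [Polynomial.eval_mul, Polynomial.eval_C, hΦ k z hz, SS, ← sqk_sqkC]
  have := sqk_ne k
  field_simp

lemma hneg_hasSum' (G : GH φ φ₀ c a) (N : ℕ) (x : ℕ → ℂ) {u : ℂ} (hu : ‖u‖ < 1) :
    HasSum (fun j : ℕ => (if j = 0 then 0 else yy a N x (j - 1) / sqk (j - 1)) * u ^ j) (hneg a N x u) := by
  rw [← hasSum_nat_add_iff' 1]
  refine hasSum_cng (G.hneg_hasSum N x hu) (fun j => ?_) ?_ <;> simp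

lemma hneg_deriv (G : GH φ φ₀ c a) (N : ℕ) (x : ℕ → ℂ) {u : ℂ} (hu : ‖u‖ < 1) :
    HasSum (fun l => yy a N x l * sqk l * u ^ l) (deriv (hneg a N x) u) := by
  refine hasSum_cng (pow_deriv (fun s hs => G.hneg_hasSum' N x hs) hu) (fun j => ?_) rfl
  have := sqk_ne j
  simp only [Nat.add_eq_zero_iff, one_ne_zero, and_false, if_false, Nat.add_sub_cancel]
  rw [← sqk_sqkC]; field_simp

lemma hneg_diff (G : GH φ φ₀ c a) (N : ℕ) (x : ℕ → ℂ) {u : ℂ} (hu : ‖u‖ < 1) :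
    HasDerivAt (hneg a N x) (deriv (hneg a N x) u) u := by
  have := pow_differentiableOn one_pos (fun s hs => G.hneg_hasSum' N x hs)
  exact (this.differentiableAt (Metric.isOpen_ball.mem_nhds (by simpa using hu))).hasDerivAt

lemma PP_deriv (G : GH φ φ₀ c a) {Φ : ℕ → Polynomial ℂ}
    (hΦ : ∀ k, ∀ z : ℂ, 1 < ‖z‖ → (Φ k).eval (φ z) = SS a k z) (N : ℕ) (x : ℕ → ℂ) {z : ℂ} (hz : 1 < ‖z‖) :
    z * ((PP Φ N x).derivative.eval (φ z) * deriv φ z) =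
      ∑ k ∈ Finset.range N, x k * sqk k * z ^ (k + 1) - z⁻¹ * deriv (hneg a N x) z⁻¹ := by
  have hz0 : z ≠ 0 := norm_pos_iff.1 (by linarith)
  have h1 : HasDerivAt (fun w => (PP Φ N x).eval (φ w)) ((PP Φ N x).derivative.eval (φ z) * deriv φ z) z :=
    ((PP Φ N x).hasDerivAt (φ z)).comp z (G.hφ.differentiableAt (isOpen_dom.mem_nhds hz)).hasDerivAt
  have h2 : HasDerivAt (fun w => ∑ k ∈ Finset.range N, x k / sqk k * w ^ (k + 1) + hneg a N x w⁻¹)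
      (∑ k ∈ Finset.range N, x k / sqk k * ((k + 1 : ℕ) * z ^ k) + deriv (hneg a N x) z⁻¹ * (-(z ^ 2)⁻¹)) z := by
    refine HasDerivAt.add ?_ ?_
    · refine HasDerivAt.fun_sum fun k _ => ?_
      simpa using (hasDerivAt_pow (k + 1) z).const_mul (x k / sqk k)
    · exact (G.hneg_diff N x (norm_inv_lt hz)).comp z (hasDerivAt_inv hz0)
  have e : (fun w => (PP Φ N x).eval (φ w)) =ᶠ[nhds z]
      (fun w => ∑ k ∈ Finset.range N, x k / sqk k * w ^ (k + 1) + hneg a N x w⁻¹) := by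
    filter_upwards [isOpen_dom.mem_nhds hz] with w hw using PP_eval hΦ N x hw
  rw [h1.unique (h2.congr_of_eventuallyEq e), mul_add, Finset.mul_sum, sub_eq_add_neg]
  congr 1
  · refine Finset.sum_congr rfl fun k _ => ?_
    push_cast
    rw [← sqk_sqkC]
    have := sqk_ne k
    field_simp
    ring
  · field_simp

end GH

namespace GH

variable {φ : ℂ → ℂ} {φ₀ : ℂ} {c : ℕ → ℂ} {a : ℕ → ℕ → ℂ}

lemma bound_geom {r : ℝ} (hr : 1 < r) : Summable (fun l : ℕ => (r⁻¹) ^ (l + 1)) := by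
  have h : Summable (fun l : ℕ => (r⁻¹) ^ l) :=
    summable_geometric_of_lt_one (by positivity) (inv_lt_one_of_one_lt₀ hr)
  exact (summable_nat_add_iff 1).2 h

lemma bound_geom' {r : ℝ} (hr : 1 < r) : Summable (fun l : ℕ => ((l : ℝ) + 1) * (r⁻¹) ^ (l + 1)) := by
  have h := summable_pow_mul_geometric_of_norm_lt_one 1 (r := r⁻¹)
    (by rw [Real.norm_eq_abs, abs_of_pos (by positivity)]; exact inv_lt_one_of_one_lt₀ hr)
  have h2 := (summable_nat_add_iff 1).2 h
  simpa using h2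

lemma sqk_le (l : ℕ) : sqk l ≤ (l : ℝ) + 1 := by
  rw [sqk]
  exact Real.sqrt_le_self_iff.2 (Or.inr (by have : (0:ℝ) ≤ l := by positivity
                                            linarith))

lemma one_le_sqk (l : ℕ) : 1 ≤ sqk l := by
  rw [sqk]
  exact Real.one_le_sqrt.2 (by have : (0:ℝ) ≤ l := by positivity
                               linarith)

/-- coefficients of `P ∘ φ` -/
noncomputable def cf (a : ℕ → ℕ → ℂ) (N : ℕ) (x : ℕ → ℂ) (r : ℝ) : ℕ ⊕ ℕ → ℂ :=
  Sum.elim (fun k => if k < N then x k / sqk k * (r : ℂ) ^ (k + 1) else 0)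
    (fun l => yy a N x l / sqk l * ((r : ℂ)⁻¹) ^ (l + 1))

/-- coefficients of the derivative -/
noncomputable def df (a : ℕ → ℕ → ℂ) (N : ℕ) (x : ℕ → ℂ) (r : ℝ) : ℕ ⊕ ℕ → ℂ :=
  Sum.elim (fun k => if k < N then x k * sqk k * (r : ℂ) ^ (k + 1) else 0)
    (fun l => -(yy a N x l * sqk l * ((r : ℂ)⁻¹) ^ (l + 1)))

lemma yy_bdd (G : GH φ φ₀ c a) (N : ℕ) (x : ℕ → ℂ) : ∃ C : ℝ, 0 ≤ C ∧ ∀ l, ‖yy a N x l‖ ≤ C := by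
  obtain ⟨C, hC, hb⟩ := G.bb_bdd
  refine ⟨∑ k ∈ Finset.range N, C * ‖x k‖, by positivity, fun l => (norm_sum_le _ _).trans ?_⟩
  refine Finset.sum_le_sum fun k _ => ?_
  rw [norm_mul]
  exact mul_le_mul_of_nonneg_right (hb k l) (norm_nonneg _)

lemma hasSum_fin {N : ℕ} {g : ℕ → ℂ} : HasSum (fun k => if k < N then g k else 0) (∑ k ∈ Finset.range N, g k) := by
  have : ∑ k ∈ Finset.range N, g k = ∑ k ∈ Finset.range N, (if k < N then g k else 0) :=
    Finset.sum_congr rfl fun k hk => by simp [Finset.mem_range.1 hk]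
  rw [this]
  exact hasSum_sum_of_ne_finset_zero fun k hk => by simp_all

lemma summ_fin {N : ℕ} {g : ℕ → ℂ} : Summable (fun k => ‖if k < N then g k else 0‖) :=
  (hasSum_fin (N := N) (g := g)).summable.norm

lemma df_summ (G : GH φ φ₀ c a) (N : ℕ) (x : ℕ → ℂ) {r : ℝ} (hr : 1 < r) :
    Summable (fun i => ‖df a N x r i‖) := by
  obtain ⟨C, hC, hb⟩ := G.yy_bdd N x
  refine Summable.sum _ summ_fin ?_
  refine Summable.of_nonneg_of_le (fun _ => norm_nonneg _) (fun l => ?_) ((bound_geom' hr).mul_left C)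
  simp only [df, Function.comp, Sum.elim_inr, norm_neg, norm_mul, norm_pow, norm_inv, Complex.norm_real,
    Real.norm_eq_abs, abs_of_pos (zero_lt_one.trans hr), abs_of_pos (sqk_pos l)]
  rw [mul_assoc]
  have := hb l
  have := sqk_le l
  have := (sqk_pos l).le
  gcongr

lemma cf_summ (G : GH φ φ₀ c a) (N : ℕ) (x : ℕ → ℂ) {r : ℝ} (hr : 1 < r) :
    Summable (fun i => ‖cf a N x r i‖) := by
  obtain ⟨C, hC, hb⟩ := G.yy_bdd N x
  refine Summable.sum _ summ_fin ?_
  refine Summable.of_nonneg_of_le (fun _ => norm_nonneg _) (fun l => ?_) ((bound_geom hr).mul_left C)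
  simp only [cf, Function.comp, Sum.elim_inr, norm_div, norm_mul, norm_pow, norm_inv, Complex.norm_real,
    Real.norm_eq_abs, abs_of_pos (zero_lt_one.trans hr), abs_of_pos (sqk_pos l)]
  have h1 := hb l
  have h2 := one_le_sqk l
  have : ‖yy a N x l‖ / sqk l ≤ C := (div_le_self (norm_nonneg _) h2).trans h1
  gcongr

lemma cont_f (G : GH φ φ₀ c a) (P : Polynomial ℂ) {r : ℝ} (hr : 1 < r) :
    Continuous (fun x : TT => P.eval (φ (tpt r x))) := by
  refine P.continuous.comp ?_
  exact G.hφ.continuousOn.comp_continuous (tpt_continuous r) fun x => by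
    simpa [norm_tpt (zero_lt_one.trans hr).le] using hr

/-- the function `P ∘ φ` on the circle -/
noncomputable def ff (G : GH φ φ₀ c a) (P : Polynomial ℂ) {r : ℝ} (hr : 1 < r) : C(TT, ℂ) :=
  ⟨fun x => P.eval (φ (tpt r x)), G.cont_f P hr⟩

lemma one_lt_tpt {r : ℝ} (hr : 1 < r) (x : TT) : 1 < ‖tpt r x‖ := by
  rw [norm_tpt (zero_lt_one.trans hr).le]; exact hr

variable {Φ : ℕ → Polynomial ℂ}

lemma ff_hasSum (G : GH φ φ₀ c a) (hΦ : ∀ k, ∀ z : ℂ, 1 < ‖z‖ → (Φ k).eval (φ z) = SS a k z) (N : ℕ)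
    (x : ℕ → ℂ) {r : ℝ} (hr : 1 < r) (θ : TT) :
    HasSum (fun i => cf a N x r i * fourier (ee i) θ) (G.ff (PP Φ N x) hr θ) := by
  have h := PP_eval hΦ N x (one_lt_tpt hr θ)
  change HasSum _ ((PP Φ N x).eval (φ (tpt r θ)))
  rw [h]
  refine HasSum.sum ?_ ?_
  · refine hasSum_cng hasSum_fin (fun k => ?_) rfl
    simp only [cf, ee, Function.comp, Sum.elim_inl, ite_mul, zero_mul]
    split_ifs
    · rw [tpt_pow, mul_assoc]
    · rfl
  · refine hasSum_cng (G.hneg_hasSum N x (norm_inv_lt (one_lt_tpt hr θ))) (fun l => ?_) rfl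
    simp only [cf, ee, Function.comp, Sum.elim_inr, tpt_inv_pow, mul_assoc]

lemma dd_hasSum (G : GH φ φ₀ c a) (hΦ : ∀ k, ∀ z : ℂ, 1 < ‖z‖ → (Φ k).eval (φ z) = SS a k z) (N : ℕ)
    (x : ℕ → ℂ) {r : ℝ} (hr : 1 < r) (θ : TT) :
    HasSum (fun i => df a N x r i * fourier (ee i) θ)
      (tpt r θ * ((PP Φ N x).derivative.eval (φ (tpt r θ)) * deriv φ (tpt r θ))) := by
  have h := G.PP_deriv hΦ N x (one_lt_tpt hr θ)
  rw [h, sub_eq_add_neg]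
  refine HasSum.sum ?_ ?_
  · refine hasSum_cng hasSum_fin (fun k => ?_) rfl
    simp only [df, ee, Function.comp, Sum.elim_inl, ite_mul, zero_mul]
    split_ifs
    · rw [tpt_pow, mul_assoc]
    · rfl
  · refine hasSum_cng ((G.hneg_deriv N x (norm_inv_lt (one_lt_tpt hr θ))).mul_left (-(tpt r θ)⁻¹)) (fun l => ?_)
      (by ring)
    simp only [df, ee, Function.comp, Sum.elim_inr]
    have := tpt_inv_pow r (l + 1) θ
    rw [neg_mul, mul_assoc, ← this]; ring

lemma JJ_pair (G : GH φ φ₀ c a) (hΦ : ∀ k, ∀ z : ℂ, 1 < ‖z‖ → (Φ k).eval (φ z) = SS a k z) (N : ℕ)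
    (x : ℕ → ℂ) {r : ℝ} (hr : 1 < r) (g : ℂ → ℂ) (v : C(TT, ℂ)) (hv : ∀ θ, v θ = g (φ (tpt r θ))) :
    HasSum (fun i => df a N x r i * fourierCoeff v (-(ee i)))
      (JJ φ g (PP Φ N x).derivative r / (2 * Real.pi : ℝ)) := by
  refine hasSum_cng (pairing v (df a N x r) ee (G.df_summ N x hr) (G.dd_hasSum hΦ N x hr)) (fun i => rfl) ?_
  rw [JJ, CI_eq]
  have : ((2 * Real.pi : ℝ) : ℂ) ≠ 0 := by exact_mod_cast Real.two_pi_pos.ne'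
  rw [mul_div_cancel_left₀ _ this]
  congr 1; ext θ
  rw [hv]; ring

lemma ff_coeff (G : GH φ φ₀ c a) (hΦ : ∀ k, ∀ z : ℂ, 1 < ‖z‖ → (Φ k).eval (φ z) = SS a k z) (N : ℕ)
    (x : ℕ → ℂ) {r : ℝ} (hr : 1 < r) (i : ℕ ⊕ ℕ) :
    fourierCoeff (G.ff (PP Φ N x) hr) (ee i) = cf a N x r i :=
  fcoef (G.cf_summ N x hr) (G.ff_hasSum hΦ N x hr) i

lemma yy_summ (G : GH φ φ₀ c a) (N : ℕ) (x : ℕ → ℂ) : Summable (fun l => ‖yy a N x l‖ ^ 2) := by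
  have h1 : ∀ k, Summable (fun l => ‖bb a k l‖ ^ 2) := fun k => G.bb_summ.prod_factor k
  have h2 : Summable (fun l => N * ∑ k ∈ Finset.range N, ‖bb a k l‖ ^ 2 * ‖x k‖ ^ 2) :=
    (summable_sum fun k _ => (h1 k).mul_right _).mul_left _
  refine Summable.of_nonneg_of_le (fun _ => by positivity) (fun l => ?_) h2
  calc ‖yy a N x l‖ ^ 2 ≤ (∑ k ∈ Finset.range N, ‖bb a k l * x k‖) ^ 2 := by
        gcongr; exact norm_sum_le _ _
    _ ≤ N * ∑ k ∈ Finset.range N, ‖bb a k l * x k‖ ^ 2 := by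
        simpa using sq_sum_le_card_mul_sum_sq (s := Finset.range N) (f := fun k => ‖bb a k l * x k‖)
    _ = _ := by simp only [norm_mul, mul_pow]

/-- Dirichlet energy -/
noncomputable def EE (a : ℕ → ℕ → ℂ) (N : ℕ) (x : ℕ → ℂ) (r : ℝ) : ℝ :=
  ∑ k ∈ Finset.range N, ‖x k‖ ^ 2 * (r ^ (k + 1)) ^ 2 - ∑' l, ‖yy a N x l‖ ^ 2 * ((r⁻¹) ^ (l + 1)) ^ 2

lemma yyr_summ (G : GH φ φ₀ c a) (N : ℕ) (x : ℕ → ℂ) {r : ℝ} (hr : 1 < r) :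
    Summable (fun l => ‖yy a N x l‖ ^ 2 * ((r⁻¹) ^ (l + 1)) ^ 2) := by
  refine Summable.of_nonneg_of_le (fun _ => by positivity) (fun l => ?_) (G.yy_summ N x)
  refine mul_le_of_le_one_right (by positivity) ?_
  have : r⁻¹ ≤ 1 := inv_le_one_of_one_le₀ hr.le
  have h0 : 0 ≤ r⁻¹ := by positivity
  exact pow_le_one₀ (by positivity) (pow_le_one₀ h0 this)

lemma JJ_energy (G : GH φ φ₀ c a) (hΦ : ∀ k, ∀ z : ℂ, 1 < ‖z‖ → (Φ k).eval (φ z) = SS a k z) (N : ℕ)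
    (x : ℕ → ℂ) {r : ℝ} (hr : 1 < r) :
    (JJ φ (fun w => (starRingEnd ℂ) ((PP Φ N x).eval w)) (PP Φ N x).derivative r).re = 2 * Real.pi * EE a N x r := by
  have h := G.JJ_pair hΦ N x hr (fun w => (starRingEnd ℂ) ((PP Φ N x).eval w)) (star (G.ff (PP Φ N x) hr))
    (fun θ => rfl)
  simp only [fcoef_conj, neg_neg, G.ff_coeff hΦ] at h
  have h2 : HasSum (fun i => df a N x r i * (starRingEnd ℂ) (cf a N x r i)) ((EE a N x r : ℝ) : ℂ) := by
    rw [EE, sub_eq_add_neg, Complex.ofReal_add]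
    have hr0 : (0:ℝ) < r := zero_lt_one.trans hr
    refine HasSum.sum ?_ ?_
    · refine hasSum_cng (hasSum_fin (N := N) (g := fun k => ((‖x k‖ ^ 2 * (r ^ (k + 1)) ^ 2 : ℝ) : ℂ))) (fun k => ?_) (by push_cast; rfl)
      simp only [df, cf, Function.comp, Sum.elim_inl]
      split_ifs
      · have := sqk_ne k
        simp only [map_mul, map_div₀, Complex.conj_ofReal, map_pow]
        push_cast
        rw [← Complex.mul_conj']
        field_simp
      · simp
    · have := (Complex.hasSum_ofReal.2 (G.yyr_summ N x hr).hasSum).neg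
      refine hasSum_cng this (fun l => ?_) (by simp)
      simp only [df, cf, Function.comp, Sum.elim_inr]
      have := sqk_ne l
      simp only [map_mul, map_div₀, Complex.conj_ofReal, map_pow, map_inv₀]
      push_cast
      rw [← Complex.mul_conj']
      field_simp
  have h3 := h.unique h2
  have hp : ((2 * Real.pi : ℝ) : ℂ) ≠ 0 := by exact_mod_cast Real.two_pi_pos.ne'
  rw [div_eq_iff hp, ← Complex.ofReal_mul] at h3
  rw [h3, Complex.ofReal_re]; ring

lemma EE_nonneg (G : GH φ φ₀ c a) (N : ℕ) (x : ℕ → ℂ) {r : ℝ} (hr : 1 < r) : 0 ≤ EE a N x r := by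
  obtain ⟨Φ, hΦ⟩ := G.faber
  have := G.JJ_nonneg (PP Φ N x) hr
  rw [G.JJ_energy hΦ N x hr] at this
  exact nonneg_of_mul_nonneg_right this Real.two_pi_pos

end GH

lemma tsum_cs {f g : ℕ → ℝ} (hf : Summable (fun i => f i ^ 2)) (hg : Summable (fun i => g i ^ 2)) :
    Summable (fun i => f i * g i) ∧ (∑' i, f i * g i) ^ 2 ≤ (∑' i, f i ^ 2) * ∑' i, g i ^ 2 := by
  have hs : Summable (fun i => f i * g i) := by
    refine Summable.of_norm_bounded (hf.add hg) fun i => ?_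
    rw [Real.norm_eq_abs, abs_le]
    constructor <;> nlinarith [sq_nonneg (f i - g i), sq_nonneg (f i + g i)]
  refine ⟨hs, ?_⟩
  refine le_of_tendsto_of_tendsto' (hs.hasSum.tendsto_sum_nat.pow 2)
    (hf.hasSum.tendsto_sum_nat.mul hg.hasSum.tendsto_sum_nat) fun n => ?_
  exact Finset.sum_mul_sq_le_sq_mul_sq _ _ _

/-- row norms -/
noncomputable def rown (b : ℕ → ℕ → ℂ) (k : ℕ) : ℝ := ∑' l, ‖b k l‖ ^ 2

/-- tails -/
noncomputable def tail (b : ℕ → ℕ → ℂ) (M : ℕ) : ℝ := ∑' k, rown b (k + M)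

/-- the damped operator -/
noncomputable def Br (b : ℕ → ℕ → ℂ) (ρ : ℝ) (X : ℕ → ℂ) (k : ℕ) : ℂ :=
  ∑' l, b k l * (ρ : ℂ) ^ (k + 1) * (ρ : ℂ) ^ (l + 1) * X l

lemma row_summ {b : ℕ → ℕ → ℂ} (hb : Summable (fun p : ℕ × ℕ => ‖b p.1 p.2‖ ^ 2)) (k : ℕ) :
    Summable (fun l => ‖b k l‖ ^ 2) := hb.prod_factor k

lemma rown_summ {b : ℕ → ℕ → ℂ} (hb : Summable (fun p : ℕ × ℕ => ‖b p.1 p.2‖ ^ 2)) :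
    Summable (rown b) := hb.prod

lemma tail_tendsto (b : ℕ → ℕ → ℂ) : Tendsto (tail b) atTop (nhds 0) := tendsto_sum_nat_add (rown b)

lemma rown_nonneg (b : ℕ → ℕ → ℂ) (k : ℕ) : 0 ≤ rown b k := tsum_nonneg fun _ => by positivity
lemma tail_nonneg (b : ℕ → ℕ → ℂ) (k : ℕ) : 0 ≤ tail b k := tsum_nonneg fun _ => rown_nonneg _ _

lemma Br_bound {b : ℕ → ℕ → ℂ} (hb : Summable (fun p : ℕ × ℕ => ‖b p.1 p.2‖ ^ 2)) {ρ : ℝ} (h0 : 0 < ρ) (h1 : ρ < 1)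
    {X : ℕ → ℂ} (hX : Summable (fun l => ‖X l‖ ^ 2)) (k : ℕ) : ‖Br b ρ X k‖ ^ 2 ≤ rown b k * ∑' l, ‖X l‖ ^ 2 := by
  obtain ⟨hs, hle⟩ := tsum_cs (row_summ hb k) hX
  have h : ‖Br b ρ X k‖ ≤ ∑' l, ‖b k l‖ * ‖X l‖ := by
    refine tsum_of_norm_bounded hs.hasSum fun l => ?_
    simp only [norm_mul, norm_pow, Complex.norm_real, Real.norm_eq_abs, abs_of_pos h0]
    have : ρ ^ (k + 1) * ρ ^ (l + 1) ≤ 1 :=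
      mul_le_one₀ (pow_le_one₀ h0.le h1.le) (by positivity) (pow_le_one₀ h0.le h1.le)
    rw [mul_assoc ‖b k l‖]
    refine mul_le_mul_of_nonneg_right (mul_le_of_le_one_right (norm_nonneg _) this) (norm_nonneg _)
  calc ‖Br b ρ X k‖ ^ 2 ≤ (∑' l, ‖b k l‖ * ‖X l‖) ^ 2 := by gcongr
    _ ≤ _ := hle

lemma Br_summ {b : ℕ → ℕ → ℂ} (hb : Summable (fun p : ℕ × ℕ => ‖b p.1 p.2‖ ^ 2)) {ρ : ℝ} (h0 : 0 < ρ) (h1 : ρ < 1)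
    {X : ℕ → ℂ} (hX : ∀ l, ‖X l‖ ≤ (l : ℝ) + 1) :
    (∀ k, Summable (fun l => b k l * (ρ : ℂ) ^ (k + 1) * (ρ : ℂ) ^ (l + 1) * X l)) ∧
    Summable (fun k => ‖Br b ρ X k‖ ^ 2) := by
  obtain ⟨C, hC, hbC⟩ : ∃ C : ℝ, 0 ≤ C ∧ ∀ k l, ‖b k l‖ ≤ C := by
    refine ⟨Real.sqrt (∑' p : ℕ × ℕ, ‖b p.1 p.2‖ ^ 2), Real.sqrt_nonneg _, fun k l => ?_⟩
    refine Real.le_sqrt_of_sq_le ?_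
    exact hb.le_tsum (k, l) fun j _ => by positivity
  have hs := GH.bound_geom' (r := ρ⁻¹) ((one_lt_inv₀ h0).2 h1)
  simp only [inv_inv] at hs
  have hbd : ∀ k l, ‖b k l * (ρ : ℂ) ^ (k + 1) * (ρ : ℂ) ^ (l + 1) * X l‖ ≤
      C * ρ ^ (k + 1) * (((l : ℝ) + 1) * ρ ^ (l + 1)) := fun k l => by
    simp only [norm_mul, norm_pow, Complex.norm_real, Real.norm_eq_abs, abs_of_pos h0]
    rw [mul_assoc, mul_comm _ ‖X l‖]
    have := hX l
    have := hbC k l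
    gcongr
  refine ⟨fun k => Summable.of_norm_bounded (hs.mul_left _) (hbd k), ?_⟩
  set S := ∑' l : ℕ, ((l : ℝ) + 1) * ρ ^ (l + 1)
  have hB : ∀ k, ‖Br b ρ X k‖ ≤ C * ρ ^ (k + 1) * S := fun k =>
    tsum_of_norm_bounded (hs.hasSum.mul_left _) (hbd k)
  have hg : Summable (fun k : ℕ => (ρ ^ 2) ^ k) :=
    summable_geometric_of_lt_one (by positivity) (by nlinarith)
  refine Summable.of_nonneg_of_le (fun _ => by positivity) (fun k => ?_) (hg.mul_left ((C * ρ * S) ^ 2))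
  calc ‖Br b ρ X k‖ ^ 2 ≤ (C * ρ ^ (k + 1) * S) ^ 2 := by gcongr; exact hB k
    _ = _ := by rw [← pow_mul, mul_comm 2 k, pow_mul]; ring

lemma Y_summ {b : ℕ → ℕ → ℂ} (hb : Summable (fun p : ℕ × ℕ => ‖b p.1 p.2‖ ^ 2)) {ρ : ℝ} (h0 : 0 < ρ) (h1 : ρ < 1)
    {X Y : ℕ → ℂ} (hX : ∀ l, ‖X l‖ ≤ (l : ℝ) + 1) {ε : ℝ}
    (hZ : ∀ K, ∑ k ∈ Finset.range K, ‖Y k - Br b ρ X k‖ ^ 2 ≤ ε) : Summable (fun l => ‖Y l‖ ^ 2) := by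
  have hZs : Summable (fun k => ‖Y k - Br b ρ X k‖ ^ 2) :=
    summable_of_sum_range_le (fun _ => by positivity) hZ
  refine Summable.of_nonneg_of_le (fun _ => by positivity) (fun k => ?_)
    ((hZs.mul_left 2).add ((Br_summ hb h0 h1 hX).2.mul_left 2))
  have h := norm_add_le (Y k - Br b ρ X k) (Br b ρ X k)
  rw [sub_add_cancel] at h
  nlinarith [sq_nonneg (‖Y k - Br b ρ X k‖ - ‖Br b ρ X k‖), norm_nonneg (Y k), norm_nonneg (Br b ρ X k),
    norm_nonneg (Y k - Br b ρ X k)]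

lemma Y_tail {b : ℕ → ℕ → ℂ} (hb : Summable (fun p : ℕ × ℕ => ‖b p.1 p.2‖ ^ 2)) {ρ : ℝ} (h0 : 0 < ρ) (h1 : ρ < 1)
    {X Y : ℕ → ℂ} (hX : Summable (fun l => ‖X l‖ ^ 2)) (hY : Summable (fun l => ‖Y l‖ ^ 2)) {ε : ℝ}
    (hZ : ∀ K, ∑ k ∈ Finset.range K, ‖Y k - Br b ρ X k‖ ^ 2 ≤ ε) (M : ℕ) :
    ∑' k, ‖Y (k + M)‖ ^ 2 ≤ 2 * tail b M * ∑' l, ‖X l‖ ^ 2 + 2 * ε := by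
  have hZs : Summable (fun k => ‖Y k - Br b ρ X k‖ ^ 2) :=
    summable_of_sum_range_le (fun _ => by positivity) hZ
  have hZ1 : ∑' k, ‖Y k - Br b ρ X k‖ ^ 2 ≤ ε := Real.tsum_le_of_sum_range_le (fun _ => by positivity) hZ
  have hZ2 : ∑' k, ‖Y (k + M) - Br b ρ X (k + M)‖ ^ 2 ≤ ε := by
    have h3 := hZs.sum_add_tsum_nat_add M
    have : 0 ≤ ∑ i ∈ Finset.range M, ‖Y i - Br b ρ X i‖ ^ 2 := by positivity
    linarith
  have hZs' := (summable_nat_add_iff M).2 hZs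
  have hR := (summable_nat_add_iff M).2 (rown_summ hb)
  have hle : ∀ k, ‖Y (k + M)‖ ^ 2 ≤ 2 * (rown b (k + M) * ∑' l, ‖X l‖ ^ 2) + 2 * ‖Y (k + M) - Br b ρ X (k + M)‖ ^ 2 := by
    intro k
    have hB := Br_bound hb h0 h1 hX (k + M)
    have h := norm_add_le (Y (k + M) - Br b ρ X (k + M)) (Br b ρ X (k + M))
    rw [sub_add_cancel] at h
    nlinarith [sq_nonneg (‖Y (k + M) - Br b ρ X (k + M)‖ - ‖Br b ρ X (k + M)‖), norm_nonneg (Y (k + M)), norm_nonneg (Br b ρ X (k + M)),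
      norm_nonneg (Y (k + M) - Br b ρ X (k + M))]
  have := ((summable_nat_add_iff M).2 hY).tsum_le_tsum hle (((hR.mul_right _).mul_left 2).add (hZs'.mul_left 2))
  rw [((hR.mul_right _).mul_left 2).tsum_add (hZs'.mul_left 2), tsum_mul_left, tsum_mul_left, tsum_mul_right] at this
  change _ ≤ 2 * (tail b M * _) + _ at this
  linarith

/-- positive and negative weighted Fourier coefficients -/
noncomputable def XX (v : C(TT, ℂ)) (l : ℕ) : ℂ := sqk l * fourierCoeff v ((l + 1 : ℕ) : ℤ)
noncomputable def YY (v : C(TT, ℂ)) (l : ℕ) : ℂ := sqk l * fourierCoeff v (-((l + 1 : ℕ) : ℤ))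

lemma XX_star (v : C(TT, ℂ)) (l : ℕ) : XX (star v) l = (starRingEnd ℂ) (YY v l) := by
  rw [XX, YY, fcoef_conj]; simp
lemma YY_star (v : C(TT, ℂ)) (l : ℕ) : YY (star v) l = (starRingEnd ℂ) (XX v l) := by
  rw [XX, YY, fcoef_conj]; simp

lemma coeff_sq_le {v : C(TT, ℂ)} (hv : ∀ θ, ‖v θ‖ = 1) : HasSum (fun n => ‖fourierCoeff v n‖ ^ 2) 1 := by
  have := parseval_cont v
  simpa [hv] using this

lemma coeff_le {v : C(TT, ℂ)} (hv : ∀ θ, ‖v θ‖ = 1) (n : ℤ) : ‖fourierCoeff v n‖ ≤ 1 := by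
  have h := (coeff_sq_le hv)
  have := le_hasSum h n (fun _ _ => by positivity)
  nlinarith [norm_nonneg (fourierCoeff v n)]

lemma XX_le {v : C(TT, ℂ)} (hv : ∀ θ, ‖v θ‖ = 1) (l : ℕ) : ‖XX v l‖ ≤ (l : ℝ) + 1 := by
  rw [XX, norm_mul, Complex.norm_real, Real.norm_eq_abs, abs_of_pos (sqk_pos l)]
  have := coeff_le hv ((l + 1 : ℕ) : ℤ)
  exact (mul_le_of_le_one_right (sqk_pos l).le this).trans (GH.sqk_le l)

lemma YY_le {v : C(TT, ℂ)} (hv : ∀ θ, ‖v θ‖ = 1) (l : ℕ) : ‖YY v l‖ ≤ (l : ℝ) + 1 := by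
  rw [YY, norm_mul, Complex.norm_real, Real.norm_eq_abs, abs_of_pos (sqk_pos l)]
  have := coeff_le hv (-((l + 1 : ℕ) : ℤ))
  exact (mul_le_of_le_one_right (sqk_pos l).le this).trans (GH.sqk_le l)

lemma YY_sq (v : C(TT, ℂ)) (l : ℕ) : ‖YY v l‖ ^ 2 = ((l : ℝ) + 1) * ‖fourierCoeff v (-((l + 1 : ℕ) : ℤ))‖ ^ 2 := by
  rw [YY, norm_mul, Complex.norm_real, mul_pow, Real.norm_eq_abs, sq_abs, pow_two (sqk l), sqk_sqk]
lemma XX_sq (v : C(TT, ℂ)) (l : ℕ) : ‖XX v l‖ ^ 2 = ((l : ℝ) + 1) * ‖fourierCoeff v (((l + 1 : ℕ) : ℤ))‖ ^ 2 := by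
  rw [XX, norm_mul, Complex.norm_real, mul_pow, Real.norm_eq_abs, sq_abs, pow_two (sqk l), sqk_sqk]

/-- translation -/
noncomputable def shf (v : C(TT, ℂ)) (h : TT) : C(TT, ℂ) := v.comp ⟨fun θ => θ + h, by fun_prop⟩

lemma shf_apply (v : C(TT, ℂ)) (h θ : TT) : shf v h θ = v (θ + h) := rfl

lemma shf_coeff (v : C(TT, ℂ)) (h : TT) (n : ℤ) : fourierCoeff (shf v h) n = fourier n h * fourierCoeff v n := by
  rw [fourierCoeff, fourierCoeff, ← integral_const_mul,
    ← integral_add_right_eq_self (μ := hm) (fun t => fourier n h * (fourier (-n) t • v t)) h]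
  congr 1; ext t
  simp only [shf_apply, smul_eq_mul]
  have : fourier (-n) (t + h) = fourier (-n) t * fourier (-n) h := by
    simp only [fourier_apply, smul_add, AddCircle.toCircle_add, Circle.coe_mul]
  have h2 : fourier n h * fourier (-n) h = 1 := by
    rw [← fourier_add]; simp
  rw [this, show fourier n h * (fourier (-n) t * fourier (-n) h * v (t + h)) =
    (fourier n h * fourier (-n) h) * (fourier (-n) t * v (t + h)) by ring, h2, one_mul]

lemma sub_coeff (v w : C(TT, ℂ)) (n : ℤ) : fourierCoeff (v - w : C(TT, ℂ)) n = fourierCoeff v n - fourierCoeff w n := by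
  simp only [fourierCoeff]
  rw [← integral_sub]
  · congr 1; ext t; simp [mul_sub]
  · exact (by fun_prop : Continuous fun t => fourier (-n) t • v t).integrable_of_hasCompactSupport
      (HasCompactSupport.of_compactSpace _)
  · exact (by fun_prop : Continuous fun t => fourier (-n) t • w t).integrable_of_hasCompactSupport
      (HasCompactSupport.of_compactSpace _)

lemma fourier_sub_one (n : ℤ) (η : ℝ) : ‖fourier n (η : TT) - 1‖ ≤ |(n : ℝ) * η| ∧ ‖fourier n (η : TT) - 1‖ ≤ 2 := by
  constructor
  · have : fourier n (η : TT) = Complex.exp (Complex.I * ((n * η : ℝ) : ℂ)) := by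
      rw [fourier_coe_apply]
      congr 1
      have : (Real.pi : ℂ) ≠ 0 := by exact_mod_cast Real.pi_ne_zero
      push_cast
      field_simp
    rw [this]
    exact Real.norm_exp_I_mul_ofReal_sub_one_le
  · calc _ ≤ ‖fourier n (η : TT)‖ + ‖(1 : ℂ)‖ := norm_sub_le _ _
      _ = 2 := by rw [norm_fourier_pt]; norm_num

lemma factor_bound (k M : ℕ) (n : ℤ) (hn : |(n : ℝ)| = (k : ℝ) + 1) {η : ℝ} (hη : 0 ≤ η) (A : ℝ) (hA : 0 ≤ A) :
    ‖(fourier n (η : TT) - 1)‖ ^ 2 * A ≤ M * η ^ 2 * (((k : ℝ) + 1) * A) + if M ≤ k then 2 * η * (((k : ℝ) + 1) * A) else 0 := by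
  obtain ⟨h1, h2⟩ := fourier_sub_one n η
  rw [abs_mul, hn, abs_of_nonneg hη] at h1
  have h0 := norm_nonneg (fourier n (η : TT) - 1)
  have hk : (0:ℝ) ≤ k := by positivity
  have hp : 0 ≤ ((k : ℝ) + 1) * η := by positivity
  split_ifs with hM
  · have : ‖(fourier n (η : TT) - 1)‖ ^ 2 ≤ 2 * η * ((k : ℝ) + 1) := by nlinarith
    have h3 : 0 ≤ M * η ^ 2 * (((k : ℝ) + 1) * A) := by positivity
    nlinarith
  · have hkM : (k : ℝ) + 1 ≤ M := by exact_mod_cast (not_le.1 hM)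
    have : ‖(fourier n (η : TT) - 1)‖ ^ 2 ≤ M * η ^ 2 * ((k : ℝ) + 1) := by
      calc _ ≤ (((k : ℝ) + 1) * η) ^ 2 := by gcongr
        _ = ((k : ℝ) + 1) * (η ^ 2 * ((k : ℝ) + 1)) := by ring
        _ ≤ M * (η ^ 2 * ((k : ℝ) + 1)) := by gcongr
        _ = _ := by ring
    nlinarith

lemma tsum_tail_ite {w : ℕ → ℝ} (hw : Summable w) (M : ℕ) (C : ℝ) :
    HasSum (fun k => if M ≤ k then C * w k else 0) (C * ∑' k, w (k + M)) := by
  rw [← hasSum_nat_add_iff' M]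
  have : ∑ i ∈ Finset.range M, (if M ≤ i then C * w i else 0) = 0 :=
    Finset.sum_eq_zero fun i hi => by have := Finset.mem_range.1 hi; simp [not_le.2 this]
  rw [this, sub_zero]
  simpa using ((summable_nat_add_iff M).2 hw).hasSum.mul_left C

/-- modulus of continuity bound -/
lemma mod_aux (v : C(TT, ℂ)) (hX : Summable (fun l => ‖XX v l‖ ^ 2)) (hY : Summable (fun l => ‖YY v l‖ ^ 2))
    {η : ℝ} (hη : 0 ≤ η) (M : ℕ) :
    ∫ θ, ‖v (θ + (η : TT)) - v θ‖ ^ 2 ∂hm ≤ M * η ^ 2 * (∑' l, ‖XX v l‖ ^ 2 + ∑' l, ‖YY v l‖ ^ 2) +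
      2 * η * (∑' l, ‖XX v (l + M)‖ ^ 2 + ∑' l, ‖YY v (l + M)‖ ^ 2) := by
  have h := parseval_cont (shf v η - v)
  simp only [sub_coeff, shf_coeff] at h
  have hc : ∀ n, fourier n (η : TT) * fourierCoeff v n - fourierCoeff v n = (fourier n (η : TT) - 1) * fourierCoeff v n :=
    fun n => by ring
  simp only [hc, norm_mul, mul_pow] at h
  have e : ∫ θ, ‖(shf v η - v : C(TT, ℂ)) θ‖ ^ 2 ∂hm = ∫ θ, ‖v (θ + (η : TT)) - v θ‖ ^ 2 ∂hm := rfl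
  rw [← e, ← h.tsum_eq]
  set f : ℤ → ℝ := fun n => ‖(fourier n (η : TT) - 1)‖ ^ 2 * ‖fourierCoeff v n‖ ^ 2 with hf
  have hX1 := (hX.hasSum.mul_left (M * η ^ 2)).add (tsum_tail_ite hX M (2 * η))
  have hY1 := (hY.hasSum.mul_left (M * η ^ 2)).add (tsum_tail_ite hY M (2 * η))
  have bX : ∀ l : ℕ, f ((l + 1 : ℕ) : ℤ) ≤ M * η ^ 2 * ‖XX v l‖ ^ 2 + if M ≤ l then 2 * η * ‖XX v l‖ ^ 2 else 0 := by
    intro l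
    rw [XX_sq]
    refine factor_bound l M _ ?_ hη _ (by positivity)
    push_cast; exact abs_of_nonneg (by positivity)
  have bY : ∀ l : ℕ, f (-((l + 1 : ℕ) : ℤ)) ≤ M * η ^ 2 * ‖YY v l‖ ^ 2 + if M ≤ l then 2 * η * ‖YY v l‖ ^ 2 else 0 := by
    intro l
    rw [YY_sq]
    refine factor_bound l M _ ?_ hη _ (by positivity)
    push_cast; rw [abs_neg]; exact abs_of_nonneg (by positivity)
  have sX : Summable (fun l : ℕ => f ((l + 1 : ℕ) : ℤ)) :=
    Summable.of_nonneg_of_le (fun _ => by positivity) bX hX1.summable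
  have sY : Summable (fun l : ℕ => f (-((l + 1 : ℕ) : ℤ))) :=
    Summable.of_nonneg_of_le (fun _ => by positivity) bY hY1.summable
  have sX0 : HasSum (fun l : ℕ => f (l : ℤ)) (∑' l : ℕ, f ((l + 1 : ℕ) : ℤ)) := by
    rw [← hasSum_nat_add_iff' 1]
    simpa [hf] using sX.hasSum
  have sYh : HasSum (fun l : ℕ => f (-((l : ℤ) + 1))) (∑' l : ℕ, f (-((l + 1 : ℕ) : ℤ))) := by
    have := sY.hasSum
    simpa only [Nat.cast_add, Nat.cast_one] using this
  rw [(HasSum.of_nat_of_neg_add_one sX0 sYh).tsum_eq]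
  have l1 := hasSum_le bX sX.hasSum hX1
  have l2 := hasSum_le bY sY.hasSum hY1
  calc _ ≤ _ := add_le_add l1 l2
    _ = _ := by ring

lemma head_le {v : C(TT, ℂ)} (hv : ∀ θ, ‖v θ‖ = 1) (M : ℕ) :
    ∑ l ∈ Finset.range M, ‖XX v l‖ ^ 2 + ∑ l ∈ Finset.range M, ‖YY v l‖ ^ 2 ≤ 2 * M := by
  have hs := coeff_sq_le hv
  have key : ∀ e : ℕ → ℤ, Function.Injective e → ∑ l ∈ Finset.range M, ((l : ℝ) + 1) * ‖fourierCoeff v (e l)‖ ^ 2 ≤ (M : ℝ) := by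
    intro e he
    have h2 : ∑ l ∈ Finset.range M, ‖fourierCoeff v (e l)‖ ^ 2 ≤ 1 := by
      have h3 := hs.summable.comp_injective he
      refine (h3.sum_le_tsum (Finset.range M) (fun _ _ => sq_nonneg _)).trans ?_
      rw [← hs.tsum_eq]
      exact tsum_comp_le_tsum_of_inj hs.summable (fun _ => sq_nonneg _) he
    calc _ ≤ ∑ l ∈ Finset.range M, (M : ℝ) * ‖fourierCoeff v (e l)‖ ^ 2 := by
          refine Finset.sum_le_sum fun l hl => ?_
          have : (l : ℝ) + 1 ≤ M := by exact_mod_cast Finset.mem_range.1 hl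
          gcongr
      _ = M * ∑ l ∈ Finset.range M, ‖fourierCoeff v (e l)‖ ^ 2 := by rw [Finset.mul_sum]
      _ ≤ M * 1 := by gcongr
      _ = M := mul_one _
  simp only [XX_sq, YY_sq]
  have a1 := key (fun l => ((l + 1 : ℕ) : ℤ)) (fun x y h => by simpa using h)
  have a2 := key (fun l => -((l + 1 : ℕ) : ℤ)) (fun x y h => by simpa using h)
  linarith

lemma mod_bound {b : ℕ → ℕ → ℂ} (hb : Summable (fun p : ℕ × ℕ => ‖b p.1 p.2‖ ^ 2)) {ρ : ℝ} (h0 : 0 < ρ) (h1 : ρ < 1)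
    {v : C(TT, ℂ)} (hv : ∀ θ, ‖v θ‖ = 1) {ε : ℝ}
    (hZ1 : ∀ K, ∑ k ∈ Finset.range K, ‖YY v k - Br b ρ (XX v) k‖ ^ 2 ≤ ε)
    (hZ2 : ∀ K, ∑ k ∈ Finset.range K, ‖YY (star v) k - Br b ρ (XX (star v)) k‖ ^ 2 ≤ ε)
    {M₀ : ℕ} (hM₀ : tail b M₀ ≤ 1 / 8) {η : ℝ} (hη : 0 ≤ η) (M : ℕ) :
    ∫ θ, ‖v (θ + (η : TT)) - v θ‖ ^ 2 ∂hm ≤ M * η ^ 2 * (4 * M₀ + 8 * ε) +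
      2 * η * (2 * tail b M * (4 * M₀ + 8 * ε) + 4 * ε) := by
  have hv' : ∀ θ, ‖(star v) θ‖ = 1 := fun θ => by simp [hv]
  have hε : 0 ≤ ε := by simpa using hZ1 0
  have sY := Y_summ hb h0 h1 (XX_le hv) hZ1
  have sX : Summable (fun l => ‖XX v l‖ ^ 2) := by
    have := Y_summ hb h0 h1 (XX_le hv') hZ2
    simpa [YY_star] using this
  have tY := Y_tail hb h0 h1 sX sY hZ1
  have tX : ∀ M, ∑' k, ‖XX v (k + M)‖ ^ 2 ≤ 2 * tail b M * ∑' l, ‖YY v l‖ ^ 2 + 2 * ε := by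
    have := Y_tail hb h0 h1 (X := XX (star v)) (Y := YY (star v)) (by simpa [XX_star] using sY)
      (by simpa [YY_star] using sX) hZ2
    simpa [YY_star, XX_star] using this
  set nX := ∑' l, ‖XX v l‖ ^ 2
  set nY := ∑' l, ‖YY v l‖ ^ 2
  have pX : 0 ≤ nX := tsum_nonneg fun _ => by positivity
  have pY : 0 ≤ nY := tsum_nonneg fun _ => by positivity
  have hn : nX + nY ≤ 4 * M₀ + 8 * ε := by
    have e1 := sX.sum_add_tsum_nat_add M₀
    have e2 := sY.sum_add_tsum_nat_add M₀
    have e3 := head_le hv M₀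
    have e4 := tX M₀
    have e5 := tY M₀
    have := tail_nonneg b M₀
    change _ = nX at e1
    change _ = nY at e2
    nlinarith
  have h := mod_aux v sX sY hη M
  refine h.trans ?_
  have hT := tail_nonneg b M
  have : ∑' l, ‖XX v (l + M)‖ ^ 2 + ∑' l, ‖YY v (l + M)‖ ^ 2 ≤ 2 * tail b M * (4 * M₀ + 8 * ε) + 4 * ε := by
    have := tX M
    have := tY M
    nlinarith
  gcongr

/-- `exp (i t g)` -/
noncomputable def expf (g : C(TT, ℝ)) (t : ℝ) : C(TT, ℂ) :=
  ⟨fun θ => Complex.exp (Complex.I * ((t * g θ : ℝ) : ℂ)), by fun_prop⟩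

lemma expf_norm (g : C(TT, ℝ)) (t : ℝ) (θ : TT) : ‖expf g t θ‖ = 1 := Complex.norm_exp_I_mul_ofReal _

lemma expf_star (g : C(TT, ℝ)) (t : ℝ) : star (expf g t) = expf g (-t) := by
  ext θ
  simp only [expf, ContinuousMap.star_apply, ContinuousMap.coe_mk]
  rw [RCLike.star_def, ← Complex.exp_conj]
  simp

/-- real part -/
noncomputable def reC (f : C(TT, ℂ)) : C(TT, ℝ) := ⟨fun θ => (f θ).re, by fun_prop⟩

namespace GH

variable {φ : ℂ → ℂ} {φ₀ : ℂ} {c : ℕ → ℂ} {a : ℕ → ℕ → ℂ} {Φ : ℕ → Polynomial ℂ}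

lemma EE_le (N : ℕ) (x : ℕ → ℂ) {r : ℝ} :
    EE a N x r ≤ ∑ k ∈ Finset.range N, ‖x k‖ ^ 2 * (r ^ (k + 1)) ^ 2 := by
  rw [EE]
  have : 0 ≤ ∑' l, ‖yy a N x l‖ ^ 2 * ((r⁻¹) ^ (l + 1)) ^ 2 := tsum_nonneg fun _ => by positivity
  linarith

lemma zbound0 (G : GH φ φ₀ c a) (hΦ : ∀ k, ∀ z : ℂ, 1 < ‖z‖ → (Φ k).eval (φ z) = SS a k z) (N : ℕ)
    (x : ℕ → ℂ) {r : ℝ} (hr : 1 < r) (t : ℝ) (K : ℕ) (s : ℕ → ℂ) :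
    ‖∑ k ∈ Finset.range K, s k * (YY (expf (reC (G.ff (PP Φ N x) hr)) t) k -
      Br (bb a) r⁻¹ (XX (expf (reC (G.ff (PP Φ N x) hr)) t)) k)‖ ≤
      t ^ 2 / 4 * EE a N x r + 1 / 4 * ∑ k ∈ Finset.range K, ‖s k‖ ^ 2 := by
  set v := expf (reC (G.ff (PP Φ N x) hr)) t with hvdef
  have hr0 : 0 < r := zero_lt_one.trans hr
  have hrC : (r : ℂ) ≠ 0 := by exact_mod_cast hr0.ne'
  set s' : ℕ → ℂ := fun k => s k * ((r : ℂ)⁻¹) ^ (k + 1) with hs'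
  have h1 := G.JJ_pair hΦ K s' hr
    (fun w => Complex.exp (Complex.I * ((t * ((PP Φ N x).eval w).re : ℝ) : ℂ))) v (fun θ => rfl)
  have hB := (Br_summ G.bb_summ (inv_pos.2 hr0) (inv_lt_one_of_one_lt₀ hr) (XX_le (expf_norm (reC (G.ff (PP Φ N x) hr)) t))).1
  have h2 : HasSum (fun i => df a K s' r i * fourierCoeff v (-(ee i)))
      (∑ k ∈ Finset.range K, s k * (YY v k - Br (bb a) r⁻¹ (XX v) k)) := by
    simp only [mul_sub, Finset.sum_sub_distrib]
    rw [sub_eq_add_neg]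
    refine HasSum.sum ?_ ?_
    · refine hasSum_cng (hasSum_fin (N := K) (g := fun k => s k * YY v k)) (fun k => ?_) rfl
      simp only [df, Function.comp, Sum.elim_inl, ee]
      split_ifs
      · rw [YY, hs']
        simp only [inv_pow]
        field_simp
      · simp
    · have h3 := (hasSum_sum (s := Finset.range K) (fun k _ => (hB k).hasSum.mul_left (s k))).neg
      refine hasSum_cng h3 (fun l => ?_) rfl
      simp only [df, Function.comp, Sum.elim_inr, ee, neg_neg, yy]
      rw [Finset.sum_mul, Finset.sum_mul, neg_mul, Finset.sum_mul]
      congr 1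
      refine Finset.sum_congr rfl fun k _ => ?_
      rw [hs', XX]
      push_cast
      ring
  rw [← h1.unique h2, norm_div, Complex.norm_real, Real.norm_eq_abs, abs_of_pos Real.two_pi_pos,
    div_le_iff₀ Real.two_pi_pos]
  have h4 := G.JJ_exp (PP Φ N x) (PP Φ K s') t one_pos hr
  rw [G.JJ_energy hΦ N x hr, G.JJ_energy hΦ K s' hr] at h4
  have h5 : EE a K s' r ≤ ∑ k ∈ Finset.range K, ‖s k‖ ^ 2 := by
    refine (EE_le K s').trans (le_of_eq (Finset.sum_congr rfl fun k _ => ?_))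
    rw [hs', norm_mul, norm_pow, norm_inv, Complex.norm_real, Real.norm_eq_abs, abs_of_pos hr0]
    simp only [inv_pow]
    field_simp
  refine h4.trans ?_
  have := mul_le_mul_of_nonneg_left h5 Real.two_pi_pos.le
  nlinarith

lemma zbound (G : GH φ φ₀ c a) (hΦ : ∀ k, ∀ z : ℂ, 1 < ‖z‖ → (Φ k).eval (φ z) = SS a k z) (N : ℕ)
    (x : ℕ → ℂ) {r : ℝ} (hr : 1 < r) (t : ℝ) (K : ℕ) :
    ∑ k ∈ Finset.range K, ‖YY (expf (reC (G.ff (PP Φ N x) hr)) t) k -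
      Br (bb a) r⁻¹ (XX (expf (reC (G.ff (PP Φ N x) hr)) t)) k‖ ^ 2 ≤ t ^ 2 / 4 * EE a N x r := by
  set Z : ℕ → ℂ := fun k => YY (expf (reC (G.ff (PP Φ N x) hr)) t) k -
      Br (bb a) r⁻¹ (XX (expf (reC (G.ff (PP Φ N x) hr)) t)) k with hZ
  have h := G.zbound0 hΦ N x hr t K (fun k => 2 * (starRingEnd ℂ) (Z k))
  have e : ∑ k ∈ Finset.range K, 2 * (starRingEnd ℂ) (Z k) * Z k = ((2 * ∑ k ∈ Finset.range K, ‖Z k‖ ^ 2 : ℝ) : ℂ) := by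
    push_cast
    rw [Finset.mul_sum]
    refine Finset.sum_congr rfl fun k _ => ?_
    rw [mul_assoc, Complex.conj_mul']
  change ‖∑ k ∈ Finset.range K, 2 * (starRingEnd ℂ) (Z k) * Z k‖ ≤ _ at h
  rw [e, Complex.norm_real, Real.norm_eq_abs, abs_of_nonneg (by positivity)] at h
  have e2 : ∑ k ∈ Finset.range K, ‖2 * (starRingEnd ℂ) (Z k)‖ ^ 2 = 4 * ∑ k ∈ Finset.range K, ‖Z k‖ ^ 2 := by
    rw [Finset.mul_sum]
    refine Finset.sum_congr rfl fun k _ => ?_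
    rw [norm_mul, RCLike.norm_conj, mul_pow]; norm_num
  rw [e2] at h
  change ∑ k ∈ Finset.range K, ‖Z k‖ ^ 2 ≤ _
  linarith

lemma expf_mod (G : GH φ φ₀ c a) (hΦ : ∀ k, ∀ z : ℂ, 1 < ‖z‖ → (Φ k).eval (φ z) = SS a k z) (N : ℕ)
    (x : ℕ → ℂ) {r : ℝ} (hr : 1 < r) {t T E : ℝ} (ht : |t| ≤ T) (hE : EE a N x r ≤ E)
    {M₀ : ℕ} (hM₀ : tail (bb a) M₀ ≤ 1 / 8) {η : ℝ} (hη : 0 ≤ η) (M : ℕ) :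
    ∫ θ, ‖expf (reC (G.ff (PP Φ N x) hr)) t (θ + (η : TT)) - expf (reC (G.ff (PP Φ N x) hr)) t θ‖ ^ 2 ∂hm ≤
      M * η ^ 2 * (4 * M₀ + 8 * (T ^ 2 * E)) + 2 * η * (2 * tail (bb a) M * (4 * M₀ + 8 * (T ^ 2 * E)) + 4 * (T ^ 2 * E)) := by
  have hr0 : 0 < r := zero_lt_one.trans hr
  have hE0 := G.EE_nonneg N x hr
  have hb : t ^ 2 / 4 * EE a N x r ≤ T ^ 2 * E := by
    have : t ^ 2 ≤ T ^ 2 := sq_le_sq' (by linarith [neg_abs_le t]) (by linarith [le_abs_self t])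
    nlinarith [sq_nonneg t]
  refine mod_bound G.bb_summ (inv_pos.2 hr0) (inv_lt_one_of_one_lt₀ hr) (expf_norm _ t)
    (fun K => (G.zbound hΦ N x hr t K).trans hb) (fun K => ?_) hM₀ hη M
  rw [expf_star]
  refine (G.zbound hΦ N x hr (-t) K).trans ?_
  rw [neg_sq]; exact hb

end GH

lemma exp_diff_aux (p q : ℝ) :
    ‖Complex.exp (Complex.I * (p : ℂ)) - Complex.exp (Complex.I * (q : ℂ))‖ ^ 2 = 2 - 2 * Real.cos (p - q) := by
  rw [mul_comm Complex.I, mul_comm Complex.I, ← Complex.normSq_eq_norm_sq, Complex.normSq_apply,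
    Complex.sub_re, Complex.sub_im, Complex.exp_ofReal_mul_I_re, Complex.exp_ofReal_mul_I_re,
    Complex.exp_ofReal_mul_I_im, Complex.exp_ofReal_mul_I_im, Real.cos_sub]
  nlinarith [Real.sin_sq_add_cos_sq p, Real.sin_sq_add_cos_sq q]

lemma expf_diff (g : C(TT, ℝ)) (t : ℝ) (x y : TT) :
    ‖expf g t x - expf g t y‖ ^ 2 = 2 - 2 * Real.cos (t * (g x - g y)) := by
  rw [mul_sub, ← exp_diff_aux]; rfl

lemma cos_avg (T δ : ℝ) (hT : 0 < T) (h : 2 / T ≤ |δ|) : T ≤ ∫ t in (0:ℝ)..T, (2 - 2 * Real.cos (t * δ)) := by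
  have hδ : δ ≠ 0 := by rintro rfl; simp at h; exact absurd h (not_le.2 (by positivity))
  have h1 : ∫ t in (0:ℝ)..T, (2 - 2 * Real.cos (t * δ)) = 2 * T - 2 * (δ⁻¹ * Real.sin (T * δ)) := by
    rw [intervalIntegral.integral_sub (by simp) (Continuous.intervalIntegrable (by fun_prop) _ _),
      intervalIntegral.integral_const_mul, intervalIntegral.integral_comp_mul_right _ hδ]
    simp; ring
  rw [h1]
  have h2 : |δ⁻¹ * Real.sin (T * δ)| ≤ T / 2 := by
    rw [abs_mul, abs_inv]
    have h3 := Real.abs_sin_le_one (T * δ)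
    have h4 : |δ|⁻¹ ≤ T / 2 := by
      rw [inv_le_comm₀ (abs_pos.2 hδ) (by positivity), inv_div]; exact h
    calc _ ≤ |δ|⁻¹ * 1 := by gcongr
      _ ≤ _ := by simpa using h4
  linarith [le_abs_self (δ⁻¹ * Real.sin (T * δ))]

lemma swap_aux (F : ℝ → TT → ℝ) (hFc : Continuous (Function.uncurry F)) {T W : ℝ} (hT : 0 < T)
    (hW : ∀ t ∈ Set.Icc 0 T, ∫ θ, F t θ ∂hm ≤ W) :
    Continuous (fun θ => ∫ t in (0:ℝ)..T, F t θ) ∧ ∫ θ, (∫ t in (0:ℝ)..T, F t θ) ∂hm ≤ T * W := by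
  have hsw : ∫ t in (0:ℝ)..T, ∫ θ, F t θ ∂hm = ∫ θ, (∫ t in (0:ℝ)..T, F t θ) ∂hm := by
    refine intervalIntegral_integral_swap ?_
    rw [Set.uIoc_of_le hT.le]
    have : IntegrableOn (Function.uncurry F) (Set.Icc (0:ℝ) T ×ˢ Set.univ) ((volume : Measure ℝ).prod hm) :=
      hFc.continuousOn.integrableOn_compact (isCompact_Icc.prod isCompact_univ)
    have h2 := this.mono_set (Set.prod_mono Set.Ioc_subset_Icc_self subset_rfl)
    rw [IntegrableOn, ← Measure.prod_restrict, Measure.restrict_univ] at h2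
    exact h2
  have hin : Continuous (fun t => ∫ θ, F t θ ∂hm) := by
    have := continuous_parametric_integral_of_continuous (μ := hm) (f := F) hFc isCompact_univ
    simpa using this
  have hc2 : Continuous (fun θ => ∫ t in (0:ℝ)..T, F t θ) := by
    refine intervalIntegral.continuous_parametric_intervalIntegral_of_continuous' (f := fun θ t => F t θ) ?_ 0 T
    exact hFc.comp continuous_swap
  refine ⟨hc2, ?_⟩
  rw [← hsw]
  have h3 : IntervalIntegrable (fun _ : ℝ => W) volume 0 T := by simp
  have := intervalIntegral.integral_mono_on hT.le (hin.intervalIntegrable 0 T) h3 hW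
  simpa using this

lemma meas_bound (g : C(TT, ℝ)) (h : TT) {T W : ℝ} (hT : 0 < T)
    (hW : ∀ t ∈ Set.Icc 0 T, ∫ θ, ‖expf g t (θ + h) - expf g t θ‖ ^ 2 ∂hm ≤ W) :
    hm.real {θ | 2 / T ≤ |g (θ + h) - g θ|} ≤ W := by
  set F : ℝ → TT → ℝ := fun t θ => 2 - 2 * Real.cos (t * (g (θ + h) - g θ)) with hF
  have hFc : Continuous (Function.uncurry F) := by
    rw [hF]; unfold Function.uncurry; fun_prop
  have h1 : ∀ t, ∫ θ, ‖expf g t (θ + h) - expf g t θ‖ ^ 2 ∂hm = ∫ θ, F t θ ∂hm := fun t => by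
    congr 1; ext θ; rw [expf_diff]
  simp only [h1] at hW
  obtain ⟨hc2, hL⟩ := swap_aux F hFc hT hW
  have hS : MeasurableSet {θ | 2 / T ≤ |g (θ + h) - g θ|} :=
    (isClosed_le continuous_const (by fun_prop)).measurableSet
  have hR : T * hm.real {θ | 2 / T ≤ |g (θ + h) - g θ|} ≤ ∫ θ, (∫ t in (0:ℝ)..T, F t θ) ∂hm := by
    have : ∫ θ, Set.indicator {θ | 2 / T ≤ |g (θ + h) - g θ|} (fun _ => T) θ ∂hm =
        T * hm.real {θ | 2 / T ≤ |g (θ + h) - g θ|} := by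
      rw [integral_indicator hS]; simp [mul_comm]
    rw [← this]
    refine integral_mono ((integrable_const T).indicator hS) (hc2.integrable_of_hasCompactSupport
      (HasCompactSupport.of_compactSpace _)) fun θ => ?_
    by_cases hθ : θ ∈ {θ | 2 / T ≤ |g (θ + h) - g θ|}
    · rw [Set.indicator_of_mem hθ]; exact cos_avg T _ hT hθ
    · rw [Set.indicator_of_notMem hθ]
      refine intervalIntegral.integral_nonneg hT.le fun t _ => ?_
      simp only [hF]
      linarith [Real.cos_le_one (t * (g (θ + h) - g θ))]
  exact le_of_mul_le_mul_left (hR.trans hL) hT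

lemma union_bound (g : C(TT, ℝ)) (h : TT) {τ W : ℝ} (hW : hm.real {θ | τ ≤ |g (θ + h) - g θ|} ≤ W) (n : ℕ) :
    hm.real {θ | ((n + 1 : ℕ) : ℝ) * τ ≤ |g (θ + (n + 1) • h) - g θ|} ≤ (n + 1 : ℕ) * W := by
  induction n with
  | zero => simpa using hW
  | succ n ih =>
    have hsub : {θ | ((n + 1 + 1 : ℕ) : ℝ) * τ ≤ |g (θ + (n + 1 + 1) • h) - g θ|} ⊆
        {θ | ((n + 1 : ℕ) : ℝ) * τ ≤ |g (θ + (n + 1) • h) - g θ|} ∪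
        (fun θ => θ + (n + 1) • h) ⁻¹' {θ | τ ≤ |g (θ + h) - g θ|} := by
      intro θ hθ
      by_contra hc
      simp only [Set.mem_union, Set.mem_preimage, Set.mem_ofPred_eq, not_or, not_le] at hc hθ
      obtain ⟨h1, h2⟩ := hc
      rw [add_assoc, ← succ_nsmul] at h2
      have h3 := abs_sub_le (g (θ + (n + 1 + 1) • h)) (g (θ + (n + 1) • h)) (g θ)
      push_cast at *
      linarith
    have hS : MeasurableSet {θ | τ ≤ |g (θ + h) - g θ|} :=
      (isClosed_le continuous_const (by fun_prop)).measurableSet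
    have htr : hm.real ((fun θ => θ + (n + 1) • h) ⁻¹' {θ | τ ≤ |g (θ + h) - g θ|}) = hm.real {θ | τ ≤ |g (θ + h) - g θ|} := by
      rw [Measure.real, Measure.real]
      congr 1
      exact (measurePreserving_add_right hm ((n + 1) • h)).measure_preimage hS.nullMeasurableSet
    calc _ ≤ hm.real ({θ | ((n + 1 : ℕ) : ℝ) * τ ≤ |g (θ + (n + 1) • h) - g θ|} ∪
        (fun θ => θ + (n + 1) • h) ⁻¹' {θ | τ ≤ |g (θ + h) - g θ|}) := measureReal_mono hsub
      _ ≤ _ := measureReal_union_le _ _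
      _ ≤ (n + 1 : ℕ) * W + W := by rw [htr]; exact add_le_add ih hW
      _ = _ := by push_cast; ring

/-- complexification -/
noncomputable def toC (g : C(TT, ℝ)) : C(TT, ℂ) := ⟨fun θ => (g θ : ℂ), by fun_prop⟩

lemma coeff_diff_le (g : C(TT, ℝ)) (h : TT) (k : ℤ) (hk : fourier k h = -1) :
    2 * ‖fourierCoeff (toC g) k‖ ≤ ∫ θ, |g (θ + h) - g θ| ∂hm := by
  have h1 : fourierCoeff (shf (toC g) h - toC g : C(TT, ℂ)) k = (-2) * fourierCoeff (toC g) k := by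
    rw [sub_coeff, shf_coeff, hk]; ring
  have h2 : ‖fourierCoeff (shf (toC g) h - toC g : C(TT, ℂ)) k‖ ≤ ∫ θ, |g (θ + h) - g θ| ∂hm := by
    rw [fourierCoeff]
    refine (norm_integral_le_integral_norm _).trans (le_of_eq ?_)
    congr 1
    ext θ
    rw [norm_smul, norm_fourier_pt, one_mul, ContinuousMap.sub_apply, shf_apply]
    simp only [toC, ContinuousMap.coe_mk]
    rw [← Complex.ofReal_sub, Complex.norm_real, Real.norm_eq_abs]
  rw [h1, norm_mul] at h2
  simpa using h2

lemma int_split (g : C(TT, ℝ)) (h : TT) {η lam : ℝ} (hη : 0 ≤ η) (hl : 0 < lam) :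
    ∫ θ, |g (θ + h) - g θ| ∂hm ≤ η + lam⁻¹ * hm.real {θ | η ≤ |g (θ + h) - g θ|} + lam * (4 * ∫ θ, g θ ^ 2 ∂hm) := by
  have hS : MeasurableSet {θ | η ≤ |g (θ + h) - g θ|} :=
    (isClosed_le continuous_const (by fun_prop)).measurableSet
  have hIntg : ∀ f : TT → ℝ, Continuous f → Integrable f hm := fun f hf =>
    hf.integrable_of_hasCompactSupport (HasCompactSupport.of_compactSpace _)
  have i1 : Integrable (Set.indicator {θ | η ≤ |g (θ + h) - g θ|} (fun _ => lam⁻¹)) hm := (integrable_const _).indicator hS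
  have i2 : Integrable (fun θ => g (θ + h) ^ 2) hm := hIntg _ (by fun_prop)
  have i3 : Integrable (fun θ => g θ ^ 2) hm := hIntg _ (by fun_prop)
  have key : ∫ θ, |g (θ + h) - g θ| ∂hm ≤ ∫ θ, ((η + Set.indicator {θ | η ≤ |g (θ + h) - g θ|} (fun _ => lam⁻¹) θ)
      + (2 * lam * g (θ + h) ^ 2 + 2 * lam * g θ ^ 2)) ∂hm := by
    refine integral_mono (hIntg _ (by fun_prop)) (((integrable_const _).add i1).add ((i2.const_mul _).add (i3.const_mul _))) fun θ => ?_
    have e0 : 0 ≤ 2 * lam * g (θ + h) ^ 2 + 2 * lam * g θ ^ 2 := by positivity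
    by_cases hθ : θ ∈ {θ | η ≤ |g (θ + h) - g θ|}
    · simp only [Set.indicator_of_mem hθ]
      have e1 : |g (θ + h) - g θ| ≤ lam⁻¹ + lam * |g (θ + h) - g θ| ^ 2 := by
        set d := |g (θ + h) - g θ|
        have hd : 0 ≤ d := abs_nonneg _
        have : lam * d ≤ 1 + (lam * d) ^ 2 := by nlinarith [sq_nonneg (lam * d - 1)]
        have h3 : lam * d ≤ lam * (lam⁻¹ + lam * d ^ 2) := by
          rw [mul_add, mul_inv_cancel₀ hl.ne']; nlinarith
        exact le_of_mul_le_mul_left h3 hl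
      rw [sq_abs] at e1
      nlinarith [mul_nonneg hl.le (sq_nonneg (g (θ + h) + g θ))]
    · simp only [Set.indicator_of_notMem hθ]
      simp only [Set.mem_ofPred_eq, not_le] at hθ
      linarith
  refine key.trans (le_of_eq ?_)
  have e4 : ∫ θ, g (θ + h) ^ 2 ∂hm = ∫ θ, g θ ^ 2 ∂hm := integral_add_right_eq_self (fun θ => g θ ^ 2) h
  have e5 : ∫ θ, (η + Set.indicator {θ | η ≤ |g (θ + h) - g θ|} (fun _ => lam⁻¹) θ) ∂hm =
      η + lam⁻¹ * hm.real {θ | η ≤ |g (θ + h) - g θ|} := by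
    rw [integral_add (integrable_const _) i1, integral_indicator hS]; simp [mul_comm]
  have e6 : ∫ θ, (2 * lam * g (θ + h) ^ 2 + 2 * lam * g θ ^ 2) ∂hm = lam * (4 * ∫ θ, g θ ^ 2 ∂hm) := by
    rw [integral_add (i2.const_mul _) (i3.const_mul _), integral_const_mul, integral_const_mul, e4]; ring
  rw [← e5, ← e6]
  exact integral_add ((integrable_const _).add i1) ((i2.const_mul _).add (i3.const_mul _))

lemma reC_coeff (f : C(TT, ℂ)) (n : ℤ) :
    fourierCoeff (toC (reC f)) n = (fourierCoeff f n + (starRingEnd ℂ) (fourierCoeff f (-n))) / 2 := by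
  have h : f - toC (reC f) = toC (reC f) - star f := by
    ext θ
    simp only [ContinuousMap.sub_apply, toC, reC, ContinuousMap.coe_mk, ContinuousMap.star_apply, RCLike.star_def]
    rw [sub_eq_sub_iff_add_eq_add, Complex.add_conj]; push_cast; ring
  have h2 := congrArg (fun w : C(TT, ℂ) => fourierCoeff w n) h
  simp only [sub_coeff, fcoef_conj] at h2
  linear_combination -h2 / 2

lemma fourier_half (k : ℕ) : fourier ((k + 1 : ℕ) : ℤ) ((Real.pi / (k + 1) : ℝ) : TT) = -1 := by
  rw [fourier_coe_apply]
  have hp : (Real.pi : ℂ) ≠ 0 := by exact_mod_cast Real.pi_ne_zero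
  have hk : (k : ℂ) + 1 ≠ 0 := by exact_mod_cast Nat.succ_ne_zero k
  rw [← Complex.exp_pi_mul_I]
  congr 1
  push_cast
  field_simp

namespace GH

variable {φ : ℂ → ℂ} {φ₀ : ℂ} {c : ℕ → ℂ} {a : ℕ → ℕ → ℂ} {Φ : ℕ → Polynomial ℂ}

lemma ff_l2 (G : GH φ φ₀ c a) (hΦ : ∀ k, ∀ z : ℂ, 1 < ‖z‖ → (Φ k).eval (φ z) = SS a k z) (N : ℕ)
    (x : ℕ → ℂ) {r : ℝ} (hr : 1 < r) {Q : ℝ} (hx : ∑ k ∈ Finset.range N, ‖x k‖ ^ 2 * (r ^ (k + 1)) ^ 2 ≤ Q) :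
    ∫ θ, (reC (G.ff (PP Φ N x) hr) θ) ^ 2 ∂hm ≤ 2 * Q := by
  have hr0 : 0 < r := zero_lt_one.trans hr
  set f := G.ff (PP Φ N x) hr with hf
  have h1 := pairing (star f) (cf a N x r) ee (G.cf_summ N x hr) (G.ff_hasSum hΦ N x hr)
  have h2 : HasSum (fun i => ‖cf a N x r i‖ ^ 2) (∫ θ, ‖f θ‖ ^ 2 ∂hm) := by
    rw [← Complex.hasSum_ofReal, ← integral_complex_ofReal]
    refine hasSum_cng h1 (fun i => ?_) ?_
    · rw [fcoef_conj, neg_neg, hf, G.ff_coeff hΦ, Complex.mul_conj']; push_cast; rfl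
    · congr 1; ext θ
      rw [ContinuousMap.star_apply, RCLike.star_def, Complex.conj_mul']; push_cast; rfl
  have hfin : HasSum (fun k => if k < N then ‖x k‖ ^ 2 * (r ^ (k + 1)) ^ 2 else 0)
      (∑ k ∈ Finset.range N, ‖x k‖ ^ 2 * (r ^ (k + 1)) ^ 2) := by
    have := hasSum_sum_of_ne_finset_zero (L := SummationFilter.unconditional ℕ) (s := Finset.range N) (f := fun k => if k < N then ‖x k‖ ^ 2 * (r ^ (k + 1)) ^ 2 else 0)
      (fun b hb => by simp at hb; simp [not_lt.2 hb])
    convert this using 1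
    exact Finset.sum_congr rfl fun k hk => by simp [Finset.mem_range.1 hk]
  have h3 : HasSum (Sum.elim (fun k => if k < N then ‖x k‖ ^ 2 * (r ^ (k + 1)) ^ 2 else 0)
      (fun l => ‖yy a N x l‖ ^ 2 * ((r⁻¹) ^ (l + 1)) ^ 2)) _ := HasSum.sum hfin (G.yyr_summ N x hr).hasSum
  have h4 : ∫ θ, ‖f θ‖ ^ 2 ∂hm ≤ _ := hasSum_le (fun i => ?_) h2 h3
  · have h5 := G.EE_nonneg N x hr
    rw [EE] at h5
    have h6 : ∫ θ, (reC f θ) ^ 2 ∂hm ≤ ∫ θ, ‖f θ‖ ^ 2 ∂hm := by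
      refine integral_mono ((by fun_prop : Continuous fun θ => (reC f θ) ^ 2).integrable_of_hasCompactSupport
        (HasCompactSupport.of_compactSpace _)) ((by fun_prop : Continuous fun θ => ‖f θ‖ ^ 2).integrable_of_hasCompactSupport
        (HasCompactSupport.of_compactSpace _)) fun θ => ?_
      change (f θ).re ^ 2 ≤ ‖f θ‖ ^ 2
      exact sq_le_sq' (by linarith [neg_abs_le (f θ).re, Complex.abs_re_le_norm (f θ)]) ((le_abs_self _).trans (Complex.abs_re_le_norm _))
    linarith
  · have hs : ∀ k, ∀ z : ℂ, ‖z / (sqk k : ℂ)‖ ≤ ‖z‖ := fun k z => by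
      rw [norm_div, Complex.norm_real, Real.norm_eq_abs, abs_of_pos (sqk_pos k)]
      exact div_le_self (norm_nonneg _) (one_le_sqk k)
    rcases i with k | l
    · simp only [cf, Sum.elim_inl]
      split_ifs
      · rw [norm_mul, mul_pow, norm_pow, Complex.norm_real, Real.norm_eq_abs, abs_of_pos hr0]
        gcongr; exact hs _ _
      · simp
    · simp only [cf, Sum.elim_inr]
      rw [norm_mul, mul_pow, norm_pow, norm_inv, Complex.norm_real, Real.norm_eq_abs, abs_of_pos hr0]
      gcongr; exact hs _ _

lemma re_small (G : GH φ φ₀ c a) (hΦ : ∀ k, ∀ z : ℂ, 1 < ‖z‖ → (Φ k).eval (φ z) = SS a k z) (k : ℕ)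
    {ε : ℝ} (hε : 0 < ε) : ∃ δ > 0, ∀ (N : ℕ) (x : ℕ → ℂ) (r : ℝ) (hr : 1 < r),
      ∑ k ∈ Finset.range N, ‖x k‖ ^ 2 * (r ^ (k + 1)) ^ 2 ≤ 4 → EE a N x r ≤ δ →
      ‖fourierCoeff (toC (reC (G.ff (PP Φ N x) hr))) ((k + 1 : ℕ) : ℤ)‖ ≤ ε := by
  set h0 : ℝ := Real.pi / (k + 1) with hh0
  have h0pos : 0 < h0 := by positivity
  set lam : ℝ := ε / 32 with hlam
  have hl : 0 < lam := by positivity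
  obtain ⟨M₀, hM₀⟩ : ∃ M₀, tail (bb a) M₀ ≤ 1 / 8 :=
    ((tail_tendsto (bb a)).eventually (ge_mem_nhds (by norm_num : (0:ℝ) < 1 / 8))).exists
  set C : ℝ := 4 * M₀ + 8 with hC
  have hCpos : 0 < C := by positivity
  obtain ⟨M, hM⟩ : ∃ M, tail (bb a) M ≤ lam * ε / 6 / (4 * h0 * C) :=
    ((tail_tendsto (bb a)).eventually (ge_mem_nhds (by positivity : (0:ℝ) < lam * ε / 6 / (4 * h0 * C)))).exists
  obtain ⟨n, hn⟩ := exists_nat_gt (M * h0 ^ 2 * C / (lam * ε / 6))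
  set T : ℝ := 4 * (n + 1 : ℕ) / ε with hT
  have hTpos : 0 < T := by positivity
  set δ : ℝ := min (1 / T ^ 2) (lam * ε / 6 / (8 * h0 * T ^ 2)) with hδ
  have hδpos : 0 < δ := by positivity
  refine ⟨δ, hδpos, fun N x r hr hx hE => ?_⟩
  set g := reC (G.ff (PP Φ N x) hr) with hg
  set η : ℝ := h0 / (n + 1 : ℕ) with hη
  have hη0 : 0 < η := by positivity
  have hW := meas_bound g (η : TT) hTpos (W := _) fun t ht =>
    G.expf_mod hΦ N x hr (abs_le.2 ⟨by linarith [ht.1], ht.2⟩ : |t| ≤ T) hE hM₀ hη0.le M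
  have hU := union_bound g (η : TT) hW n
  have hηn : (n + 1) • ((η : ℝ) : TT) = ((h0 : ℝ) : TT) := by
    rw [← AddCircle.coe_nsmul, nsmul_eq_mul, hη]
    congr 1
    field_simp
  rw [hηn] at hU
  have h1 := coeff_diff_le g (h0 : TT) ((k + 1 : ℕ) : ℤ) (fourier_half k)
  have h2 := int_split g (h0 : TT) (η := ((n + 1 : ℕ) : ℝ) * (2 / T)) (lam := lam) (by positivity) hl
  have h3 := G.ff_l2 hΦ N x hr hx
  rw [← hg] at h3
  have e1 : ((n + 1 : ℕ) : ℝ) * (2 / T) = ε / 2 := by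
    rw [hT]; field_simp; ring
  have e2 : T ^ 2 * δ ≤ 1 := by
    calc T ^ 2 * δ ≤ T ^ 2 * (1 / T ^ 2) := by gcongr; exact min_le_left _ _
      _ = 1 := by field_simp
  have e3 : 8 * h0 * (T ^ 2 * δ) ≤ lam * ε / 6 := by
    calc 8 * h0 * (T ^ 2 * δ) ≤ 8 * h0 * (T ^ 2 * (lam * ε / 6 / (8 * h0 * T ^ 2))) := by gcongr; exact min_le_right _ _
      _ = lam * ε / 6 := by field_simp
  have e4 : 4 * h0 * C * tail (bb a) M ≤ lam * ε / 6 := by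
    rw [mul_comm]; exact (le_div_iff₀ (by positivity)).1 hM
  have e5 : M * h0 ^ 2 * C / (n + 1 : ℕ) ≤ lam * ε / 6 := by
    rw [div_lt_iff₀ (by positivity)] at hn
    rw [div_le_iff₀ (by positivity)]
    push_cast
    nlinarith [mul_pos hl hε]
  have hCC : 4 * (M₀ : ℝ) + 8 * (T ^ 2 * δ) ≤ C := by rw [hC]; linarith
  have htail := tail_nonneg (bb a) M
  have hW2 : ((n + 1 : ℕ) : ℝ) * (M * η ^ 2 * (4 * M₀ + 8 * (T ^ 2 * δ)) + 2 * η * (2 * tail (bb a) M * (4 * M₀ + 8 * (T ^ 2 * δ)) + 4 * (T ^ 2 * δ)))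
      ≤ lam * ε / 2 := by
    have : ((n + 1 : ℕ) : ℝ) * (M * η ^ 2 * C + 2 * η * (2 * tail (bb a) M * C + 4 * (T ^ 2 * δ))) =
        M * h0 ^ 2 * C / (n + 1 : ℕ) + 4 * h0 * C * tail (bb a) M + 8 * h0 * (T ^ 2 * δ) := by
      rw [hη]; field_simp; ring
    calc _ ≤ ((n + 1 : ℕ) : ℝ) * (M * η ^ 2 * C + 2 * η * (2 * tail (bb a) M * C + 4 * (T ^ 2 * δ))) := by gcongr
      _ ≤ _ := by rw [this]; linarith
  have e6 : lam⁻¹ * hm.real {θ | ((n + 1 : ℕ) : ℝ) * (2 / T) ≤ |g (θ + (h0 : TT)) - g θ|} ≤ ε / 2 := by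
    calc _ ≤ lam⁻¹ * (lam * ε / 2) := by
          refine mul_le_mul_of_nonneg_left (hU.trans hW2) (by positivity)
      _ = ε / 2 := by field_simp
  have e7 : lam * (4 * ∫ θ, g θ ^ 2 ∂hm) ≤ ε := by
    calc _ ≤ lam * (4 * (2 * 4)) := by gcongr
      _ = ε := by rw [hlam]; ring
  rw [e1] at h2 e6
  linarith

lemma EE_I (N : ℕ) (x : ℕ → ℂ) (r : ℝ) : EE a N (fun k => Complex.I * x k) r = EE a N x r := by
  have : ∀ l, yy a N (fun k => Complex.I * x k) l = Complex.I * yy a N x l := fun l => by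
    simp only [yy]; rw [Finset.mul_sum]; exact Finset.sum_congr rfl fun k _ => by ring
  simp only [EE, this, norm_mul, Complex.norm_I, one_mul]

lemma x_small (G : GH φ φ₀ c a) (k : ℕ) {ε : ℝ} (hε : 0 < ε) : ∃ δ > 0, ∀ (N : ℕ) (x : ℕ → ℂ) (r : ℝ), 1 < r →
      ∑ k ∈ Finset.range N, ‖x k‖ ^ 2 * (r ^ (k + 1)) ^ 2 ≤ 4 → EE a N x r ≤ δ → k < N → ‖x k‖ ≤ ε := by
  obtain ⟨Φ, hΦ⟩ := G.faber
  have hs := sqk_pos k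
  obtain ⟨δ, hδ, H⟩ := G.re_small hΦ k (ε := ε / (2 * sqk k)) (by positivity)
  refine ⟨δ, hδ, fun N x r hr hx hE hk => ?_⟩
  have h1 := H N x r hr hx hE
  have h2 := H N (fun k => Complex.I * x k) r hr (by simpa using hx) (by rw [EE_I]; exact hE)
  have ei : ((k + 1 : ℕ) : ℤ) = ee (Sum.inl k) := rfl
  have ej : -((k + 1 : ℕ) : ℤ) = ee (Sum.inr k) := rfl
  rw [reC_coeff, ei, G.ff_coeff hΦ, ← ei, ej, G.ff_coeff hΦ] at h1 h2
  have c1 : ∀ i, cf a N (fun k => Complex.I * x k) r i = Complex.I * cf a N x r i := by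
    have : ∀ l, yy a N (fun k => Complex.I * x k) l = Complex.I * yy a N x l := fun l => by
      simp only [yy]; rw [Finset.mul_sum]; exact Finset.sum_congr rfl fun k _ => by ring
    rintro (i | i)
    · simp only [cf, Sum.elim_inl]; split_ifs <;> ring
    · simp only [cf, Sum.elim_inr, this]; ring
  rw [c1, c1] at h2
  have h3 : cf a N x r (Sum.inl k) = (cf a N x r (Sum.inl k) + (starRingEnd ℂ) (cf a N x r (Sum.inr k))) / 2 +
      -Complex.I * ((Complex.I * cf a N x r (Sum.inl k) + (starRingEnd ℂ) (Complex.I * cf a N x r (Sum.inr k))) / 2) := by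
    rw [map_mul, Complex.conj_I]
    linear_combination ((cf a N x r (Sum.inl k)) / 2 - (starRingEnd ℂ) (cf a N x r (Sum.inr k)) / 2) * Complex.I_mul_I
  have h4 : ‖cf a N x r (Sum.inl k)‖ ≤ ε / sqk k := by
    rw [h3]
    refine (norm_add_le _ _).trans ?_
    rw [norm_mul, norm_neg, Complex.norm_I, one_mul]
    calc _ ≤ ε / (2 * sqk k) + ε / (2 * sqk k) := add_le_add h1 h2
      _ = _ := by field_simp; ring
  simp only [cf, Sum.elim_inl, if_pos hk] at h4
  rw [norm_mul, norm_div, norm_pow, Complex.norm_real, Complex.norm_real, Real.norm_eq_abs, Real.norm_eq_abs,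
    abs_of_pos hs, abs_of_pos (zero_lt_one.trans hr), div_mul_eq_mul_div, div_le_div_iff_of_pos_right hs] at h4
  exact (le_mul_of_one_le_right (norm_nonneg _) (one_le_pow₀ hr.le)).trans h4

end GH

namespace GH

variable {φ : ℂ → ℂ} {φ₀ : ℂ} {c : ℕ → ℂ} {a : ℕ → ℕ → ℂ}

/-- truncated defect at radius r -/
noncomputable def FE (a : ℕ → ℕ → ℂ) (N : ℕ) (x : ℕ → ℂ) (r : ℝ) : ℝ :=
  ∑ k ∈ Finset.range N, ‖x k‖ ^ 2 * (r ^ (k + 1)) ^ 2 - ∑ l ∈ Finset.range N, ‖yy a N x l‖ ^ 2 * ((r⁻¹) ^ (l + 1)) ^ 2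

lemma EE_le_FE (G : GH φ φ₀ c a) (N : ℕ) (x : ℕ → ℂ) {r : ℝ} (hr : 1 < r) : EE a N x r ≤ FE a N x r := by
  rw [EE, FE]
  have := (G.yyr_summ N x hr).sum_le_tsum (Finset.range N) (fun i _ => by positivity)
  linarith

lemma SX_tendsto (N : ℕ) (x : ℕ → ℂ) : Tendsto (fun r : ℝ => ∑ k ∈ Finset.range N, ‖x k‖ ^ 2 * (r ^ (k + 1)) ^ 2)
    (nhdsWithin 1 (Set.Ioi 1)) (nhds (∑ k ∈ Finset.range N, ‖x k‖ ^ 2)) := by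
  have : ContinuousAt (fun r : ℝ => ∑ k ∈ Finset.range N, ‖x k‖ ^ 2 * (r ^ (k + 1)) ^ 2) 1 := by fun_prop
  have h := this.tendsto.mono_left (nhdsWithin_le_nhds (s := Set.Ioi 1))
  simpa using h

lemma FE_tendsto (N : ℕ) (x : ℕ → ℂ) : Tendsto (FE a N x)
    (nhdsWithin 1 (Set.Ioi 1)) (nhds (∑ k ∈ Finset.range N, ‖x k‖ ^ 2 - ∑ l ∈ Finset.range N, ‖yy a N x l‖ ^ 2)) := by
  have hi : ContinuousAt (fun r : ℝ => r⁻¹) 1 := continuousAt_inv₀ one_ne_zero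
  have : ContinuousAt (fun r : ℝ => ∑ l ∈ Finset.range N, ‖yy a N x l‖ ^ 2 * ((r⁻¹) ^ (l + 1)) ^ 2) 1 := by
    have h2 : ContinuousAt (fun s : ℝ => ∑ l ∈ Finset.range N, ‖yy a N x l‖ ^ 2 * (s ^ (l + 1)) ^ 2) ((1:ℝ)⁻¹) := by fun_prop
    exact ContinuousAt.comp (f := fun r : ℝ => r⁻¹) h2 hi
  have h := this.tendsto.mono_left (nhdsWithin_le_nhds (s := Set.Ioi 1))
  have h3 := (SX_tendsto N x).sub h
  simp only [inv_one, one_pow, mul_one] at h3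
  exact h3

lemma grunsky (G : GH φ φ₀ c a) (N : ℕ) (x : ℕ → ℂ) :
    ∑ l ∈ Finset.range N, ‖yy a N x l‖ ^ 2 ≤ ∑ k ∈ Finset.range N, ‖x k‖ ^ 2 := by
  have := ge_of_tendsto (FE_tendsto (a := a) N x) (b := 0) (by
    filter_upwards [self_mem_nhdsWithin] with r hr
    exact (G.EE_nonneg N x hr).trans (G.EE_le_FE N x hr))
  linarith

lemma high_bound (G : GH φ φ₀ c a) (N M : ℕ) (x : ℕ → ℂ) :
    ∑ l ∈ Finset.range N, ‖yy a N (fun k => if k < M then 0 else x k) l‖ ^ 2 ≤ tail (bb a) M * ∑ k ∈ Finset.range N, ‖x k‖ ^ 2 := by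
  have hrs := rown_summ G.bb_summ
  have h1 : ∀ l, ‖yy a N (fun k => if k < M then 0 else x k) l‖ ^ 2 ≤
      (∑ k ∈ Finset.Ico M N, ‖bb a k l‖ ^ 2) * ∑ k ∈ Finset.range N, ‖x k‖ ^ 2 := fun l => by
    have e : yy a N (fun k => if k < M then 0 else x k) l = ∑ k ∈ Finset.Ico M N, bb a k l * x k := by
      rw [yy]
      have : Finset.Ico M N ⊆ Finset.range N := fun k hk => by simp at hk ⊢; omega
      rw [← Finset.sum_subset this]
      · refine Finset.sum_congr rfl fun k hk => ?_
        rw [if_neg (not_lt.2 (Finset.mem_Ico.1 hk).1)]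
      · intro k hk hk'
        have : k < M := by simp at hk hk'; omega
        simp [this]
    rw [e]
    calc _ ≤ (∑ k ∈ Finset.Ico M N, ‖bb a k l‖ * ‖x k‖) ^ 2 := by
          gcongr
          refine (norm_sum_le _ _).trans (le_of_eq ?_)
          simp only [norm_mul]
      _ ≤ (∑ k ∈ Finset.Ico M N, ‖bb a k l‖ ^ 2) * ∑ k ∈ Finset.Ico M N, ‖x k‖ ^ 2 := Finset.sum_mul_sq_le_sq_mul_sq _ _ _
      _ ≤ _ := by
          gcongr
          exact fun k hk => by simp at hk ⊢; omega
  calc _ ≤ ∑ l ∈ Finset.range N, (∑ k ∈ Finset.Ico M N, ‖bb a k l‖ ^ 2) * ∑ k ∈ Finset.range N, ‖x k‖ ^ 2 :=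
        Finset.sum_le_sum fun l _ => h1 l
    _ = (∑ k ∈ Finset.Ico M N, ∑ l ∈ Finset.range N, ‖bb a k l‖ ^ 2) * ∑ k ∈ Finset.range N, ‖x k‖ ^ 2 := by
        rw [← Finset.sum_mul, Finset.sum_comm]
    _ ≤ _ := by
        gcongr
        calc _ ≤ ∑ k ∈ Finset.Ico M N, rown (bb a) k := Finset.sum_le_sum fun k _ =>
              (row_summ G.bb_summ k).sum_le_tsum _ (fun i _ => by positivity)
          _ = ∑ k ∈ Finset.range (N - M), rown (bb a) (k + M) := by
              rw [Finset.sum_Ico_eq_sum_range]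
              exact Finset.sum_congr rfl fun k _ => by rw [add_comm]
          _ ≤ _ := ((summable_nat_add_iff M).2 hrs).sum_le_tsum _ (fun i _ => rown_nonneg _ _)

lemma strict1 (G : GH φ φ₀ c a) : ∃ q : ℝ, 0 ≤ q ∧ q < 1 ∧ ∀ (N : ℕ) (x : ℕ → ℂ),
    ∑ k ∈ Finset.range N, ‖x k‖ ^ 2 = 1 → ∑ l ∈ Finset.range N, ‖yy a N x l‖ ^ 2 ≤ q := by
  obtain ⟨M, hM⟩ : ∃ M, tail (bb a) M ≤ 1 / 8 :=
    ((tail_tendsto (bb a)).eventually (ge_mem_nhds (by norm_num : (0:ℝ) < 1 / 8))).exists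
  obtain ⟨ε, hε⟩ : ∃ ε : ℝ, ε = Real.sqrt (1 / (8 * (M + 1))) := ⟨_, rfl⟩
  have hε2 : ε ^ 2 = 1 / (8 * (M + 1)) := by rw [hε]; exact Real.sq_sqrt (by positivity)
  have hεp : 0 < ε := by rw [hε]; exact Real.sqrt_pos.2 (by positivity)
  choose δ hδ H using fun k => G.x_small k hεp
  obtain ⟨δ0, hδ0, hle⟩ : ∃ δ0 > 0, ∀ k < M, δ0 ≤ δ k := by
    clear hM H hεp hε2 hε
    induction M with
    | zero => exact ⟨1, one_pos, by simp⟩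
    | succ M ih =>
      obtain ⟨d, hd, h⟩ := ih
      refine ⟨min d (δ M), lt_min hd (hδ M), fun k hk => ?_⟩
      rcases Nat.lt_succ_iff_lt_or_eq.1 hk with h1 | rfl
      · exact (min_le_left _ _).trans (h k h1)
      · exact min_le_right _ _
  refine ⟨max (1 - δ0 / 2) (1 / 2), le_max_of_le_right (by norm_num), max_lt (by linarith) (by norm_num), fun N x hx => ?_⟩
  by_contra hc
  rw [not_le, max_lt_iff] at hc
  obtain ⟨h1, h2⟩ := hc
  have e1 := (FE_tendsto (a := a) N x).eventually (gt_mem_nhds (by rw [hx]; linarith : _ < δ0))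
  have e2 := (SX_tendsto N x).eventually (gt_mem_nhds (by rw [hx]; norm_num : _ < (4:ℝ)))
  obtain ⟨r, ⟨hr1, hr2⟩, hr⟩ := ((e1.and e2).and self_mem_nhdsWithin).exists
  have hsm : ∀ k < M, k < N → ‖x k‖ ≤ ε := fun k hk hN =>
    H k N x r hr hr2.le (((G.EE_le_FE N x hr).trans hr1.le).trans (hle k hk)) hN
  have b1 := G.grunsky N (fun k => if k < M then x k else 0)
  have b2 := G.high_bound N M x
  rw [hx, mul_one] at b2
  have b3 : ∑ k ∈ Finset.range N, ‖if k < M then x k else 0‖ ^ 2 ≤ 1 / 8 := by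
    have : ∀ k ∈ Finset.range N, ‖if k < M then x k else 0‖ ^ 2 ≤ if k < M then ε ^ 2 else 0 := fun k hk => by
      split_ifs with h
      · have := hsm k h (Finset.mem_range.1 hk); gcongr
      · simp
    refine (Finset.sum_le_sum this).trans ?_
    rw [← Finset.sum_filter, Finset.sum_const, nsmul_eq_mul]
    have hcard : ((Finset.filter (fun k => k < M) (Finset.range N)).card : ℝ) ≤ M := by
      have : Finset.filter (fun k => k < M) (Finset.range N) ⊆ Finset.range M := fun k hk => by
        simp at hk ⊢; exact hk.2
      simpa using Finset.card_le_card this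
    calc _ ≤ ((M : ℝ) + 1) * ε ^ 2 := by gcongr; linarith
      _ = _ := by rw [hε2]; field_simp
  have b4 : ∀ l, ‖yy a N x l‖ ^ 2 ≤ 2 * ‖yy a N (fun k => if k < M then x k else 0) l‖ ^ 2 +
      2 * ‖yy a N (fun k => if k < M then 0 else x k) l‖ ^ 2 := fun l => by
    have e : yy a N x l = yy a N (fun k => if k < M then x k else 0) l + yy a N (fun k => if k < M then 0 else x k) l := by
      simp only [yy]; rw [← Finset.sum_add_distrib]
      exact Finset.sum_congr rfl fun k _ => by split_ifs <;> ring
    rw [e]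
    have := norm_add_le (yy a N (fun k => if k < M then x k else 0) l) (yy a N (fun k => if k < M then 0 else x k) l)
    have h0 := norm_nonneg (yy a N (fun k => if k < M then x k else 0) l + yy a N (fun k => if k < M then 0 else x k) l)
    nlinarith [sq_nonneg (‖yy a N (fun k => if k < M then x k else 0) l‖ - ‖yy a N (fun k => if k < M then 0 else x k) l‖)]
  have b5 := Finset.sum_le_sum fun l (_ : l ∈ Finset.range N) => b4 l
  rw [Finset.sum_add_distrib, ← Finset.mul_sum, ← Finset.mul_sum] at b5
  linarith

lemma strict (G : GH φ φ₀ c a) : ∃ q : ℝ, 0 ≤ q ∧ q < 1 ∧ ∀ (N : ℕ) (x : ℕ → ℂ),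
    ∑ l ∈ Finset.range N, ‖yy a N x l‖ ^ 2 ≤ q * ∑ k ∈ Finset.range N, ‖x k‖ ^ 2 := by
  obtain ⟨q, h0, h1, H⟩ := G.strict1
  refine ⟨q, h0, h1, fun N x => ?_⟩
  set s := ∑ k ∈ Finset.range N, ‖x k‖ ^ 2 with hs
  have hs0 : 0 ≤ s := Finset.sum_nonneg fun _ _ => by positivity
  rcases hs0.eq_or_lt with h | h
  · have := G.grunsky N x
    rw [← hs, ← h] at this
    rw [← h]; linarith
  · have hq : 0 < Real.sqrt s := Real.sqrt_pos.2 h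
    have hsq : Real.sqrt s ^ 2 = s := Real.sq_sqrt hs0
    have hn : ‖((Real.sqrt s : ℝ) : ℂ)⁻¹‖ ^ 2 = s⁻¹ := by
      rw [norm_inv, Complex.norm_real, Real.norm_eq_abs, abs_of_pos hq, inv_pow, hsq]
    have hy : ∀ l, yy a N (fun k => ((Real.sqrt s : ℝ) : ℂ)⁻¹ * x k) l = ((Real.sqrt s : ℝ) : ℂ)⁻¹ * yy a N x l := fun l => by
      simp only [yy]; rw [Finset.mul_sum]; exact Finset.sum_congr rfl fun k _ => by ring
    have h3 := H N (fun k => ((Real.sqrt s : ℝ) : ℂ)⁻¹ * x k) (by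
      simp only [norm_mul, mul_pow, hn]; rw [← Finset.mul_sum, ← hs]; exact inv_mul_cancel₀ h.ne')
    simp only [hy, norm_mul, mul_pow, hn] at h3
    rw [← Finset.mul_sum, inv_mul_le_iff₀ h] at h3
    linarith

end GH

/-- weights -/
def wt (i : ℕ) : ℕ := i + 1

/-- the Hall norm of a monomial -/
noncomputable def zz (α : ℕ →₀ ℕ) : ℝ := α.prod fun i e => ((i : ℝ) + 1) ^ e * (e.factorial : ℝ)

lemma zz_pos (α : ℕ →₀ ℕ) : 0 < zz α := Finset.prod_pos fun i _ => by positivity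

lemma zz_sub (α : ℕ →₀ ℕ) (i : ℕ) (hi : i ∈ α.support) :
    zz α = ((i : ℝ) + 1) * α i * zz (α - Finsupp.single i 1) := by
  have hi' : α i ≠ 0 := Finsupp.mem_support_iff.1 hi
  set β := α - Finsupp.single i 1 with hβ
  have hsub : β.support ⊆ α.support := Finsupp.support_mono (by rw [hβ]; exact tsub_le_self)
  rw [zz, zz, Finsupp.prod, Finsupp.prod_of_support_subset β hsub _ (fun _ _ => by simp),
    ← Finset.mul_prod_erase _ _ hi, ← Finset.mul_prod_erase _ _ hi]
  have h1 : ∀ k ∈ α.support.erase i, ((k : ℝ) + 1) ^ (β k) * ((β k).factorial : ℝ) = ((k : ℝ) + 1) ^ (α k) * ((α k).factorial : ℝ) := by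
    intro k hk
    have : k ≠ i := Finset.ne_of_mem_erase hk
    have : β k = α k := by rw [hβ, Finsupp.tsub_apply, Finsupp.single_eq_of_ne this]; simp
    rw [this]
  rw [Finset.prod_congr rfl h1]
  have h2 : α i = β i + 1 := by
    rw [hβ, Finsupp.tsub_apply, Finsupp.single_eq_same]; omega
  rw [h2, Nat.factorial_succ]
  push_cast
  ring

lemma weight_eq (α : ℕ →₀ ℕ) : Finsupp.weight wt α = ∑ i ∈ α.support, α i * (i + 1) := by
  rw [Finsupp.weight_apply]; rfl

lemma weight_sub (α : ℕ →₀ ℕ) (i : ℕ) (hi : i ∈ α.support) :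
    Finsupp.weight wt α = Finsupp.weight wt (α - Finsupp.single i 1) + (i + 1) := by
  have hi' : α i ≠ 0 := Finsupp.mem_support_iff.1 hi
  have : α = (α - Finsupp.single i 1) + Finsupp.single i 1 := by
    rw [tsub_add_cancel_of_le]
    rw [Finsupp.single_le_iff]; omega
  conv_lhs => rw [this]
  rw [map_add, Finsupp.weight_single]; simp [wt]

/-- exponential of a weighted series: recursive coefficients -/
noncomputable def expP (R : ℕ → MvPolynomial ℕ ℂ) : ℕ → MvPolynomial ℕ ℂ
  | 0 => 1
  | j + 1 => MvPolynomial.C (1 / ((j : ℂ) + 1)) * ∑ i : Fin (j + 1), R i * expP R (j - i)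

lemma expP_zero (R : ℕ → MvPolynomial ℕ ℂ) : expP R 0 = 1 := by rw [expP]

lemma expP_succ (R : ℕ → MvPolynomial ℕ ℂ) (j : ℕ) :
    expP R (j + 1) = MvPolynomial.C (1 / ((j : ℂ) + 1)) * ∑ i ∈ Finset.range (j + 1), R i * expP R (j - i) := by
  rw [expP, Finset.sum_range]

lemma expP_rec (R : ℕ → MvPolynomial ℕ ℂ) (t : ℕ → ℂ) (j : ℕ) :
    ((j : ℂ) + 1) * MvPolynomial.eval t (expP R (j + 1)) =
      ∑ i ∈ Finset.range (j + 1), MvPolynomial.eval t (R i) * MvPolynomial.eval t (expP R (j - i)) := by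
  have hj : (j : ℂ) + 1 ≠ 0 := by exact_mod_cast Nat.succ_ne_zero j
  rw [expP_succ, map_mul, MvPolynomial.eval_C, map_sum, ← mul_assoc, mul_one_div_cancel hj, one_mul]
  simp only [map_mul]

lemma expP_hom {R : ℕ → MvPolynomial ℕ ℂ} (hR : ∀ i, (R i).IsWeightedHomogeneous wt (i + 1)) (j : ℕ) :
    (expP R j).IsWeightedHomogeneous wt j := by
  induction j using Nat.strong_induction_on with
  | _ j ih =>
    cases j with
    | zero => rw [expP_zero]; exact MvPolynomial.isWeightedHomogeneous_one ℂ wt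
    | succ j =>
      rw [expP_succ, ← zero_add (j + 1)]
      refine (MvPolynomial.isWeightedHomogeneous_C wt _).mul (MvPolynomial.IsWeightedHomogeneous.sum _ _ _ fun i hi => ?_)
      have hi' := Finset.mem_range.1 hi
      have := (hR i).mul (ih (j - i) (by omega))
      rwa [show i + 1 + (j - i) = j + 1 by omega] at this

/-- exponential generating series -/
lemma expP_hasSum {R : ℕ → MvPolynomial ℕ ℂ} {t : ℕ → ℂ} {f : ℂ → ℂ} {r : ℝ} (hr : 0 < r)
    (h : ∀ s : ℂ, ‖s‖ < r → HasSum (fun i => MvPolynomial.eval t (R i) / ((i : ℂ) + 1) * s ^ (i + 1)) (f s))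
    {s : ℂ} (hs : ‖s‖ < r) : HasSum (fun j => MvPolynomial.eval t (expP R j) * s ^ j) (Complex.exp (f s)) := by
  have hf0 : f 0 = 0 := by
    have := (h 0 (by simpa using hr))
    simp at this
    exact this.unique hasSum_zero |>.symm ▸ rfl
  set q : ℕ → ℂ := fun j => match j with
    | 0 => 0
    | i + 1 => MvPolynomial.eval t (R i) / ((i : ℂ) + 1) with hq
  refine exp_series_rec (q := q) hr (fun s hs => ?_) _ ?_ ?_ s hs
  · have := h s hs
    rw [← hasSum_nat_add_iff' 1]
    simpa [hq] using this
  · rw [hf0]; simp [expP_zero]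
  · intro j
    rw [expP_rec]
    refine Finset.sum_congr rfl fun i _ => ?_
    have hj : (i : ℂ) + 1 ≠ 0 := by exact_mod_cast Nat.succ_ne_zero i
    simp only [hq]
    rw [mul_div_cancel₀ _ hj]

/-- complete homogeneous polynomials in power sums -/
noncomputable def WP (j : ℕ) : MvPolynomial ℕ ℂ := expP (fun i => MvPolynomial.X i) j

lemma WP_hom (j : ℕ) : (WP j).IsWeightedHomogeneous wt j :=
  expP_hom (fun i => MvPolynomial.isWeightedHomogeneous_X ℂ wt i) j

lemma WP_coeff (j : ℕ) (α : ℕ →₀ ℕ) (hα : Finsupp.weight wt α = j) : MvPolynomial.coeff α (WP j) = ((zz α)⁻¹ : ℝ) := by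
  induction j using Nat.strong_induction_on generalizing α with
  | _ j ih =>
    cases j with
    | zero =>
      have h0 : α = 0 := by
        rw [weight_eq, Finset.sum_eq_zero_iff] at hα
        ext i
        by_contra h
        have := hα i (Finsupp.mem_support_iff.2 h)
        simp at this; exact h this
      subst h0
      simp [WP, expP_zero, zz]
    | succ j =>
      have hj : (j : ℂ) + 1 ≠ 0 := by exact_mod_cast Nat.succ_ne_zero j
      have hz : ((zz α : ℝ) : ℂ) ≠ 0 := by exact_mod_cast (zz_pos α).ne'
      rw [WP, expP_succ, MvPolynomial.coeff_C_mul, MvPolynomial.coeff_sum]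
      have h1 : ∀ i ∈ Finset.range (j + 1), MvPolynomial.coeff α (MvPolynomial.X i * expP (fun i => MvPolynomial.X i) (j - i)) =
          ((i : ℂ) + 1) * α i * ((zz α)⁻¹ : ℝ) := by
        intro i hi
        rw [MvPolynomial.coeff_X_mul']
        split_ifs with h
        · have hw := weight_sub α i h
          have h3 := ih (j - i) (by omega) (α - Finsupp.single i 1) (by omega)
          rw [WP] at h3
          have hβ : ((zz (α - Finsupp.single i 1) : ℝ) : ℂ) ≠ 0 := by exact_mod_cast (zz_pos _).ne'
          have hi0 : ((i : ℂ) + 1) ≠ 0 := by exact_mod_cast Nat.succ_ne_zero i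
          have ha : (α i : ℂ) ≠ 0 := by exact_mod_cast Finsupp.mem_support_iff.1 h
          rw [h3, zz_sub α i h]
          push_cast
          field_simp
        · have : α i = 0 := by simpa using h
          simp [this]
      rw [Finset.sum_congr rfl h1, ← Finset.sum_mul]
      have h2 : ∑ i ∈ Finset.range (j + 1), ((i : ℂ) + 1) * α i = (j : ℂ) + 1 := by
        have hs : α.support ⊆ Finset.range (j + 1) := fun i hi => by
          have := weight_sub α i hi
          simp; omega
        have e : ((Finsupp.weight wt α : ℕ) : ℂ) = (j : ℂ) + 1 := by rw [hα]; push_cast; ring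
        rw [← e, weight_eq]
        push_cast
        rw [Finset.sum_subset hs fun i _ hi => by
          have : α i = 0 := by simpa using hi
          simp [this]]
        exact Finset.sum_congr rfl fun i _ => by ring
      rw [h2]
      push_cast
      field_simp

lemma WP_support {j : ℕ} {α : ℕ →₀ ℕ} : α ∈ (WP j).support ↔ Finsupp.weight wt α = j := by
  constructor
  · intro h; exact WP_hom j (MvPolynomial.mem_support_iff.1 h)
  · intro h
    rw [MvPolynomial.mem_support_iff, WP_coeff j α h]
    exact_mod_cast (inv_pos.2 (zz_pos α)).ne'

/-- Hall norm -/
noncomputable def HN (P : MvPolynomial ℕ ℂ) : ℝ := ∑ α ∈ P.support, zz α * ‖MvPolynomial.coeff α P‖ ^ 2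

lemma HN_eq {P : MvPolynomial ℕ ℂ} {S : Finset (ℕ →₀ ℕ)} (h : P.support ⊆ S) :
    HN P = ∑ α ∈ S, zz α * ‖MvPolynomial.coeff α P‖ ^ 2 := by
  rw [HN]
  refine Finset.sum_subset h fun α _ hα => ?_
  rw [MvPolynomial.notMem_support_iff.1 hα]; simp

lemma hom_support {P : MvPolynomial ℕ ℂ} {j : ℕ} (hP : P.IsWeightedHomogeneous wt j) : P.support ⊆ (WP j).support :=
  fun _ hα => WP_support.2 (hP (MvPolynomial.mem_support_iff.1 hα))

/-- scaling -/
lemma hom_scale {P : MvPolynomial ℕ ℂ} {j : ℕ} (hP : P.IsWeightedHomogeneous wt j) (s : ℂ) (t : ℕ → ℂ) :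
    MvPolynomial.eval (fun i => s ^ (i + 1) * t i) P = s ^ j * MvPolynomial.eval t P := by
  rw [MvPolynomial.eval_eq, MvPolynomial.eval_eq, Finset.mul_sum]
  refine Finset.sum_congr rfl fun α hα => ?_
  have hw := hP (MvPolynomial.mem_support_iff.1 hα)
  rw [weight_eq] at hw
  simp only [mul_pow, Finset.prod_mul_distrib, ← pow_mul]
  rw [Finset.prod_pow_eq_pow_sum, ← hw]
  have : ∑ i ∈ α.support, (i + 1) * α i = ∑ i ∈ α.support, α i * (i + 1) := Finset.sum_congr rfl fun i _ => mul_comm _ _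
  rw [this]; ring

/-- elementary coefficients from power sums -/
noncomputable def eRec (t : ℕ → ℂ) : ℕ → ℂ
  | 0 => 1
  | k + 1 => (1 / ((k : ℂ) + 1)) * ((-1) ^ k * ∑ i : Fin (k + 1), (-1) ^ (i : ℕ) * eRec t i * t (k - i))

lemma eRec_succ (t : ℕ → ℂ) (k : ℕ) : ((k : ℂ) + 1) * eRec t (k + 1) =
    (-1) ^ k * ∑ i ∈ Finset.range (k + 1), (-1) ^ i * eRec t i * t (k - i) := by
  have hj : (k : ℂ) + 1 ≠ 0 := by exact_mod_cast Nat.succ_ne_zero k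
  rw [eRec, Finset.sum_range, ← mul_assoc, mul_one_div_cancel hj, one_mul]

lemma exists_esymm (n : ℕ) (e : ℕ → ℂ) (he : e 0 = 1) :
    ∃ y : Fin n → ℂ, ∀ k ≤ n, MvPolynomial.aeval y (MvPolynomial.esymm (Fin n) ℂ k) = e k := by
  obtain ⟨P, hP⟩ : ∃ P : Polynomial ℂ, P = ∑ k ∈ Finset.range (n + 1), Polynomial.C ((-1) ^ (n - k) * e (n - k)) * Polynomial.X ^ k := ⟨_, rfl⟩
  have hc : ∀ k ≤ n, P.coeff k = (-1) ^ (n - k) * e (n - k) := by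
    intro k hk
    rw [hP, Polynomial.finsetSum_coeff]
    simp only [Polynomial.coeff_C_mul_X_pow]
    rw [Finset.sum_eq_single k]
    · simp
    · intro b _ hb; rw [if_neg (Ne.symm hb)]
    · intro h; exact absurd (Finset.mem_range.2 (by omega)) h
  have hdeg : P.natDegree = n := by
    apply Polynomial.natDegree_eq_of_le_of_coeff_ne_zero
    · rw [hP]
      apply Polynomial.natDegree_sum_le_of_forall_le
      intro i hi
      exact (Polynomial.natDegree_C_mul_X_pow_le _ _).trans (by have := Finset.mem_range.1 hi; omega)
    · rw [hc n le_rfl]; simp [he]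
  have hlead : P.leadingCoeff = 1 := by
    rw [Polynomial.leadingCoeff, hdeg, hc n le_rfl]; simp [he]
  have hcard : Multiset.card P.roots = P.natDegree := Polynomial.splits_iff_card_roots.mp (IsAlgClosed.splits P)
  obtain ⟨y, hy⟩ : ∃ y : Fin n → ℂ, Finset.univ.val.map y = P.roots := by
    have hlen : P.roots.toList.length = n := by rw [Multiset.length_toList, hcard, hdeg]
    refine ⟨fun i => P.roots.toList.get (i.cast hlen.symm), ?_⟩
    have : P.roots = (P.roots.toList : Multiset ℂ) := (Multiset.coe_toList _).symm
    conv_rhs => rw [this]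
    rw [Fin.univ_val_map]
    congr 1
    apply List.ext_get
    · simp [hlen]
    · intro i h1 h2; simp
  refine ⟨y, fun k hk => ?_⟩
  rw [MvPolynomial.aeval_esymm_eq_multiset_esymm, hy]
  have h1 := Polynomial.coeff_eq_esymm_roots_of_card hcard (k := n - k) (by omega)
  rw [hc _ (by omega), hlead, hdeg, one_mul] at h1
  have h2 : n - (n - k) = k := by omega
  rw [h2] at h1
  exact (mul_left_cancel₀ (pow_ne_zero _ (by norm_num)) h1).symm

lemma exists_psum (n : ℕ) (t : ℕ → ℂ) :
    ∃ y : Fin n → ℂ, ∀ k < n, ∑ i, y i ^ (k + 1) = t k := by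
  obtain ⟨y, hy⟩ := exists_esymm n (eRec t) (by rw [eRec])
  refine ⟨y, ?_⟩
  intro k
  induction k using Nat.strong_induction_on with
  | _ k ih =>
  intro hk
  have h1 := congrArg (MvPolynomial.aeval y) (MvPolynomial.mul_esymm_eq_sum (Fin n) ℂ (k + 1))
  have hps : ∀ j, MvPolynomial.aeval y (MvPolynomial.psum (Fin n) ℂ j) = ∑ i, y i ^ j := by
    intro j; simp [MvPolynomial.psum]
  have hfil : Finset.filter (fun a : ℕ × ℕ => a.1 < k + 1) (Finset.HasAntidiagonal.antidiagonal (k + 1)) =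
      (Finset.range (k + 1)).image (fun i => (i, k + 1 - i)) := by
    ext ⟨p, q⟩
    simp only [Finset.mem_filter, Finset.HasAntidiagonal.mem_antidiagonal, Finset.mem_image, Finset.mem_range, Prod.mk.injEq]
    constructor
    · rintro ⟨h, h'⟩; exact ⟨p, h', rfl, by omega⟩
    · rintro ⟨i, hi, rfl, rfl⟩; omega
  rw [hfil, Finset.sum_image (by intro i _ j _ h; exact (Prod.mk.inj h).1)] at h1
  simp only [map_mul, map_natCast, map_pow, map_neg, map_one, map_sum, hps] at h1
  rw [hy _ (by omega)] at h1
  push_cast at h1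
  rw [eRec_succ] at h1
  have h3 : ((-1 : ℂ)) ^ (k + 1 + 1) = (-1) ^ k := by rw [pow_add, pow_add]; ring
  rw [h3] at h1
  have h4 := mul_left_cancel₀ (pow_ne_zero _ (by norm_num)) h1
  rw [Finset.sum_range_succ', Finset.sum_range_succ'] at h4
  have h5 : ∑ i ∈ Finset.range k, (-1 : ℂ) ^ (i + 1) * eRec t (i + 1) * t (k - (i + 1)) =
      ∑ i ∈ Finset.range k, (-1 : ℂ) ^ (i + 1) * MvPolynomial.aeval y (MvPolynomial.esymm (Fin n) ℂ (i + 1)) * ∑ j, y j ^ (k + 1 - (i + 1)) := by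
    refine Finset.sum_congr rfl fun i hi => ?_
    have hi := Finset.mem_range.1 hi
    rw [hy _ (by omega), ← ih (k - (i + 1)) (by omega) (by omega)]
    congr 4
    have : k - (i + 1) + 1 = k + 1 - (i + 1) := by omega
    rw [this]
  rw [h5] at h4
  have h6 := add_left_cancel h4
  rw [hy 0 (by omega)] at h6
  simp only [eRec, pow_zero, Nat.sub_zero, one_mul] at h6
  exact h6.symm

lemma hom_vars {P : MvPolynomial ℕ ℂ} {j : ℕ} (hP : P.IsWeightedHomogeneous wt j) (s t : ℕ → ℂ)
    (h : ∀ k < j, s k = t k) : MvPolynomial.eval s P = MvPolynomial.eval t P := by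
  apply MvPolynomial.eval₂Hom_congr' rfl _ rfl
  intro i hi _
  apply h
  obtain ⟨α, hα, hi'⟩ := (MvPolynomial.mem_vars_iff_mem_support i).1 hi
  have hw := hP (MvPolynomial.mem_support_iff.1 hα)
  rw [weight_eq] at hw
  have h2 : α i * (i + 1) ≤ j := by
    rw [← hw]
    exact Finset.single_le_sum (f := fun i => α i * (i + 1)) (fun _ _ => Nat.zero_le _) hi'
  have : α i ≠ 0 := Finsupp.mem_support_iff.1 hi'
  nlinarith [Nat.one_le_iff_ne_zero.2 this]

/-- power sums as a point -/
def ps {n : ℕ} (y : Fin n → ℂ) (k : ℕ) : ℂ := ∑ i, y i ^ (k + 1)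

lemma ps_zero {n j : ℕ} {P : MvPolynomial ℕ ℂ} (hP : P.IsWeightedHomogeneous wt j) (hn : j ≤ n)
    (h : ∀ y : Fin n → ℂ, MvPolynomial.eval (ps y) P = 0) : P = 0 := by
  apply MvPolynomial.funext
  intro t
  obtain ⟨y, hy⟩ := exists_psum n t
  rw [map_zero, ← h y]
  exact hom_vars hP _ _ fun k hk => (hy k (by omega)).symm

/-- product Haar measure -/
noncomputable abbrev pm (n : ℕ) : Measure (Fin n → TT) := Measure.pi (fun _ => hm)

/-- points on the circle -/
noncomputable def xx {n : ℕ} (θ : Fin n → TT) (i : Fin n) : ℂ := fourier (-1) (θ i)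

lemma xx_continuous {n : ℕ} : Continuous (xx (n := n)) := by
  unfold xx
  refine continuous_pi fun i => ?_
  have : Continuous (fun x : TT => (fourier (-1) x : ℂ)) := by fun_prop
  exact this.comp (continuous_apply i)

lemma xx_norm {n : ℕ} (θ : Fin n → TT) (i : Fin n) : ‖xx θ i‖ = 1 := norm_fourier_pt _ _

lemma four_star (x : TT) : star (fourier (-1) x : ℂ) = fourier 1 x := by
  rw [fourier_neg]; simp

lemma four_mpow (k : ℕ) (x : TT) : (fourier (-1) x : ℂ) ^ k = fourier (-(k : ℤ)) x := by
  rw [fourier_neg_pow, fourier_neg]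
  congr 1
  rw [Complex.inv_def, Complex.normSq_eq_norm_sq, norm_fourier_pt]; simp

lemma int_four (n : ℤ) : ∫ x : TT, (fourier n x : ℂ) ∂hm = if n = 0 then 1 else 0 := by
  have h := fourierCoeff_fourier (T := 2 * Real.pi) n
  have h2 : fourierCoeff (fourier n : TT → ℂ) 0 = ∫ x : TT, (fourier n x : ℂ) ∂hm := by
    rw [fourierCoeff]; simp
  rw [← h2, h, Pi.single_apply]
  simp [eq_comm]

lemma four_coeff (n m : ℤ) : fourierCoeff (fourier n : TT → ℂ) m = if m = n then 1 else 0 := by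
  rw [fourierCoeff_fourier, Pi.single_apply]

lemma cauchy1 (k : ℕ) {w : ℂ} (hw : ‖w‖ < 1) :
    ∫ x : TT, (fourier (-1) x : ℂ) ^ k * (1 - fourier 1 x * w)⁻¹ ∂hm = w ^ k := by
  have h := pairing (fourier (-(k : ℤ))) (fun j : ℕ => w ^ j) (fun j => (j : ℤ))
    (by simpa using summable_geometric_of_lt_one (norm_nonneg w) hw) (F := fun x => (1 - fourier 1 x * w)⁻¹) ?_
  · have h2 : ∀ j : ℕ, w ^ j * fourierCoeff (fourier (-(k : ℤ)) : TT → ℂ) (-(j : ℤ)) = if j = k then w ^ k else 0 := by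
      intro j
      rw [four_coeff]
      by_cases hj : j = k
      · simp [hj]
      · simp [hj]
    have h3 := (hasSum_ite_eq k (w ^ k)).unique (hasSum_cng h (fun j => (h2 j).symm) rfl)
    rw [h3]
    simp only [four_mpow]
  · intro x
    have : ‖fourier 1 x * w‖ < 1 := by rw [norm_mul, norm_fourier_pt, one_mul]; exact hw
    refine hasSum_cng (hasSum_geometric_of_norm_lt_one this) (fun j => ?_) rfl
    rw [fourier_pow, mul_pow]; ring

lemma one_sub_ne {u w : ℂ} (hu : ‖u‖ ≤ 1) (hw : ‖w‖ < 1) : 1 - u * w ≠ 0 := by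
  intro h
  have : ‖u * w‖ < 1 := by
    rw [norm_mul]; nlinarith [norm_nonneg u, norm_nonneg w]
  rw [← sub_eq_zero.1 h] at this
  simp at this

lemma cauchyn {n : ℕ} (A : MvPolynomial (Fin n) ℂ) (w : Fin n → ℂ) (hw : ∀ i, ‖w i‖ < 1) :
    ∫ θ, MvPolynomial.eval (xx θ) A * ∏ i, (1 - star (xx θ i) * w i)⁻¹ ∂(pm n) = MvPolynomial.eval w A := by
  have hcont : ∀ A : MvPolynomial (Fin n) ℂ, Integrable (fun θ => MvPolynomial.eval (xx θ) A * ∏ i, (1 - star (xx θ i) * w i)⁻¹) (pm n) := by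
    intro A
    apply Continuous.integrable_of_hasCompactSupport _ (HasCompactSupport.of_compactSpace _)
    refine ((MvPolynomial.continuous_eval A).comp xx_continuous).mul ?_
    refine continuous_finsetProd _ fun i _ => ?_
    have h1 : Continuous fun θ : Fin n → TT => xx θ i := (continuous_apply i).comp xx_continuous
    refine Continuous.inv₀ (continuous_const.sub (h1.star.mul continuous_const)) fun θ => ?_
    exact one_sub_ne (by rw [norm_star, xx_norm]) (hw i)
  induction A using MvPolynomial.induction_on' with
  | monomial α c =>
    simp only [MvPolynomial.eval_monomial, Finsupp.prod_fintype _ _ (fun i => pow_zero _)]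
    have : ∀ θ : Fin n → TT, c * (∏ i, xx θ i ^ α i) * ∏ i, (1 - star (xx θ i) * w i)⁻¹ =
        c * ∏ i, ((fourier (-1) (θ i) : ℂ) ^ (α i) * (1 - fourier 1 (θ i) * w i)⁻¹) := by
      intro θ
      rw [mul_assoc, ← Finset.prod_mul_distrib]
      simp only [xx, four_star]
    simp only [this]
    rw [integral_const_mul]
    congr 1
    rw [integral_fintype_prod_eq_prod (fun i (x : TT) => (fourier (-1) x : ℂ) ^ (α i) * (1 - fourier 1 x * w i)⁻¹)]
    exact Finset.prod_congr rfl fun i _ => cauchy1 _ (hw i)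
  | add p q hp hq =>
    simp only [map_add, add_mul]
    rw [integral_add (hcont p) (hcont q), hp, hq]

/-- the Vandermonde determinant -/
noncomputable def VV {n : ℕ} (y : Fin n → ℂ) : ℂ := (Matrix.vandermonde y).det

/-- Cauchy cofactor polynomial -/
noncomputable def QN {n : ℕ} (y : Fin n → ℂ) (j : Fin n) : Polynomial ℂ :=
  ∏ l ∈ Finset.univ.erase j, (1 - Polynomial.C (y l) * Polynomial.X)

/-- Cauchy cofactor matrix -/
noncomputable def NN {n : ℕ} (y : Fin n → ℂ) : Matrix (Fin n) (Fin n) ℂ :=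
  Matrix.of fun j c => (QN y j).coeff c

lemma QN_deg {n : ℕ} (y : Fin n → ℂ) (j : Fin n) : (QN y j).natDegree < n := by
  have h : (QN y j).natDegree ≤ ∑ l ∈ Finset.univ.erase j, 1 := by
    refine (Polynomial.natDegree_prod_le _ _).trans (Finset.sum_le_sum fun l _ => ?_)
    have : (1 - Polynomial.C (y l) * Polynomial.X) = Polynomial.C (-(y l)) * Polynomial.X + Polynomial.C 1 := by
      simp; ring
    rw [this]; exact Polynomial.natDegree_linear_le
  rw [Finset.sum_const, Finset.card_erase_of_mem (Finset.mem_univ _), Finset.card_univ, Fintype.card_fin] at h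
  have := j.pos
  simp at h; omega

lemma QN_eval {n : ℕ} (y : Fin n → ℂ) (j : Fin n) (u : ℂ) :
    ∏ l ∈ Finset.univ.erase j, (1 - u * y l) = ∑ c : Fin n, u ^ (c : ℕ) * NN y j c := by
  have h1 : (QN y j).eval u = ∏ l ∈ Finset.univ.erase j, (1 - u * y l) := by
    rw [QN, Polynomial.eval_prod]
    refine Finset.prod_congr rfl fun l _ => ?_
    simp only [Polynomial.eval_sub, Polynomial.eval_one, Polynomial.eval_mul, Polynomial.eval_C, Polynomial.eval_X]
    ring
  rw [← h1, Polynomial.eval_eq_sum_range' (QN_deg y j), Finset.sum_range]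
  exact Finset.sum_congr rfl fun c _ => by rw [NN, Matrix.of_apply, mul_comm]

lemma cauchy_det {n : ℕ} (u y : Fin n → ℂ) (h : ∀ i j, 1 - u i * y j ≠ 0) :
    (Matrix.of fun i j => (1 - u i * y j)⁻¹).det =
      (∏ i, ∏ l, (1 - u i * y l)⁻¹) * (VV u * (NN y).det) := by
  have : (Matrix.of fun i j => (1 - u i * y j)⁻¹) =
      Matrix.diagonal (fun i => ∏ l, (1 - u i * y l)⁻¹) * (Matrix.vandermonde u * (NN y).transpose) := by
    ext i j
    rw [Matrix.diagonal_mul, Matrix.mul_apply]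
    simp only [Matrix.transpose_apply, Matrix.vandermonde_apply, Matrix.of_apply]
    rw [← QN_eval, ← Finset.mul_prod_erase _ _ (Finset.mem_univ j), mul_assoc, ← Finset.prod_mul_distrib]
    rw [Finset.prod_congr rfl fun l _ => inv_mul_cancel₀ (h i l)]
    simp
  rw [this, Matrix.det_mul, Matrix.det_mul, Matrix.det_diagonal, Matrix.det_transpose, VV]

/-- Vandermonde as polynomial -/
noncomputable def VP (n : ℕ) : MvPolynomial (Fin n) ℂ := (Matrix.vandermonde (fun i => MvPolynomial.X i)).det

lemma VP_eval {n : ℕ} (y : Fin n → ℂ) : MvPolynomial.eval y (VP n) = VV y := by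
  rw [VP, RingHom.map_det, VV]
  congr 1
  ext i j
  simp [Matrix.vandermonde_apply]

lemma VP_ne (n : ℕ) : VP n ≠ 0 := by
  intro h
  have h1 : VV (fun i : Fin n => ((i : ℕ) : ℂ)) = 0 := by rw [← VP_eval, h, map_zero]
  refine (Matrix.det_vandermonde_ne_zero_iff.2 ?_) h1
  intro i j hij
  exact Fin.ext (Nat.cast_injective (R := ℂ) hij)

/-- power sum substitution -/
noncomputable def psP (n : ℕ) (P : MvPolynomial ℕ ℂ) : MvPolynomial (Fin n) ℂ :=
  MvPolynomial.aeval (fun k => ∑ i, (MvPolynomial.X i : MvPolynomial (Fin n) ℂ) ^ (k + 1)) P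

lemma psP_eval {n : ℕ} (P : MvPolynomial ℕ ℂ) (y : Fin n → ℂ) :
    MvPolynomial.eval y (psP n P) = MvPolynomial.eval (ps y) P := by
  induction P using MvPolynomial.induction_on with
  | C a => simp [psP]
  | add p q hp hq => simp only [psP, map_add] at *; rw [hp, hq]
  | mul_X p k hp => simp only [psP, map_mul] at *; rw [hp]; simp [ps]

lemma VV_perm {n : ℕ} (y : Fin n → ℂ) (σ : Equiv.Perm (Fin n)) :
    VV (fun i => y (σ i)) = (Equiv.Perm.sign σ : ℂ) * VV y := by
  have := Matrix.det_permute σ (Matrix.vandermonde y)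
  rw [VV, VV]
  rw [← this]; rfl

lemma ps_perm {n : ℕ} (y : Fin n → ℂ) (σ : Equiv.Perm (Fin n)) : ps (fun i => y (σ i)) = ps y := by
  ext k
  exact Equiv.sum_comp σ (fun i => y i ^ (k + 1))

lemma VV_star {n : ℕ} (y : Fin n → ℂ) : VV (fun i => star (y i)) = star (VV y) := by
  rw [VV, VV, Matrix.det_vandermonde, Matrix.det_vandermonde]
  simp

/-- kernel -/
noncomputable def kap {n : ℕ} (θ : Fin n → TT) (y : Fin n → ℂ) : ℂ := ∏ i, ∏ l, (1 - star (xx θ i) * y l)⁻¹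

lemma kap_formula {n : ℕ} (P : MvPolynomial ℕ ℂ) (y : Fin n → ℂ) (hy : ∀ i, ‖y i‖ < 1) :
    (NN y).det * ∫ θ, (VV (xx θ) * star (VV (xx θ))) * (MvPolynomial.eval (ps (xx θ)) P * kap θ y) ∂(pm n)
      = n.factorial * (MvPolynomial.eval (ps y) P * VV y) := by
  rw [← integral_const_mul]
  have h1 : ∀ θ : Fin n → TT, (NN y).det * ((VV (xx θ) * star (VV (xx θ))) * (MvPolynomial.eval (ps (xx θ)) P * kap θ y)) =
      ∑ σ : Equiv.Perm (Fin n), (Equiv.Perm.sign σ : ℂ) * (MvPolynomial.eval (xx θ) (psP n P * VP n) * ∏ i, (1 - star (xx θ i) * y (σ i))⁻¹) := by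
    intro θ
    have h2 := cauchy_det (fun i => star (xx θ i)) y (fun i j => one_sub_ne (by rw [norm_star, xx_norm]) (hy j))
    rw [← Matrix.det_transpose, Matrix.det_apply'] at h2
    simp only [Matrix.transpose_apply, Matrix.of_apply] at h2
    rw [VV_star] at h2
    have h3 : (NN y).det * ((VV (xx θ) * star (VV (xx θ))) * (MvPolynomial.eval (ps (xx θ)) P * kap θ y)) =
      (MvPolynomial.eval (ps (xx θ)) P * VV (xx θ)) * (kap θ y * (star (VV (xx θ)) * (NN y).det)) := by ring
    rw [h3, kap, ← h2, Finset.mul_sum]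
    refine Finset.sum_congr rfl fun σ _ => ?_
    rw [map_mul, psP_eval, VP_eval]; ring
  simp only [h1]
  rw [integral_finsetSum]
  · have h4 : ∀ σ : Equiv.Perm (Fin n), ∫ θ, (Equiv.Perm.sign σ : ℂ) * (MvPolynomial.eval (xx θ) (psP n P * VP n) * ∏ i, (1 - star (xx θ i) * y (σ i))⁻¹) ∂(pm n) = MvPolynomial.eval (ps y) P * VV y := by
      intro σ
      rw [integral_const_mul, cauchyn _ (fun i => y (σ i)) (fun i => hy _), map_mul, psP_eval, VP_eval, ps_perm, VV_perm]
      have : (Equiv.Perm.sign σ : ℂ) * (Equiv.Perm.sign σ : ℂ) = 1 := by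
        rcases Int.units_eq_one_or (Equiv.Perm.sign σ) with h | h <;> simp [h]
      linear_combination (MvPolynomial.eval (ps y) P * VV y) * this
    rw [Finset.sum_congr rfl fun σ _ => h4 σ, Finset.sum_const, Finset.card_univ, Fintype.card_perm, Fintype.card_fin, nsmul_eq_mul]
  · intro σ _
    refine Integrable.const_mul ?_ _
    apply Continuous.integrable_of_hasCompactSupport _ (HasCompactSupport.of_compactSpace _)
    refine ((MvPolynomial.continuous_eval _).comp xx_continuous).mul ?_
    refine continuous_finsetProd _ fun i _ => ?_
    have h1 : Continuous fun θ : Fin n → TT => xx θ i := (continuous_apply i).comp xx_continuous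
    refine Continuous.inv₀ (continuous_const.sub (h1.star.mul continuous_const)) fun θ => ?_
    exact one_sub_ne (by rw [norm_star, xx_norm]) (hy _)

/-- CUE expectation -/
noncomputable def EE (n : ℕ) (f : (Fin n → TT) → ℂ) : ℂ :=
  (n.factorial : ℂ)⁻¹ * ∫ θ, (VV (xx θ) * star (VV (xx θ))) * f θ ∂(pm n)

lemma VVx_continuous {n : ℕ} : Continuous fun θ : Fin n → TT => VV (xx θ) := by
  simp only [← VP_eval]
  exact (MvPolynomial.continuous_eval _).comp xx_continuous

lemma EE_intble {n : ℕ} {f : (Fin n → TT) → ℂ} (hf : Continuous f) :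
    Integrable (fun θ => (VV (xx θ) * star (VV (xx θ))) * f θ) (pm n) :=
  Continuous.integrable_of_hasCompactSupport ((VVx_continuous.mul VVx_continuous.star).mul hf) (HasCompactSupport.of_compactSpace _)

lemma EE_one (n : ℕ) : EE n (fun _ => 1) = 1 := by
  have h1 : ∀ θ : Fin n → TT, (VV (xx θ) * star (VV (xx θ))) * 1 =
      ∑ σ : Equiv.Perm (Fin n), ∑ τ : Equiv.Perm (Fin n), ((Equiv.Perm.sign σ : ℂ) * (Equiv.Perm.sign τ : ℂ)) *
        ∏ i, (fourier ((τ i : ℕ) - (σ i : ℕ) : ℤ) (θ i) : ℂ) := by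
    intro θ
    rw [mul_one, ← VV_star, VV, VV, ← Matrix.det_transpose, ← Matrix.det_transpose (Matrix.vandermonde fun i => star (xx θ i)), Matrix.det_apply', Matrix.det_apply', Finset.sum_mul_sum]
    refine Finset.sum_congr rfl fun σ _ => Finset.sum_congr rfl fun τ _ => ?_
    rw [mul_mul_mul_comm, ← Finset.prod_mul_distrib]
    congr 1
    refine Finset.prod_congr rfl fun i _ => ?_
    simp only [Matrix.transpose_apply, Matrix.vandermonde_apply, xx, four_star, four_mpow]
    rw [← fourier_pow, ← fourier_add, neg_add_eq_sub]
  have h2 : ∀ σ τ : Equiv.Perm (Fin n), ∫ θ : Fin n → TT, ((Equiv.Perm.sign σ : ℂ) * (Equiv.Perm.sign τ : ℂ)) *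
        ∏ i, (fourier ((τ i : ℕ) - (σ i : ℕ) : ℤ) (θ i) : ℂ) ∂(pm n) = if σ = τ then 1 else 0 := by
    intro σ τ
    rw [integral_const_mul, integral_fintype_prod_eq_prod (fun i (x : TT) => (fourier ((τ i : ℕ) - (σ i : ℕ) : ℤ) x : ℂ))]
    simp only [int_four]
    by_cases h : σ = τ
    · subst h
      have : (Equiv.Perm.sign σ : ℂ) * (Equiv.Perm.sign σ : ℂ) = 1 := by
        rcases Int.units_eq_one_or (Equiv.Perm.sign σ) with h | h <;> simp [h]
      simp [this]
    · rw [if_neg h]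
      obtain ⟨i, hi⟩ : ∃ i, σ i ≠ τ i := by
        by_contra hh; push Not at hh; exact h (Equiv.ext hh)
      rw [Finset.prod_eq_zero (Finset.mem_univ i), mul_zero]
      rw [if_neg]
      intro h'
      apply hi
      apply Fin.ext
      omega
  have hIntg : ∀ σ τ : Equiv.Perm (Fin n), Integrable (fun θ : Fin n → TT => ((Equiv.Perm.sign σ : ℂ) * (Equiv.Perm.sign τ : ℂ)) *
        ∏ i, (fourier ((τ i : ℕ) - (σ i : ℕ) : ℤ) (θ i) : ℂ)) (pm n) := by
    intro σ τ
    apply Continuous.integrable_of_hasCompactSupport _ (HasCompactSupport.of_compactSpace _)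
    fun_prop
  rw [EE]
  simp only [h1]
  rw [integral_finsetSum _ (fun σ _ => integrable_finsetSum _ fun τ _ => hIntg σ τ)]
  simp only [integral_finsetSum _ (fun τ _ => hIntg _ τ), h2]
  simp only [Finset.sum_ite_eq, Finset.mem_univ, if_true, Finset.sum_const, Finset.card_univ, Fintype.card_perm, Fintype.card_fin, nsmul_eq_mul, mul_one]
  exact inv_mul_cancel₀ (by exact_mod_cast n.factorial_ne_zero)

/-- rotation -/
noncomputable def rot {n : ℕ} (t : TT) (θ : Fin n → TT) : Fin n → TT := fun i => θ i + t

lemma rot_mp {n : ℕ} (t : TT) : MeasurePreserving (rot (n := n) t) (pm n) (pm n) :=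
  measurePreserving_pi _ _ (fun _ => measurePreserving_add_right hm t)

lemma rot_xx {n : ℕ} (t : TT) (θ : Fin n → TT) : xx (rot t θ) = fun i => fourier (-1) t * xx θ i := by
  ext i
  simp only [xx, rot, fourier_apply, smul_add, AddCircle.toCircle_add, Circle.coe_mul]
  ring

lemma ps_smul {n : ℕ} (c : ℂ) (y : Fin n → ℂ) : ps (fun i => c * y i) = fun k => c ^ (k + 1) * ps y k := by
  ext k
  simp only [ps, mul_pow, Finset.mul_sum]

lemma VV_smul {n : ℕ} (c : ℂ) (y : Fin n → ℂ) : ∃ N : ℕ, VV (fun i => c * y i) = c ^ N * VV y := by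
  refine ⟨∑ i : Fin n, (i : ℕ), ?_⟩
  have : Matrix.vandermonde (fun i => c * y i) = Matrix.vandermonde y * Matrix.diagonal (fun j : Fin n => c ^ (j : ℕ)) := by
    ext i j
    rw [Matrix.mul_diagonal]
    simp [Matrix.vandermonde_apply, mul_pow, mul_comm]
  rw [VV, this, Matrix.det_mul, Matrix.det_diagonal, Finset.prod_pow_eq_pow_sum, VV, mul_comm]

lemma VV_rot {n : ℕ} (t : TT) (θ : Fin n → TT) : VV (xx (rot t θ)) * star (VV (xx (rot t θ))) = VV (xx θ) * star (VV (xx θ)) := by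
  rw [rot_xx]
  obtain ⟨N, hN⟩ := VV_smul (fourier (-1) t) (xx θ)
  rw [hN, star_mul']
  have : (fourier (-1) t : ℂ) ^ N * star ((fourier (-1) t : ℂ) ^ N) = 1 := by
    have := Complex.mul_conj ((fourier (-1) t : ℂ) ^ N)
    rw [Complex.normSq_eq_norm_sq, norm_pow, norm_fourier_pt] at this
    simpa using this
  linear_combination (VV (xx θ) * star (VV (xx θ))) * this

lemma EE_rot {n : ℕ} (f : (Fin n → TT) → ℂ) (t : TT) : EE n (fun θ => f (rot t θ)) = EE n f := by
  rw [EE, EE]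
  congr 1
  have h := (rot_mp (n := n) t).integral_comp' (f := Homeomorph.toMeasurableEquiv
    (Homeomorph.addRight (fun _ : Fin n => t))) (fun θ => (VV (xx θ) * star (VV (xx θ))) * f θ)
  rw [← h]
  congr 1; ext θ
  have : (Homeomorph.addRight (fun _ : Fin n => t)).toMeasurableEquiv θ = rot t θ := rfl
  rw [this, VV_rot]

lemma exists_four_ne {m : ℤ} (hm0 : m ≠ 0) : ∃ t : TT, (fourier m t : ℂ) ≠ 1 := by
  by_contra hh
  push Not at hh
  have := int_four m
  simp [hh, hm0] at this

lemma EE_orth {n : ℕ} (f : (Fin n → TT) → ℂ) {m : ℤ} (hm0 : m ≠ 0)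
    (h : ∀ t θ, f (rot t θ) = fourier m t * f θ) : EE n f = 0 := by
  obtain ⟨t, ht⟩ := exists_four_ne hm0
  have h1 := EE_rot f t
  simp only [h] at h1
  have h2 : EE n (fun θ => fourier m t * f θ) = fourier m t * EE n f := by
    rw [EE, EE, mul_left_comm]
    congr 1
    rw [← integral_const_mul]
    congr 1; ext θ; ring
  rw [h2] at h1
  have h3 : ((fourier m t : ℂ) - 1) * EE n f = 0 := by rw [sub_mul, h1]; ring
  exact (mul_eq_zero.1 h3).resolve_left (sub_ne_zero.2 ht)

/-- kernel arguments -/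
noncomputable def KT {n : ℕ} (θ : Fin n → TT) (y : Fin n → ℂ) (i : ℕ) : ℂ := star (ps (xx θ) i) * ps y i

lemma exists_rho {n : ℕ} (y : Fin n → ℂ) (hy : ∀ i, ‖y i‖ < 1) : ∃ ρ : ℝ, 0 < ρ ∧ ρ < 1 ∧ ∀ i, ‖y i‖ ≤ ρ := by
  obtain ⟨M, hM⟩ : ∃ M : ℝ, M < 1 ∧ ∀ i, ‖y i‖ ≤ M := by
    by_cases h : Nonempty (Fin n)
    · obtain ⟨i, hi⟩ := Finite.exists_max (fun i => ‖y i‖)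
      exact ⟨‖y i‖, hy i, hi⟩
    · exact ⟨0, one_pos, fun i => absurd ⟨i⟩ h⟩
  refine ⟨max M (1 / 2), by positivity, max_lt hM.1 (by norm_num), fun i => (hM.2 i).trans (le_max_left _ _)⟩

lemma kap_hasSum {n : ℕ} (θ : Fin n → TT) (y : Fin n → ℂ) (hy : ∀ i, ‖y i‖ < 1) :
    HasSum (fun m => MvPolynomial.eval (KT θ y) (WP m)) (kap θ y) := by
  obtain ⟨ρ, h0, h1, hρ⟩ := exists_rho y hy
  have h := expP_hasSum (R := fun i => MvPolynomial.X i) (t := KT θ y) (r := ρ⁻¹) (inv_pos.2 h0)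
    (f := fun s => ∑ i, ∑ l, -Complex.log (1 - star (xx θ i) * y l * s)) ?_ (s := 1) (by simpa using one_lt_inv₀ h0 |>.2 h1)
  · simp only [one_pow, mul_one] at h
    refine hasSum_cng h (fun m => rfl) ?_
    rw [Complex.exp_sum, kap]
    refine Finset.prod_congr rfl fun i _ => ?_
    rw [Complex.exp_sum]
    refine Finset.prod_congr rfl fun l _ => ?_
    rw [Complex.exp_neg, Complex.exp_log (one_sub_ne (by rw [norm_star, xx_norm]) (hy l))]
  · intro s hs
    have hz : ∀ i l, ‖star (xx θ i) * y l * s‖ < 1 := by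
      intro i l
      rw [norm_mul, norm_mul, norm_star, xx_norm, one_mul]
      calc ‖y l‖ * ‖s‖ ≤ ρ * ‖s‖ := mul_le_mul_of_nonneg_right (hρ l) (norm_nonneg _)
        _ < ρ * ρ⁻¹ := mul_lt_mul_of_pos_left hs h0
        _ = 1 := mul_inv_cancel₀ h0.ne'
    have := hasSum_sum (s := Finset.univ) fun i _ => hasSum_sum (s := Finset.univ) fun l _ => Complex.hasSum_taylorSeries_neg_log' (hz i l)
    refine hasSum_cng this (fun k => ?_) rfl
    simp only [MvPolynomial.eval_X, KT, ps, star_sum, star_pow, Finset.sum_mul, Finset.sum_div, mul_pow]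
    refine Finset.sum_congr rfl fun i _ => ?_
    rw [Finset.mul_sum, Finset.sum_div, Finset.sum_mul]
    refine Finset.sum_congr rfl fun l _ => ?_
    ring

lemma WP_eval (m : ℕ) (T : ℕ → ℂ) : MvPolynomial.eval T (WP m) =
    ∑ α ∈ (WP m).support, ((zz α)⁻¹ : ℝ) * ∏ i ∈ α.support, T i ^ α i := by
  rw [MvPolynomial.eval_eq]
  exact Finset.sum_congr rfl fun α hα => by rw [WP_coeff m α (WP_support.1 hα)]

lemma WP_bound (m : ℕ) (T : ℕ → ℂ) (R : ℕ → ℝ) (h : ∀ i, ‖T i‖ ≤ R i) :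
    ‖MvPolynomial.eval T (WP m)‖ ≤ ‖MvPolynomial.eval (fun i => (R i : ℂ)) (WP m)‖ := by
  have hR : ∀ i, 0 ≤ R i := fun i => (norm_nonneg _).trans (h i)
  have h2 : MvPolynomial.eval (fun i => (R i : ℂ)) (WP m) = ((∑ α ∈ (WP m).support, (zz α)⁻¹ * ∏ i ∈ α.support, R i ^ α i : ℝ) : ℂ) := by
    rw [WP_eval]; push_cast; rfl
  rw [h2, Complex.norm_real, Real.norm_eq_abs, abs_of_nonneg (Finset.sum_nonneg fun α _ =>
    mul_nonneg (inv_nonneg.2 (zz_pos α).le) (Finset.prod_nonneg fun i _ => pow_nonneg (hR i) _)), WP_eval]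
  refine (norm_sum_le _ _).trans (Finset.sum_le_sum fun α _ => ?_)
  rw [norm_mul, Complex.norm_real, Real.norm_eq_abs, abs_of_nonneg (inv_nonneg.2 (zz_pos α).le), norm_prod]
  refine mul_le_mul_of_nonneg_left ?_ (inv_nonneg.2 (zz_pos α).le)
  refine Finset.prod_le_prod (fun i _ => norm_nonneg _) fun i _ => ?_
  rw [norm_pow]
  exact pow_le_pow_left₀ (norm_nonneg _) (h i) _

lemma WP_summ (K ρ : ℝ) (h0 : 0 < ρ) (h1 : ρ < 1) :
    Summable fun m => ‖MvPolynomial.eval (fun i => ((K * ρ ^ (i + 1) : ℝ) : ℂ)) (WP m)‖ := by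
  have h := expP_hasSum (R := fun i => MvPolynomial.X i) (t := fun i => ((K * ρ ^ (i + 1) : ℝ) : ℂ)) (r := ρ⁻¹) (inv_pos.2 h0)
    (f := fun s => K * -Complex.log (1 - ρ * s)) ?_ (s := 1) (by simpa using one_lt_inv₀ h0 |>.2 h1)
  · simp only [one_pow, mul_one] at h
    exact h.summable.norm
  · intro s hs
    have hz : ‖(ρ : ℂ) * s‖ < 1 := by
      rw [norm_mul, Complex.norm_real, Real.norm_eq_abs, abs_of_pos h0]
      calc ρ * ‖s‖ < ρ * ρ⁻¹ := mul_lt_mul_of_pos_left hs h0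
        _ = 1 := mul_inv_cancel₀ h0.ne'
    refine hasSum_cng ((Complex.hasSum_taylorSeries_neg_log' hz).mul_left (K : ℂ)) (fun i => ?_) rfl
    rw [MvPolynomial.eval_X]; push_cast; ring

lemma ps_norm {n : ℕ} (y : Fin n → ℂ) {ρ : ℝ} (hρ : ∀ i, ‖y i‖ ≤ ρ) (k : ℕ) : ‖ps y k‖ ≤ n * ρ ^ (k + 1) := by
  refine (norm_sum_le _ _).trans ?_
  calc ∑ i, ‖y i ^ (k + 1)‖ ≤ ∑ i : Fin n, ρ ^ (k + 1) := Finset.sum_le_sum fun i _ => by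
        rw [norm_pow]; exact pow_le_pow_left₀ (norm_nonneg _) (hρ i) _
    _ = n * ρ ^ (k + 1) := by simp

lemma psx_norm {n : ℕ} (θ : Fin n → TT) (k : ℕ) : ‖ps (xx θ) k‖ ≤ n := by
  have := ps_norm (xx θ) (ρ := 1) (fun i => (xx_norm θ i).le) k
  simpa using this

lemma psx_continuous {n : ℕ} (k : ℕ) : Continuous fun θ : Fin n → TT => ps (xx θ) k := by
  unfold ps
  refine continuous_finsetSum _ fun i _ => ?_
  exact ((continuous_apply i).comp xx_continuous).pow _

lemma polx_continuous {n : ℕ} (P : MvPolynomial ℕ ℂ) : Continuous fun θ : Fin n → TT => MvPolynomial.eval (ps (xx θ)) P := by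
  refine (MvPolynomial.continuous_eval P).comp (continuous_pi fun k => psx_continuous k)

lemma KT_continuous {n : ℕ} (y : Fin n → ℂ) (P : MvPolynomial ℕ ℂ) : Continuous fun θ : Fin n → TT => MvPolynomial.eval (KT θ y) P := by
  refine (MvPolynomial.continuous_eval P).comp (continuous_pi fun k => ?_)
  exact (psx_continuous k).star.mul continuous_const

lemma VVx_bound (n : ℕ) : ∃ C : ℝ, ∀ θ : Fin n → TT, ‖VV (xx θ) * star (VV (xx θ))‖ ≤ C := by
  obtain ⟨C, hC⟩ := isCompact_univ.exists_bound_of_continuousOn (f := fun θ : Fin n → TT => VV (xx θ) * star (VV (xx θ)))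
    (VVx_continuous.mul VVx_continuous.star).continuousOn
  exact ⟨C, fun θ => hC θ trivial⟩

lemma EE_kap_hasSum {n : ℕ} (f : (Fin n → TT) → ℂ) (hf : Continuous f) (y : Fin n → ℂ) (hy : ∀ i, ‖y i‖ < 1) :
    HasSum (fun m => EE n (fun θ => f θ * MvPolynomial.eval (KT θ y) (WP m))) (EE n (fun θ => f θ * kap θ y)) := by
  obtain ⟨ρ, h0, h1, hρ⟩ := exists_rho y hy
  obtain ⟨C, hC⟩ := isCompact_univ.exists_bound_of_continuousOn (f := fun θ : Fin n → TT => VV (xx θ) * star (VV (xx θ)) * f θ)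
    ((VVx_continuous.mul VVx_continuous.star).mul hf).continuousOn
  have hIntg : ∀ m, Integrable (fun θ => (VV (xx θ) * star (VV (xx θ))) * (f θ * MvPolynomial.eval (KT θ y) (WP m))) (pm n) :=
    fun m => EE_intble (hf.mul (KT_continuous y _))
  have h := hasSum_integral_of_summable_integral_norm (μ := pm n)
    (F := fun m (θ : Fin n → TT) => (VV (xx θ) * star (VV (xx θ))) * (f θ * MvPolynomial.eval (KT θ y) (WP m))) hIntg ?_
  · refine hasSum_cng (h.mul_left (n.factorial : ℂ)⁻¹) (fun m => rfl) ?_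
    rw [EE]
    congr 2; ext θ
    exact ((((kap_hasSum θ y hy).mul_left (f θ)).mul_left _).tsum_eq).symm
  · refine Summable.of_nonneg_of_le (fun i => integral_nonneg fun x => norm_nonneg _) (fun m => ?_)
      ((WP_summ (n * n) ρ h0 h1).mul_left C)
    have hb : ∀ θ, ‖(VV (xx θ) * star (VV (xx θ))) * (f θ * MvPolynomial.eval (KT θ y) (WP m))‖ ≤
        C * ‖MvPolynomial.eval (fun i => (((n * n : ℝ) * ρ ^ (i + 1) : ℝ) : ℂ)) (WP m)‖ := by
      intro θ
      rw [← mul_assoc, norm_mul]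
      refine mul_le_mul (hC θ trivial) ?_ (norm_nonneg _) ((norm_nonneg _).trans (hC θ trivial))
      refine WP_bound m _ _ fun i => ?_
      rw [KT, norm_mul, norm_star, mul_assoc]
      exact mul_le_mul (psx_norm θ i) (ps_norm y hρ i) (norm_nonneg _) (by positivity)
    calc _ ≤ ∫ θ : Fin n → TT, C * ‖MvPolynomial.eval (fun i => (((n * n : ℝ) * ρ ^ (i + 1) : ℝ) : ℂ)) (WP m)‖ ∂(pm n) :=
          integral_mono (hIntg m).norm (integrable_const _) hb
      _ = _ := by simp

lemma pol_rot {n j : ℕ} {P : MvPolynomial ℕ ℂ} (hP : P.IsWeightedHomogeneous wt j) (t : TT) (θ : Fin n → TT) :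
    MvPolynomial.eval (ps (xx (rot t θ))) P = fourier (-(j : ℤ)) t * MvPolynomial.eval (ps (xx θ)) P := by
  rw [rot_xx, ps_smul, hom_scale hP, four_mpow]

lemma KT_rot {n m : ℕ} (y : Fin n → ℂ) {P : MvPolynomial ℕ ℂ} (hP : P.IsWeightedHomogeneous wt m) (t : TT) (θ : Fin n → TT) :
    MvPolynomial.eval (KT (rot t θ) y) P = fourier (m : ℤ) t * MvPolynomial.eval (KT θ y) P := by
  have : KT (rot t θ) y = fun i => (fourier 1 t : ℂ) ^ (i + 1) * KT θ y i := by
    ext i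
    rw [KT, rot_xx, ps_smul, star_mul', star_pow, four_star, KT, mul_assoc]
  rw [this, hom_scale hP, fourier_pow]

lemma EE_kap {n j : ℕ} {P : MvPolynomial ℕ ℂ} (hP : P.IsWeightedHomogeneous wt j) (y : Fin n → ℂ) (hy : ∀ i, ‖y i‖ < 1) :
    EE n (fun θ => MvPolynomial.eval (ps (xx θ)) P * kap θ y) =
      EE n (fun θ => MvPolynomial.eval (ps (xx θ)) P * MvPolynomial.eval (KT θ y) (WP j)) := by
  have h := EE_kap_hasSum (fun θ => MvPolynomial.eval (ps (xx θ)) P) (polx_continuous P) y hy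
  refine h.unique (hasSum_single j fun m hm => ?_)
  refine EE_orth _ (m := (m : ℤ) - j) (by omega) fun t θ => ?_
  rw [pol_rot hP, KT_rot y (WP_hom m), sub_eq_neg_add, fourier_add]; ring

lemma NN_det {n : ℕ} (y : Fin n → ℂ) (hy : ∀ i, ‖y i‖ < 1) : (NN y).det = VV y := by
  have h := kap_formula (n := n) 1 y hy
  have h0 : (n.factorial : ℂ) ≠ 0 := by exact_mod_cast n.factorial_ne_zero
  have h1 := EE_kap (n := n) (MvPolynomial.isWeightedHomogeneous_one ℂ wt) y hy
  have hw : WP 0 = 1 := expP_zero _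
  simp only [hw, map_one, mul_one] at h1
  rw [EE_one, EE, inv_mul_eq_iff_eq_mul₀ h0] at h1
  simp only [map_one] at h
  rw [h1] at h
  have : (n.factorial : ℂ) * (NN y).det = n.factorial * VV y := by linear_combination h
  exact mul_left_cancel₀ h0 this

lemma EE_repr {n j : ℕ} {P : MvPolynomial ℕ ℂ} (hP : P.IsWeightedHomogeneous wt j) (y : Fin n → ℂ) (hy : ∀ i, ‖y i‖ < 1) :
    VV y * EE n (fun θ => MvPolynomial.eval (ps (xx θ)) P * MvPolynomial.eval (KT θ y) (WP j)) =
      VV y * MvPolynomial.eval (ps y) P := by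
  have h := kap_formula (n := n) P y hy
  have h0 : (n.factorial : ℂ) ≠ 0 := by exact_mod_cast n.factorial_ne_zero
  rw [← EE_kap hP y hy, EE, ← NN_det y hy, mul_left_comm, h, ← mul_assoc, inv_mul_cancel₀ h0, NN_det y hy]; ring

/-- real CUE second moment -/
noncomputable def EN (n : ℕ) (P : MvPolynomial ℕ ℂ) : ℝ :=
  (n.factorial : ℝ)⁻¹ * ∫ θ, ‖VV (xx θ)‖ ^ 2 * ‖MvPolynomial.eval (ps (xx θ)) P‖ ^ 2 ∂(pm n)

lemma star_mul_norm (z : ℂ) : z * star z = ((‖z‖ ^ 2 : ℝ) : ℂ) := by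
  have := Complex.mul_conj z
  rw [Complex.normSq_eq_norm_sq] at this
  exact this

lemma EN_eq (n : ℕ) (P : MvPolynomial ℕ ℂ) :
    EE n (fun θ => MvPolynomial.eval (ps (xx θ)) P * star (MvPolynomial.eval (ps (xx θ)) P)) = (EN n P : ℂ) := by
  rw [EE, EN]
  push_cast
  rw [← integral_complex_ofReal]
  congr 2; ext θ
  rw [star_mul_norm, star_mul_norm]; push_cast; rfl

/-- monomial values -/
noncomputable def mon (α : ℕ →₀ ℕ) (t : ℕ → ℂ) : ℂ := ∏ i ∈ α.support, t i ^ α i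

lemma eval_mon {P : MvPolynomial ℕ ℂ} {S : Finset (ℕ →₀ ℕ)} (h : P.support ⊆ S) (t : ℕ → ℂ) :
    MvPolynomial.eval t P = ∑ α ∈ S, MvPolynomial.coeff α P * mon α t := by
  rw [MvPolynomial.eval_eq]
  refine Finset.sum_subset h fun α _ hα => ?_
  rw [MvPolynomial.notMem_support_iff.1 hα]; simp

lemma mon_continuous {n : ℕ} (α : ℕ →₀ ℕ) : Continuous fun θ : Fin n → TT => mon α (ps (xx θ)) := by
  unfold mon
  exact continuous_finsetProd _ fun i _ => (psx_continuous i).pow _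

lemma EE_sum {n : ℕ} {ι : Type*} (S : Finset ι) (c : ι → ℂ) (g : ι → (Fin n → TT) → ℂ) (hg : ∀ i, Continuous (g i)) :
    EE n (fun θ => ∑ i ∈ S, c i * g i θ) = ∑ i ∈ S, c i * EE n (g i) := by
  simp only [EE, Finset.mul_sum]
  rw [integral_finsetSum]
  · rw [Finset.mul_sum]
    refine Finset.sum_congr rfl fun i _ => ?_
    rw [mul_left_comm]
    congr 1
    rw [← integral_const_mul]
    congr 1; ext θ; ring
  · intro i _
    exact EE_intble (continuous_const.mul (hg i))

/-- projected coefficient -/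
noncomputable def cpr (n : ℕ) (P : MvPolynomial ℕ ℂ) (α : ℕ →₀ ℕ) : ℂ :=
  ((zz α)⁻¹ : ℝ) * EE n (fun θ => MvPolynomial.eval (ps (xx θ)) P * star (mon α (ps (xx θ))))

/-- projected polynomial -/
noncomputable def Ppr (n j : ℕ) (P : MvPolynomial ℕ ℂ) : MvPolynomial ℕ ℂ :=
  ∑ α ∈ (WP j).support, MvPolynomial.monomial α (cpr n P α)

lemma Ppr_coeff {n j : ℕ} {P : MvPolynomial ℕ ℂ} {α : ℕ →₀ ℕ} (h : α ∈ (WP j).support) :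
    MvPolynomial.coeff α (Ppr n j P) = cpr n P α := by
  classical
  rw [Ppr, MvPolynomial.coeff_sum]
  simp only [MvPolynomial.coeff_monomial]
  rw [Finset.sum_ite_eq' , if_pos h]

lemma Ppr_hom (n j : ℕ) (P : MvPolynomial ℕ ℂ) : (Ppr n j P).IsWeightedHomogeneous wt j := by
  rw [Ppr]
  refine MvPolynomial.IsWeightedHomogeneous.sum _ _ _ fun α hα => ?_
  exact MvPolynomial.isWeightedHomogeneous_monomial wt α _ (WP_support.1 hα)

lemma Ppr_eval (n j : ℕ) (P : MvPolynomial ℕ ℂ) (y : Fin n → ℂ) :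
    EE n (fun θ => MvPolynomial.eval (ps (xx θ)) P * MvPolynomial.eval (KT θ y) (WP j)) = MvPolynomial.eval (ps y) (Ppr n j P) := by
  have h1 : ∀ θ : Fin n → TT, MvPolynomial.eval (ps (xx θ)) P * MvPolynomial.eval (KT θ y) (WP j) =
      ∑ α ∈ (WP j).support, (((zz α)⁻¹ : ℝ) * mon α (ps y)) * (MvPolynomial.eval (ps (xx θ)) P * star (mon α (ps (xx θ)))) := by
    intro θ
    rw [WP_eval, Finset.mul_sum]
    refine Finset.sum_congr rfl fun α _ => ?_
    simp only [KT, mon, mul_pow, Finset.prod_mul_distrib, star_prod, star_pow]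
    ring
  simp only [h1]
  rw [EE_sum _ _ (fun α θ => MvPolynomial.eval (ps (xx θ)) P * star (mon α (ps (xx θ)))) (fun α => (polx_continuous P).mul (mon_continuous α).star), eval_mon (hom_support (Ppr_hom n j P))]
  refine Finset.sum_congr rfl fun α hα => ?_
  rw [Ppr_coeff hα, cpr]; ring

lemma Ppr_zero {n j : ℕ} {P : MvPolynomial ℕ ℂ} (hP : P.IsWeightedHomogeneous wt j) (y : Fin n → ℂ) :
    VV y * MvPolynomial.eval (ps y) (Ppr n j P) = VV y * MvPolynomial.eval (ps y) P := by
  obtain ⟨s, hs0, hs⟩ : ∃ s : ℝ, 0 < s ∧ ∀ i, ‖(s : ℂ) * y i‖ < 1 := by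
    have hK : 0 ≤ ∑ i, ‖y i‖ := Finset.sum_nonneg fun i _ => norm_nonneg _
    refine ⟨(1 + ∑ i, ‖y i‖)⁻¹, by positivity, fun i => ?_⟩
    rw [norm_mul, Complex.norm_real, Real.norm_eq_abs, abs_of_pos (by positivity), inv_mul_lt_iff₀ (by positivity), mul_one]
    have := Finset.single_le_sum (f := fun i => ‖y i‖) (fun i _ => norm_nonneg _) (Finset.mem_univ i)
    linarith
  have h := EE_repr hP (fun i => (s : ℂ) * y i) hs
  rw [Ppr_eval] at h
  obtain ⟨N, hN⟩ := VV_smul (s : ℂ) y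
  rw [hN, ps_smul, hom_scale (Ppr_hom n j P), hom_scale hP] at h
  have hsC : (s : ℂ) ≠ 0 := by exact_mod_cast hs0.ne'
  have : ((s : ℂ) ^ N * s ^ j) * (VV y * MvPolynomial.eval (ps y) (Ppr n j P)) = ((s : ℂ) ^ N * s ^ j) * (VV y * MvPolynomial.eval (ps y) P) := by
    linear_combination h
  exact mul_left_cancel₀ (by positivity) this

lemma EE_inner {n j : ℕ} {P Q : MvPolynomial ℕ ℂ} (hQ : Q.IsWeightedHomogeneous wt j) :
    EE n (fun θ => MvPolynomial.eval (ps (xx θ)) P * star (MvPolynomial.eval (ps (xx θ)) Q)) =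
      ∑ α ∈ (WP j).support, (zz α : ℂ) * (cpr n P α * star (MvPolynomial.coeff α Q)) := by
  have h1 : ∀ θ : Fin n → TT, MvPolynomial.eval (ps (xx θ)) P * star (MvPolynomial.eval (ps (xx θ)) Q) =
      ∑ α ∈ (WP j).support, star (MvPolynomial.coeff α Q) * (MvPolynomial.eval (ps (xx θ)) P * star (mon α (ps (xx θ)))) := by
    intro θ
    rw [eval_mon (hom_support hQ), star_sum, Finset.mul_sum]
    refine Finset.sum_congr rfl fun α _ => ?_
    rw [star_mul']; ring
  simp only [h1]
  rw [EE_sum _ _ (fun α θ => MvPolynomial.eval (ps (xx θ)) P * star (mon α (ps (xx θ)))) (fun α => (polx_continuous P).mul (mon_continuous α).star)]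
  refine Finset.sum_congr rfl fun α hα => ?_
  rw [cpr]
  have : (zz α : ℂ) ≠ 0 := by exact_mod_cast (zz_pos α).ne'
  push_cast
  field_simp

lemma EN_diff {n j : ℕ} {P : MvPolynomial ℕ ℂ} (hP : P.IsWeightedHomogeneous wt j) :
    HN P - EN n P = ∑ α ∈ (WP j).support, zz α * ‖MvPolynomial.coeff α P - cpr n P α‖ ^ 2 := by
  have h1 := EE_inner (n := n) (P := P) hP
  have h2 := EE_inner (n := n) (P := P) (Ppr_hom n j P)
  have h3 : EE n (fun θ => MvPolynomial.eval (ps (xx θ)) P * star (MvPolynomial.eval (ps (xx θ)) (Ppr n j P))) =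
      EE n (fun θ => MvPolynomial.eval (ps (xx θ)) P * star (MvPolynomial.eval (ps (xx θ)) P)) := by
    rw [EE, EE]
    congr 2; ext θ
    have := congrArg star (Ppr_zero hP (xx θ))
    rw [star_mul', star_mul'] at this
    linear_combination (VV (xx θ) * MvPolynomial.eval (ps (xx θ)) P) * this
  rw [h3] at h2
  rw [EN_eq] at h1 h2
  have h1' := congrArg Complex.re h1
  have h2' := congrArg Complex.re h2
  rw [Complex.ofReal_re, Complex.re_sum] at h1' h2'
  rw [HN_eq (hom_support hP)]
  have h4 : ∀ α ∈ (WP j).support, zz α * ‖MvPolynomial.coeff α P - cpr n P α‖ ^ 2 =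
      zz α * ‖MvPolynomial.coeff α P‖ ^ 2 - 2 * ((zz α : ℂ) * (cpr n P α * star (MvPolynomial.coeff α P))).re
        + ((zz α : ℂ) * (cpr n P α * star (MvPolynomial.coeff α (Ppr n j P)))).re := by
    intro α hα
    rw [Ppr_coeff hα, Complex.re_ofReal_mul, Complex.re_ofReal_mul]
    simp only [← Complex.normSq_eq_norm_sq, Complex.normSq_apply, Complex.mul_re, Complex.sub_re, Complex.sub_im, Complex.star_def, Complex.conj_re, Complex.conj_im]
    ring
  rw [Finset.sum_congr rfl h4, Finset.sum_add_distrib, Finset.sum_sub_distrib, ← Finset.mul_sum, ← h1', ← h2']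
  ring

lemma cue_le {n j : ℕ} {P : MvPolynomial ℕ ℂ} (hP : P.IsWeightedHomogeneous wt j) : EN n P ≤ HN P := by
  have := EN_diff (n := n) hP
  have h2 : 0 ≤ ∑ α ∈ (WP j).support, zz α * ‖MvPolynomial.coeff α P - cpr n P α‖ ^ 2 :=
    Finset.sum_nonneg fun α _ => mul_nonneg (zz_pos α).le (sq_nonneg _)
  linarith

lemma cue_eq {n j : ℕ} {P : MvPolynomial ℕ ℂ} (hP : P.IsWeightedHomogeneous wt j) (hn : j ≤ n) : EN n P = HN P := by
  have h0 : Ppr n j P - P = 0 := by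
    refine ps_zero (n := n) (j := j) (Submodule.sub_mem (MvPolynomial.weightedHomogeneousSubmodule ℂ wt j) (Ppr_hom n j P) hP) hn fun y => ?_
    have h1 : VP n * psP n (Ppr n j P - P) = 0 := by
      apply MvPolynomial.funext
      intro y
      rw [map_mul, VP_eval, psP_eval, map_sub, mul_sub, Ppr_zero hP, sub_self, map_zero]
    have h2 := (mul_eq_zero.1 h1).resolve_left (VP_ne n)
    rw [← psP_eval, h2, map_zero]
  have h3 : Ppr n j P = P := sub_eq_zero.1 h0
  have := EN_diff (n := n) hP
  rw [Finset.sum_eq_zero] at this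
  · linarith
  · intro α hα
    rw [← Ppr_coeff hα, h3]; simp

lemma EN_nonneg (n : ℕ) (P : MvPolynomial ℕ ℂ) : 0 ≤ EN n P :=
  mul_nonneg (by positivity) (integral_nonneg fun θ => mul_nonneg (sq_nonneg _) (sq_nonneg _))

lemma enorm_sq_ofReal (z : ℂ) : ‖z‖ₑ ^ 2 = ENNReal.ofReal (‖z‖ ^ 2) := by
  rw [ENNReal.ofReal_pow (norm_nonneg _), ofReal_norm]

lemma parseval_abs (c : ℕ → ℂ) (hc : Summable fun j => ‖c j‖) :
    ∫⁻ t : TT, ‖∑' j : ℕ, fourier (-(j : ℤ)) t * c j‖ₑ ^ 2 ∂hm = ∑' j, ‖c j‖ₑ ^ 2 := by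
  have hcont : Continuous fun t : TT => ∑' j : ℕ, fourier (-(j : ℤ)) t * c j := by
    refine continuous_tsum (fun j => by fun_prop) hc fun j t => ?_
    rw [norm_mul, norm_fourier_pt, one_mul]
  obtain ⟨f, hf⟩ : ∃ f : C(TT, ℂ), ∀ t, f t = ∑' j : ℕ, fourier (-(j : ℤ)) t * c j := ⟨⟨_, hcont⟩, fun t => rfl⟩
  have hsum : ∀ t : TT, HasSum (fun j : ℕ => c j * fourier (-(j : ℤ)) t) (f t) := by
    intro t
    rw [hf]
    have : Summable (fun j : ℕ => fourier (-(j : ℤ)) t * c j) :=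
      Summable.of_norm (by simpa only [norm_mul, norm_fourier_pt, one_mul] using hc)
    exact hasSum_cng this.hasSum (fun j => mul_comm _ _) rfl
  have hcoef : ∀ k : ℕ, fourierCoeff f (-(k : ℤ)) = c k := by
    intro k
    have h := pairing (fourier (k : ℤ)) c (fun j : ℕ => -(j : ℤ)) hc hsum
    have h2 : HasSum (fun j => if j = k then c k else 0) (∫ x : TT, fourier (k : ℤ) x * f x ∂hm) := by
      refine hasSum_cng h (fun j => ?_) rfl
      rw [four_coeff, neg_neg]
      by_cases hj : j = k
      · simp [hj]
      · simp [hj]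
    rw [(hasSum_ite_eq k (c k)).unique h2, fourierCoeff]
    simp
  have h1 := pairing (star f) c (fun j : ℕ => -(j : ℤ)) hc hsum
  have h2 : HasSum (fun i => ‖c i‖ ^ 2) (∫ θ, ‖f θ‖ ^ 2 ∂hm) := by
    rw [← Complex.hasSum_ofReal, ← integral_complex_ofReal]
    refine hasSum_cng h1 (fun i => ?_) ?_
    · rw [fcoef_conj, neg_neg, hcoef, Complex.mul_conj']; push_cast; rfl
    · congr 1; ext θ
      rw [ContinuousMap.star_apply, RCLike.star_def, Complex.conj_mul']; push_cast; rfl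
  simp only [← hf, enorm_sq_ofReal]
  rw [← ofReal_integral_eq_lintegral_ofReal, ← h2.tsum_eq, ENNReal.ofReal_tsum_of_nonneg (fun _ => sq_nonneg _) h2.summable]
  · exact (by fun_prop : Continuous fun θ => ‖f θ‖ ^ 2).integrable_of_hasCompactSupport (HasCompactSupport.of_compactSpace _)
  · exact ae_of_all _ fun _ => sq_nonneg _

lemma rotation_l2 {Ω : Type*} [MeasurableSpace Ω] (μ : Measure Ω) [SFinite μ] (w : Ω → ENNReal) (hw : Measurable w)
    (F : ℕ → Ω → ℂ) (hF : ∀ j, Measurable (F j)) (τ : TT → Ω → Ω) (hτ : Measurable fun p : TT × Ω => τ p.1 p.2)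
    (hmp : ∀ t, MeasurePreserving (τ t) μ μ) (hwτ : ∀ t ω, w (τ t ω) = w ω)
    (hFτ : ∀ j t ω, F j (τ t ω) = fourier (-(j : ℤ)) t * F j ω) (hsum : ∀ ω, Summable fun j => ‖F j ω‖) :
    ∫⁻ ω, w ω * ‖∑' j, F j ω‖ₑ ^ 2 ∂μ = ∑' j, ∫⁻ ω, w ω * ‖F j ω‖ₑ ^ 2 ∂μ := by
  have hS : Measurable fun ω => ∑' j, F j ω :=  Measurable.tsum hF
  have hG : Measurable fun ω => w ω * ‖∑' j, F j ω‖ₑ ^ 2 := hw.mul (hS.enorm.pow_const 2)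
  have h1 : ∀ t : TT, ∫⁻ ω, w ω * ‖∑' j, F j ω‖ₑ ^ 2 ∂μ = ∫⁻ ω, w ω * ‖∑' j : ℕ, fourier (-(j : ℤ)) t * F j ω‖ₑ ^ 2 ∂μ := by
    intro t
    rw [← (hmp t).lintegral_comp hG]
    simp only [hwτ, hFτ]
  have h2 : ∫⁻ ω, w ω * ‖∑' j, F j ω‖ₑ ^ 2 ∂μ = ∫⁻ t : TT, ∫⁻ ω, w ω * ‖∑' j : ℕ, fourier (-(j : ℤ)) t * F j ω‖ₑ ^ 2 ∂μ ∂hm := by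
    rw [← lintegral_congr h1]; simp
  have hm2 : Measurable fun p : TT × Ω => ‖∑' j : ℕ, fourier (-(j : ℤ)) p.1 * F j p.2‖ₑ ^ 2 := by
    have := (hS.comp hτ).enorm.pow_const 2
    simpa only [Function.comp_def, hFτ] using this
  obtain ⟨K, hK⟩ : ∃ K : TT → Ω → ENNReal, ∀ t ω, K t ω = ‖∑' j : ℕ, fourier (-(j : ℤ)) t * F j ω‖ₑ ^ 2 := ⟨_, fun _ _ => rfl⟩
  have hKm : Measurable fun p : TT × Ω => K p.1 p.2 := by
    simp only [hK]; exact hm2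
  have hKi : ∀ ω, ∫⁻ t, K t ω ∂hm = ∑' j, ‖F j ω‖ₑ ^ 2 := by
    intro ω
    simp only [hK]
    exact parseval_abs _ (hsum ω)
  simp only [← hK] at h2
  rw [h2, lintegral_lintegral_swap ((hw.comp measurable_snd).mul hKm).aemeasurable,
    ← lintegral_tsum (f := fun j ω => w ω * ‖F j ω‖ₑ ^ 2) fun j => (hw.mul ((hF j).enorm.pow_const 2)).aemeasurable]
  refine lintegral_congr fun ω => ?_
  have hKω : Measurable fun t => K t ω := hKm.comp (measurable_id.prodMk measurable_const)
  rw [lintegral_const_mul _ hKω, hKi, ENNReal.tsum_mul_left]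

/-- quadratic exponents -/
noncomputable def RF (a : ℕ → ℕ → ℂ) (i : ℕ) : MvPolynomial ℕ ℂ :=
  MvPolynomial.C (-((i : ℂ) + 1) / 2) * ∑ k ∈ Finset.range i, MvPolynomial.C (a (k + 1) (i - k)) * (MvPolynomial.X k * MvPolynomial.X (i - 1 - k))

/-- homogeneous components -/
noncomputable def FP (a : ℕ → ℕ → ℂ) (j : ℕ) : MvPolynomial ℕ ℂ := expP (RF a) j

lemma FP_hom (a : ℕ → ℕ → ℂ) (j : ℕ) : (FP a j).IsWeightedHomogeneous wt j := by
  refine expP_hom (fun i => ?_) j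
  rw [RF]
  have hC : ∀ (z : ℂ) (Q : MvPolynomial ℕ ℂ), Q.IsWeightedHomogeneous wt (i + 1) → (MvPolynomial.C z * Q).IsWeightedHomogeneous wt (i + 1) := by
    intro z Q hQ
    have := (MvPolynomial.isWeightedHomogeneous_C wt z).mul hQ
    rwa [zero_add] at this
  refine hC _ _ (MvPolynomial.IsWeightedHomogeneous.sum _ _ _ fun k hk => hC _ _ ?_)
  have := (MvPolynomial.isWeightedHomogeneous_X ℂ wt k).mul (MvPolynomial.isWeightedHomogeneous_X ℂ wt (i - 1 - k))
  convert this using 1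
  have := Finset.mem_range.1 hk
  simp only [wt]; omega

lemma FP_zero (a : ℕ → ℕ → ℂ) : FP a 0 = 1 := expP_zero _

lemma antidiag_hasSum {g : ℕ × ℕ → ℂ} {x : ℂ} (hg : HasSum g x) :
    HasSum (fun i => ∑ k ∈ Finset.range i, g (k, i - 1 - k)) x := by
  have h1 := (Finset.HasAntidiagonal.sigmaAntidiagonalEquivProd (A := ℕ)).hasSum_iff.2 hg
  have h2 := h1.sigma (g := fun n => ∑ k ∈ Finset.range (n + 1), g (k, n - k)) fun n => by
    have := hasSum_fintype (fun p : Finset.HasAntidiagonal.antidiagonal n => g p)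
    rw [Finset.sum_coe_sort (Finset.HasAntidiagonal.antidiagonal n) g] at this
    rw [← Finset.Nat.sum_antidiagonal_eq_sum_range_succ_mk]
    exact this
  rw [← hasSum_nat_add_iff' 1]
  simpa using h2

lemma FP_hasSum (a : ℕ → ℕ → ℂ) (t : ℕ → ℂ) {r : ℝ} (hr : 0 < r)
    (h : ∀ s : ℂ, ‖s‖ < r → Summable fun p : ℕ × ℕ => a (p.1 + 1) (p.2 + 1) * t p.1 * t p.2 * s ^ (p.1 + p.2 + 2))
    {s : ℂ} (hs : ‖s‖ < r) : HasSum (fun j => MvPolynomial.eval t (FP a j) * s ^ j)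
      (Complex.exp (-(1 / 2) * ∑' p : ℕ × ℕ, a (p.1 + 1) (p.2 + 1) * t p.1 * t p.2 * s ^ (p.1 + p.2 + 2))) := by
  refine expP_hasSum (f := fun s => -(1 / 2) * ∑' p : ℕ × ℕ, a (p.1 + 1) (p.2 + 1) * t p.1 * t p.2 * s ^ (p.1 + p.2 + 2)) hr (fun s hs => ?_) hs
  refine hasSum_cng ((antidiag_hasSum (h s hs).hasSum).mul_left (-(1 / 2))) (fun i => ?_) rfl
  have hi : (i : ℂ) + 1 ≠ 0 := by exact_mod_cast i.succ_ne_zero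
  rw [RF, map_mul, MvPolynomial.eval_C, map_sum]
  have h1 : ∑ k ∈ Finset.range i, a (k + 1) (i - 1 - k + 1) * t k * t (i - 1 - k) * s ^ (k + (i - 1 - k) + 2) =
      (∑ k ∈ Finset.range i, MvPolynomial.eval t (MvPolynomial.C (a (k + 1) (i - k)) * (MvPolynomial.X k * MvPolynomial.X (i - 1 - k)))) * s ^ (i + 1) := by
    rw [Finset.sum_mul]
    refine Finset.sum_congr rfl fun k hk => ?_
    have hk := Finset.mem_range.1 hk
    rw [show i - 1 - k + 1 = i - k by omega, show k + (i - 1 - k) + 2 = i + 1 by omega]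
    simp only [map_mul, MvPolynomial.eval_C, MvPolynomial.eval_X]
    ring
  rw [h1]
  field_simp

/-- the generating exponential on the circle -/
noncomputable def gg (a : ℕ → ℕ → ℂ) {n : ℕ} (ρ : ℝ) (θ : Fin n → TT) : ℂ :=
  Complex.exp (-(1 / 2) * ∑' p : ℕ × ℕ, a (p.1 + 1) (p.2 + 1) * ps (xx θ) p.1 * ps (xx θ) p.2 * (ρ : ℂ) ^ (p.1 + p.2 + 2))

namespace GH
variable {φ : ℂ → ℂ} {φ₀ : ℂ} {c : ℕ → ℂ} {a : ℕ → ℕ → ℂ}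

lemma ps_summ (G : GH φ φ₀ c a) {n : ℕ} (θ : Fin n → TT) {s : ℂ} (hs : ‖s‖ < 1) :
    Summable fun p : ℕ × ℕ => a (p.1 + 1) (p.2 + 1) * ps (xx θ) p.1 * ps (xx θ) p.2 * s ^ (p.1 + p.2 + 2) := by
  refine Summable.of_norm_bounded ((G.summ hs hs).mul_left ((n : ℝ) * n)) fun p => ?_
  have e : a (p.1 + 1) (p.2 + 1) * ps (xx θ) p.1 * ps (xx θ) p.2 * s ^ (p.1 + p.2 + 2) =
    (ps (xx θ) p.1 * ps (xx θ) p.2) * (a (p.1 + 1) (p.2 + 1) * s ^ (p.1 + 1) * s ^ (p.2 + 1)) := by ring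
  rw [e, norm_mul, norm_mul]
  gcongr
  · exact psx_norm θ _
  · exact psx_norm θ _

lemma gg_hasSum (G : GH φ φ₀ c a) {n : ℕ} (θ : Fin n → TT) {ρ : ℝ} (h0 : 0 < ρ) (h1 : ρ < 1) :
    HasSum (fun j => MvPolynomial.eval (ps (xx θ)) (FP a j) * (ρ : ℂ) ^ j) (gg a ρ θ) :=
  FP_hasSum a _ one_pos (fun _ hs => G.ps_summ θ hs) (by rw [Complex.norm_real, Real.norm_eq_abs, abs_of_pos h0]; exact h1)

lemma gg_lintegral (G : GH φ φ₀ c a) (n : ℕ) {ρ : ℝ} (h0 : 0 < ρ) (h1 : ρ < 1) :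
    ∫⁻ θ : Fin n → TT, ENNReal.ofReal ((n.factorial : ℝ)⁻¹ * ‖VV (xx θ)‖ ^ 2) * ‖gg a ρ θ‖ₑ ^ 2 ∂(pm n) =
      ∑' j, ENNReal.ofReal ((ρ ^ j) ^ 2 * _root_.EN n (FP a j)) := by
  have h := rotation_l2 (pm n) (fun θ => ENNReal.ofReal ((n.factorial : ℝ)⁻¹ * ‖VV (xx θ)‖ ^ 2))
    (by have := VVx_continuous (n := n); exact ENNReal.measurable_ofReal.comp (by fun_prop : Continuous fun θ : Fin n → TT => (n.factorial : ℝ)⁻¹ * ‖VV (xx θ)‖ ^ 2).measurable)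
    (fun j θ => MvPolynomial.eval (ps (xx θ)) (FP a j) * (ρ : ℂ) ^ j)
    (fun j => ((polx_continuous (FP a j)).mul continuous_const).measurable)
    rot (by
      have : Continuous fun p : TT × (Fin n → TT) => rot p.1 p.2 := by unfold rot; fun_prop
      exact this.measurable) rot_mp ?_ ?_ ?_
  · have hg : ∀ θ : Fin n → TT, gg a ρ θ = ∑' j : ℕ, MvPolynomial.eval (ps (xx θ)) (FP a j) * (ρ : ℂ) ^ j := fun θ => (G.gg_hasSum θ h0 h1).tsum_eq.symm
    simp only [hg]
    rw [h]
    congr 1; ext j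
    have e : ∀ θ : Fin n → TT, ENNReal.ofReal ((n.factorial : ℝ)⁻¹ * ‖VV (xx θ)‖ ^ 2) * ‖MvPolynomial.eval (ps (xx θ)) (FP a j) * (ρ : ℂ) ^ j‖ₑ ^ 2 =
        ENNReal.ofReal ((ρ ^ j) ^ 2 * ((n.factorial : ℝ)⁻¹ * (‖VV (xx θ)‖ ^ 2 * ‖MvPolynomial.eval (ps (xx θ)) (FP a j)‖ ^ 2))) := by
      intro θ
      rw [enorm_sq_ofReal, ← ENNReal.ofReal_mul (by positivity), norm_mul, norm_pow, Complex.norm_real, Real.norm_eq_abs, abs_of_pos h0]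
      congr 1; ring
    simp only [e]
    rw [← ofReal_integral_eq_lintegral_ofReal, integral_const_mul, integral_const_mul]
    · rfl
    · refine Integrable.const_mul (Integrable.const_mul ?_ _) _
      have i1 := VVx_continuous (n := n)
      have i2 := polx_continuous (n := n) (FP a j)
      exact (by fun_prop : Continuous fun θ : Fin n → TT => ‖VV (xx θ)‖ ^ 2 * ‖MvPolynomial.eval (ps (xx θ)) (FP a j)‖ ^ 2).integrable_of_hasCompactSupport (HasCompactSupport.of_compactSpace _)
    · exact ae_of_all _ fun θ => by positivity
  · intro t θ
    have := VV_rot t θ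
    rw [star_mul_norm, star_mul_norm] at this
    have h2 : ‖VV (xx (rot t θ))‖ ^ 2 = ‖VV (xx θ)‖ ^ 2 := by exact_mod_cast this
    simp only [h2]
  · intro j t θ
    rw [pol_rot (FP_hom a j), mul_assoc]
  · intro θ
    exact (G.gg_hasSum θ h0 h1).summable.norm

end GH

lemma prod_pairs {M : Type*} [CommMonoid M] {n : ℕ} (f : Fin n → Fin n → M) (hf : ∀ i j, f i j = f j i) :
    ∏ i, ∏ j, f i j = (∏ p ∈ Finset.univ.filter (fun p : Fin n × Fin n => p.1 < p.2), f p.1 p.2) ^ 2 * ∏ i, f i i := by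
  classical
  rw [← Fintype.prod_prod_type']
  rw [← Finset.prod_filter_mul_prod_filter_not Finset.univ (fun p : Fin n × Fin n => p.1 < p.2)]
  rw [← Finset.prod_filter_mul_prod_filter_not (Finset.univ.filter (fun p : Fin n × Fin n => ¬ p.1 < p.2)) (fun p : Fin n × Fin n => p.2 < p.1)]
  rw [pow_two, mul_assoc]
  congr 1
  congr 1
  · refine Finset.prod_nbij' (fun p => (p.2, p.1)) (fun p => (p.2, p.1)) ?_ ?_ ?_ ?_ ?_
    · intro p hp; simp only [Finset.mem_filter, Finset.mem_univ, true_and] at hp ⊢; exact hp.2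
    · intro p hp; simp only [Finset.mem_filter, Finset.mem_univ, true_and] at hp ⊢; exact ⟨not_lt.2 hp.le, hp⟩
    · intro p _; rfl
    · intro p _; rfl
    · intro p _; exact hf _ _
  · refine Finset.prod_nbij' (fun p => p.1) (fun i => (i, i)) ?_ ?_ ?_ ?_ ?_
    · intro p hp; simp
    · intro p hp; simp
    · rintro ⟨p, q⟩ hp; simp only [Finset.mem_filter, Finset.mem_univ, true_and, not_lt] at hp
      rw [le_antisymm hp.1 hp.2]
    · intro p _; rfl
    · rintro ⟨p, q⟩ hp; simp only [Finset.mem_filter, Finset.mem_univ, true_and, not_lt] at hp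
      rw [le_antisymm hp.1 hp.2]

lemma prod_filter_lt {M : Type*} [CommMonoid M] {n : ℕ} (f : Fin n → Fin n → M) :
    ∏ p ∈ Finset.univ.filter (fun p : Fin n × Fin n => p.1 < p.2), f p.1 p.2 = ∏ i, ∏ j ∈ Finset.Ioi i, f i j := by
  rw [Finset.prod_filter, Fintype.prod_prod_type]
  refine Finset.prod_congr rfl fun i _ => ?_
  rw [← Finset.prod_filter]
  congr 1
  ext j; simp

lemma AA_sum_ps {a : ℕ → ℕ → ℂ} {n : ℕ} (y : Fin n → ℂ) (ρ : ℂ)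
    (h : ∀ i j, Summable fun p : ℕ × ℕ => a (p.1 + 1) (p.2 + 1) * (ρ * y i) ^ (p.1 + 1) * (ρ * y j) ^ (p.2 + 1)) :
    ∑ i, ∑ j, AA a (ρ * y i) (ρ * y j) = ∑' p : ℕ × ℕ, a (p.1 + 1) (p.2 + 1) * ps y p.1 * ps y p.2 * ρ ^ (p.1 + p.2 + 2) := by
  unfold AA
  have h1 : ∀ i, ∑ j, (∑' p : ℕ × ℕ, a (p.1 + 1) (p.2 + 1) * (ρ * y i) ^ (p.1 + 1) * (ρ * y j) ^ (p.2 + 1)) =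
     ∑' p : ℕ × ℕ, ∑ j, a (p.1 + 1) (p.2 + 1) * (ρ * y i) ^ (p.1 + 1) * (ρ * y j) ^ (p.2 + 1) := fun i =>
    (Summable.tsum_finsetSum fun j _ => h i j).symm
  simp only [h1]
  rw [← Summable.tsum_finsetSum fun i _ => summable_sum fun j _ => h i j]
  congr 1; ext p
  unfold ps
  simp only [mul_pow]
  rw [mul_assoc (a _ _), Finset.sum_mul_sum, Finset.mul_sum, Finset.sum_mul]
  refine Finset.sum_congr rfl fun i _ => ?_
  rw [Finset.mul_sum, Finset.sum_mul]
  refine Finset.sum_congr rfl fun j _ => ?_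
  ring

lemma AA_sym {a : ℕ → ℕ → ℂ} (ha : ∀ k l, a k l = a l k) (s u : ℂ) : AA a s u = AA a u s := by
  unfold AA
  rw [← (Equiv.prodComm ℕ ℕ).tsum_eq]
  congr 1; ext p
  simp only [Equiv.prodComm_apply, Prod.fst_swap, Prod.snd_swap]
  rw [ha]; ring

lemma tpt_inv (r : ℝ) (x : TT) : (tpt r x)⁻¹ = ((r⁻¹ : ℝ) : ℂ) * fourier (-1) x := by
  have := tpt_inv_pow r 1 x
  simpa using this

lemma tpt_dist {r : ℝ} (hr : 0 < r) (x y : TT) : ‖tpt r x - tpt r y‖ = r * ‖(fourier (-1) x : ℂ) - fourier (-1) y‖ := by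
  rw [tpt, tpt, ← mul_sub, norm_mul, Complex.norm_real, Real.norm_eq_abs, abs_of_pos hr, ← four_star, ← four_star, ← star_sub, norm_star]

lemma GH.pointwise {φ : ℂ → ℂ} {φ₀ : ℂ} {c : ℕ → ℂ} {a : ℕ → ℕ → ℂ} (G : GH φ φ₀ c a) {n : ℕ} {r : ℝ} (hr : 1 < r)
    (θ : Fin n → TT) :
    (∏ p ∈ Finset.univ.filter (fun p : Fin n × Fin n => p.1 < p.2), ‖φ (tpt r (θ p.1)) - φ (tpt r (θ p.2))‖ ^ 2) *
      ∏ i, ‖deriv φ (tpt r (θ i))‖ = r ^ (n * (n - 1)) * (‖VV (xx θ)‖ ^ 2 * ‖gg a r⁻¹ θ‖ ^ 2) := by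
  have hr0 : 0 < r := by linarith
  have hz : ∀ i, 1 < ‖tpt r (θ i)‖ := fun i => by rw [norm_tpt hr0.le]; exact hr
  obtain ⟨ρ, hρ⟩ : ∃ ρ : ℂ, ρ = ((r⁻¹ : ℝ) : ℂ) := ⟨_, rfl⟩
  have hx : ∀ i, (tpt r (θ i))⁻¹ = ρ * xx θ i := fun i => by rw [tpt_inv, hρ]; rfl
  have hρx : ∀ i, ‖ρ * xx θ i‖ < 1 := fun i => by rw [← hx, norm_inv]; exact inv_lt_one_of_one_lt₀ (hz i)
  obtain ⟨A, hA⟩ : ∃ A : Fin n → Fin n → ℂ, ∀ i j, A i j = AA a (ρ * xx θ i) (ρ * xx θ j) := ⟨_, fun _ _ => rfl⟩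
  have hAs : ∀ i j, A i j = A j i := fun i j => by rw [hA, hA, AA_sym G.hsym]
  have hgg : gg a r⁻¹ θ = Complex.exp (-(1 / 2) * ∑ i, ∑ j, A i j) := by
    unfold gg
    simp only [hA]
    rw [AA_sum_ps _ _ fun i j => (G.summ (hρx i) (hρx j)).of_norm, hρ]
  have hE : ‖gg a r⁻¹ θ‖ ^ 2 = (∏ p ∈ Finset.univ.filter (fun p : Fin n × Fin n => p.1 < p.2), ‖Complex.exp (-A p.1 p.2)‖) ^ 2 *
      ∏ i, ‖Complex.exp (-A i i)‖ := by
    rw [← prod_pairs (fun i j => ‖Complex.exp (-A i j)‖) (fun i j => by rw [hAs]), hgg, ← norm_pow, ← Complex.exp_nat_mul]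
    simp only [← norm_prod, ← Complex.exp_sum]
    congr 2
    simp only [Finset.sum_neg_distrib]
    push_cast; ring
  have hV : ‖VV (xx θ)‖ ^ 2 = (∏ p ∈ Finset.univ.filter (fun p : Fin n × Fin n => p.1 < p.2), ‖xx θ p.1 - xx θ p.2‖) ^ 2 := by
    rw [VV, Matrix.det_vandermonde, prod_filter_lt (fun i j => ‖xx θ i - xx θ j‖)]
    simp only [norm_prod]
    simp only [norm_sub_rev]
  have hR : r ^ (n * (n - 1)) = (∏ p ∈ Finset.univ.filter (fun p : Fin n × Fin n => p.1 < p.2), r) ^ 2 := by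
    have := prod_pairs (fun _ _ : Fin n => r) (fun _ _ => rfl)
    have h2 : ∏ _i : Fin n, r = r ^ n := by simp
    have h3 : ∏ _i : Fin n, ∏ _j : Fin n, r = r ^ (n * (n - 1)) * r ^ n := by
      simp only [h2]
      rw [Finset.prod_const, Finset.card_univ, Fintype.card_fin, ← pow_mul, ← pow_add]
      congr 1
      cases n with
      | zero => rfl
      | succ k => simp; ring
    rw [h3, h2] at this
    exact mul_right_cancel₀ (pow_ne_zero _ hr0.ne') this
  rw [hE, hV, hR, ← mul_assoc, ← mul_pow, ← mul_assoc, ← mul_pow, ← Finset.prod_mul_distrib, ← Finset.prod_mul_distrib, Finset.prod_pow]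
  congr 1
  · congr 1
    refine Finset.prod_congr rfl fun p _ => ?_
    rw [G.gru (hz _) (hz _), norm_mul, tpt_dist hr0, hx, hx, hA]; rfl
  · refine Finset.prod_congr rfl fun i _ => ?_
    rw [G.deriv_eq (hz i), hx, hA]

lemma pi_volume_TT (n : ℕ) : (Measure.pi fun _ : Fin n => (volume : Measure TT)) = (ENNReal.ofReal (2 * Real.pi)) ^ n • pm n := by
  refine Measure.pi_eq fun s _ => ?_
  rw [Measure.smul_apply, Measure.pi_pi]
  have : ∀ i, (volume : Measure TT) (s i) = ENNReal.ofReal (2 * Real.pi) * hm (s i) := fun i => rfl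
  simp only [this, Finset.prod_mul_distrib]
  simp

lemma transfer {n : ℕ} (F : (Fin n → TT) → ℝ) (hF : Measurable F) :
    ∫ θ in Set.pi Set.univ (fun _ : Fin n => Set.Icc (-Real.pi) Real.pi), F (fun i => ((θ i : ℝ) : TT)) =
      (2 * Real.pi) ^ n * ∫ x, F x ∂(pm n) := by
  have h0 : (volume : Measure (Fin n → ℝ)) = Measure.pi (fun _ => volume) := rfl
  rw [h0, Measure.restrict_pi_pi]
  have h1 : (volume : Measure ℝ).restrict (Set.Icc (-Real.pi) Real.pi) = (volume : Measure ℝ).restrict (Set.Ioc (-Real.pi) (-Real.pi + 2 * Real.pi)) := by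
    rw [show -Real.pi + 2 * Real.pi = Real.pi by ring]
    exact Measure.restrict_congr_set Ioc_ae_eq_Icc.symm
  simp only [h1]
  have : Fact (0 < 2 * Real.pi) := ⟨Real.two_pi_pos⟩
  have mp := measurePreserving_pi (fun _ : Fin n => (volume : Measure ℝ).restrict (Set.Ioc (-Real.pi) (-Real.pi + 2 * Real.pi)))
    (fun _ : Fin n => (volume : Measure TT)) (fun _ => AddCircle.measurePreserving_mk (2 * Real.pi) (-Real.pi))
  have := integral_map (μ := Measure.pi (fun _ : Fin n => (volume : Measure ℝ).restrict (Set.Ioc (-Real.pi) (-Real.pi + 2 * Real.pi))))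
    mp.measurable.aemeasurable (f := F) hF.aestronglyMeasurable
  rw [mp.map_eq, pi_volume_TT, integral_smul_measure] at this
  rw [← this, ENNReal.toReal_pow, ENNReal.toReal_ofReal Real.two_pi_pos.le, smul_eq_mul]

lemma gg_measurable (a : ℕ → ℕ → ℂ) {n : ℕ} (ρ : ℝ) : Measurable (gg a ρ : (Fin n → TT) → ℂ) := by
  unfold gg
  refine Complex.measurable_exp.comp (Measurable.const_mul ?_ _)
  refine Measurable.tsum fun p => ?_
  have h1 := psx_continuous (n := n) p.1
  have h2 := psx_continuous (n := n) p.2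
  exact (by fun_prop : Continuous fun θ : Fin n → TT => a (p.1 + 1) (p.2 + 1) * ps (xx θ) p.1 * ps (xx θ) p.2 * (ρ : ℂ) ^ (p.1 + p.2 + 2)).measurable

lemma GH.Zn_raw {φ : ℂ → ℂ} {φ₀ : ℂ} {c : ℕ → ℂ} {a : ℕ → ℕ → ℂ} (G : GH φ φ₀ c a) (n : ℕ) {r : ℝ} (hr : 1 < r) :
   (1 / (n.factorial * r ^ (n * (n - 1)))) *
    (∫ θ in Set.pi Set.univ (fun _ : Fin n => Set.Icc (-Real.pi) Real.pi),
      (∏ p ∈ Finset.univ.filter (fun p : Fin n × Fin n => p.1 < p.2),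
        norm (φ ((r : ℂ) * Complex.exp (Complex.I * (θ p.1 : ℂ)))
          - φ ((r : ℂ) * Complex.exp (Complex.I * (θ p.2 : ℂ)))) ^ 2) *
      ∏ μ, norm (deriv φ ((r : ℂ) * Complex.exp (Complex.I * (θ μ : ℂ))))) / (2 * Real.pi) ^ n =
    (∑' j, ENNReal.ofReal (((r⁻¹) ^ j) ^ 2 * _root_.EN n (FP a j))).toReal := by
  have hr0 : 0 < r := by linarith
  have hE : ∀ θ : ℝ, (r : ℂ) * Complex.exp (Complex.I * (θ : ℂ)) = tpt r (θ : TT) := fun θ => (tpt_coe r θ).symm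
  simp only [hE]
  have hp : ∀ θ : Fin n → ℝ, (∏ p ∈ Finset.univ.filter (fun p : Fin n × Fin n => p.1 < p.2),
        norm (φ (tpt r (θ p.1 : TT)) - φ (tpt r (θ p.2 : TT))) ^ 2) * ∏ μ, norm (deriv φ (tpt r (θ μ : TT))) =
      (fun x : Fin n → TT => r ^ (n * (n - 1)) * (‖VV (xx x)‖ ^ 2 * ‖gg a r⁻¹ x‖ ^ 2)) (fun i => ((θ i : ℝ) : TT)) :=
    fun θ => G.pointwise hr (fun i => ((θ i : ℝ) : TT))
  simp only [hp]
  have hV := VVx_continuous (n := n)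
  have hm1 : Measurable fun x : Fin n → TT => ‖VV (xx x)‖ ^ 2 * ‖gg a r⁻¹ x‖ ^ 2 := by
    have h1 : Measurable fun x : Fin n → TT => ‖VV (xx x)‖ ^ 2 := (by fun_prop : Continuous fun x : Fin n → TT => ‖VV (xx x)‖ ^ 2).measurable
    exact h1.mul ((gg_measurable a r⁻¹).norm.pow_const 2)
  have := transfer (fun x : Fin n → TT => r ^ (n * (n - 1)) * (‖VV (xx x)‖ ^ 2 * ‖gg a r⁻¹ x‖ ^ 2)) (hm1.const_mul _)
  rw [this, ← G.gg_lintegral n (inv_pos.2 hr0) (inv_lt_one_of_one_lt₀ hr)]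
  have e : ∀ θ : Fin n → TT, ENNReal.ofReal ((n.factorial : ℝ)⁻¹ * ‖VV (xx θ)‖ ^ 2) * ‖gg a r⁻¹ θ‖ₑ ^ 2 =
     ENNReal.ofReal ((n.factorial : ℝ)⁻¹ * (‖VV (xx θ)‖ ^ 2 * ‖gg a r⁻¹ θ‖ ^ 2)) := fun θ => by
    rw [enorm_sq_ofReal, ← ENNReal.ofReal_mul (by positivity), mul_assoc]
  simp only [e]
  rw [← integral_eq_lintegral_of_nonneg_ae (ae_of_all _ fun θ => by positivity) (hm1.const_mul _).aestronglyMeasurable,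
    integral_const_mul, integral_const_mul]
  have h1 : (0:ℝ) < (2 * Real.pi) ^ n := by positivity
  have h2 : (0:ℝ) < r ^ (n * (n - 1)) := by positivity
  have h3 : (0:ℝ) < n.factorial := by positivity
  field_simp

lemma EN_FP_zero (a : ℕ → ℕ → ℂ) (n : ℕ) : EN n (FP a 0) = HN (FP a 0) :=
  cue_eq (FP_hom a 0) (Nat.zero_le _)

lemma tsum_limit {e : ℕ → ℝ} (h0 : ∀ j, 0 ≤ e j) (hs : Summable e) :
    Tendsto (fun r : ℝ => (∑' j, ENNReal.ofReal (((r⁻¹) ^ j) ^ 2 * e j)).toReal) (nhdsWithin 1 (Set.Ioi 1)) (nhds (∑' j, e j)) := by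
  have h : ∀ᶠ r : ℝ in nhdsWithin 1 (Set.Ioi 1), ∑' j, ((r⁻¹) ^ j) ^ 2 * e j = (∑' j, ENNReal.ofReal (((r⁻¹) ^ j) ^ 2 * e j)).toReal := by
    filter_upwards [self_mem_nhdsWithin] with r hr
    have hr0 : (0:ℝ) < r := lt_trans one_pos hr
    have hn : ∀ j, 0 ≤ ((r⁻¹) ^ j) ^ 2 * e j := fun j => mul_nonneg (sq_nonneg _) (h0 j)
    have hb : ∀ j, ((r⁻¹) ^ j) ^ 2 * e j ≤ e j := fun j => by
      refine mul_le_of_le_one_left (h0 j) (pow_le_one₀ (by positivity) (pow_le_one₀ (by positivity) (inv_le_one_of_one_le₀ (le_of_lt hr))))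
    rw [← ENNReal.ofReal_tsum_of_nonneg hn (Summable.of_nonneg_of_le hn hb hs), ENNReal.toReal_ofReal (tsum_nonneg hn)]
  refine Tendsto.congr' h ?_
  refine tendsto_tsum_of_dominated_convergence hs (fun j => ?_) ?_
  · have : ContinuousAt (fun r : ℝ => ((r⁻¹) ^ j) ^ 2 * e j) 1 := by
      have : ContinuousAt (fun r : ℝ => r⁻¹) 1 := continuousAt_inv₀ one_ne_zero
      fun_prop
    have h2 := this.tendsto.mono_left (nhdsWithin_le_nhds (s := Set.Ioi 1))
    simpa using h2
  · filter_upwards [self_mem_nhdsWithin] with r hr j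
    have hr0 : (0:ℝ) < r := lt_trans one_pos hr
    rw [Real.norm_eq_abs, abs_of_nonneg (mul_nonneg (sq_nonneg _) (h0 j))]
    refine mul_le_of_le_one_left (h0 j) (pow_le_one₀ (by positivity) (pow_le_one₀ (by positivity) (inv_le_one_of_one_le₀ (le_of_lt hr))))

lemma Zt_limit (a : ℕ → ℕ → ℂ) (hs : Summable fun j => HN (FP a j)) :
    Tendsto (fun n => ∑' j, EN n (FP a j)) atTop (nhds (∑' j, HN (FP a j))) := by
  refine tendsto_tsum_of_dominated_convergence hs (fun j => ?_) (Eventually.of_forall fun n j => ?_)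
  · refine tendsto_const_nhds.congr' ?_
    filter_upwards [eventually_ge_atTop j] with n hn
    exact (cue_eq (FP_hom a j) hn).symm
  · rw [Real.norm_eq_abs, abs_of_nonneg (EN_nonneg _ _)]
    exact cue_le (FP_hom a j)

/-- one-dimensional complex Gaussian density -/
noncomputable def gw (z : ℂ) : ℝ := Real.exp (-‖z‖ ^ 2) / Real.pi

lemma gw_continuous : Continuous gw := by unfold gw; fun_prop

lemma gw_pos (z : ℂ) : 0 < gw z := div_pos (Real.exp_pos _) Real.pi_pos

lemma gauss_moment (q : ℕ) : ∫ z : ℂ, ‖z‖ ^ q * Real.exp (-‖z‖ ^ 2) = Real.pi * Real.Gamma (((q : ℝ) + 2) / 2) := by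
  have := Complex.integral_rpow_mul_exp_neg_rpow (p := 2) (q := q) (by norm_num) (by have : (0:ℝ) ≤ q := by positivity
                                                                                     linarith)
  simp only [Real.rpow_natCast] at this
  have h2 : ∀ z : ℂ, ‖z‖ ^ (2:ℝ) = ‖z‖ ^ 2 := fun z => by exact_mod_cast Real.rpow_natCast ‖z‖ 2
  simp only [h2] at this
  rw [this]; ring

lemma gauss_moment_int (q : ℕ) : Integrable fun z : ℂ => ‖z‖ ^ q * Real.exp (-‖z‖ ^ 2) := by
  by_contra h
  have h1 := integral_undef h
  rw [gauss_moment] at h1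
  have : 0 < Real.Gamma (((q : ℝ) + 2) / 2) := Real.Gamma_pos_of_pos (by positivity)
  have := mul_pos Real.pi_pos this
  linarith

lemma gw_int (a b : ℕ) : Integrable fun z : ℂ => (gw z : ℂ) * (z ^ a * star z ^ b) := by
  refine (((gauss_moment_int (a + b)).div_const Real.pi)).mono' ?_ (ae_of_all _ fun z => ?_)
  · have := gw_continuous
    exact (by fun_prop : Continuous fun z : ℂ => (gw z : ℂ) * (z ^ a * star z ^ b)).aestronglyMeasurable
  · rw [norm_mul, norm_mul, norm_pow, norm_pow, norm_star, Complex.norm_real, Real.norm_eq_abs, abs_of_pos (gw_pos z), gw, pow_add]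
    apply le_of_eq; ring

lemma rot_vp (u : ℂ) (hu : ‖u‖ = 1) : MeasurePreserving (fun z : ℂ => u * z) := by
  have := (rotation (⟨u, by simp [Submonoid.unitSphere, hu]⟩ : Circle)).measurePreserving
  exact this

lemma gw_moment (a b : ℕ) : ∫ z : ℂ, (gw z : ℂ) * (z ^ a * star z ^ b) = if a = b then (a.factorial : ℂ) else 0 := by
  by_cases hab : a = b
  · subst hab
    rw [if_pos rfl]
    have e : ∀ z : ℂ, (gw z : ℂ) * (z ^ a * star z ^ a) = ((‖z‖ ^ (2 * a) * Real.exp (-‖z‖ ^ 2) * Real.pi⁻¹ : ℝ) : ℂ) := fun z => by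
      rw [← mul_pow, star_mul_norm, gw, pow_mul]; push_cast; rw [div_eq_mul_inv]; ring
    simp only [e]
    rw [integral_complex_ofReal, integral_mul_const, gauss_moment]
    have h2 : ((2 * a : ℕ) + 2 : ℝ) / 2 = a + 1 := by push_cast; ring
    rw [h2, Real.Gamma_nat_eq_factorial, mul_comm, ← mul_assoc, inv_mul_cancel₀ Real.pi_ne_zero, one_mul]
    simp
  · rw [if_neg hab]
    obtain ⟨J, hJ⟩ : ∃ J, J = ∫ z : ℂ, (gw z : ℂ) * (z ^ a * star z ^ b) := ⟨_, rfl⟩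
    rw [← hJ]
    have hd : ((a : ℂ) - b) ≠ 0 := by
      rw [sub_ne_zero]; exact_mod_cast hab
    obtain ⟨u, hu⟩ : ∃ u : ℂ, u = Complex.exp (((Real.pi / ((a : ℝ) - b) : ℝ) : ℂ) * Complex.I) := ⟨_, rfl⟩
    have hu1 : ‖u‖ = 1 := by rw [hu]; exact Complex.norm_exp_ofReal_mul_I _
    have hu2 : u ^ a * star u ^ b = -1 := by
      have : star u = Complex.exp (-(((Real.pi / ((a : ℝ) - b) : ℝ) : ℂ) * Complex.I)) := by
        rw [hu]
        change (starRingEnd ℂ) _ = _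
        rw [← Complex.exp_conj, map_mul, Complex.conj_ofReal, Complex.conj_I, mul_neg]
      rw [this, hu, ← Complex.exp_nat_mul, ← Complex.exp_nat_mul, ← Complex.exp_add, ← Complex.exp_pi_mul_I]
      congr 1
      push_cast
      field_simp
      ring
    have h1 : J = ∫ z : ℂ, (gw (u * z) : ℂ) * ((u * z) ^ a * star (u * z) ^ b) := by
      rw [hJ]
      have hme : MeasurableEmbedding (fun z : ℂ => u * z) := measurableEmbedding_mulLeft₀ (by
        intro h; rw [h] at hu1; simp at hu1)
      exact ((rot_vp u hu1).integral_comp hme (fun z => (gw z : ℂ) * (z ^ a * star z ^ b))).symm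
    have h2 : ∀ z : ℂ, (gw (u * z) : ℂ) * ((u * z) ^ a * star (u * z) ^ b) = -1 * ((gw z : ℂ) * (z ^ a * star z ^ b)) := fun z => by
      rw [← hu2, gw, gw, norm_mul, hu1, one_mul, star_mul', mul_pow, mul_pow]; ring
    simp only [h2] at h1
    rw [integral_const_mul, ← hJ] at h1
    have : (2:ℂ) * J = 0 := by linear_combination h1
    simpa using this

/-- Gaussian density on `ℂ^m` -/
noncomputable def gwm {m : ℕ} (X : Fin m → ℂ) : ℝ := ∏ k, gw (X k)

lemma gwm_continuous {m : ℕ} : Continuous (gwm (m := m)) := by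
  unfold gwm
  exact continuous_finsetProd _ fun i _ => gw_continuous.comp (continuous_apply i)

lemma gwm_pos {m : ℕ} (X : Fin m → ℂ) : 0 < gwm X := Finset.prod_pos fun _ _ => gw_pos _

/-- power sum variables -/
noncomputable def tX {m : ℕ} (X : Fin m → ℂ) (k : ℕ) : ℂ := if h : k < m then (sqk k : ℂ) * X ⟨k, h⟩ else 0

lemma tX_continuous {m : ℕ} (k : ℕ) : Continuous fun X : Fin m → ℂ => tX X k := by
  unfold tX
  split_ifs
  · fun_prop
  · fun_prop

lemma mon_tX_zero {m : ℕ} (X : Fin m → ℂ) {α : ℕ →₀ ℕ} (h : ¬ α.support ⊆ Finset.range m) : mon α (tX X) = 0 := by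
  obtain ⟨k, hk, hk2⟩ := Finset.not_subset.1 h
  rw [mon]
  refine Finset.prod_eq_zero hk ?_
  rw [tX, dif_neg (by simpa using hk2), zero_pow (Finsupp.mem_support_iff.1 hk)]

lemma mon_tX {m : ℕ} (X : Fin m → ℂ) {α : ℕ →₀ ℕ} (h : α.support ⊆ Finset.range m) :
    mon α (tX X) = ∏ k : Fin m, ((sqk k : ℂ) * X k) ^ α k := by
  rw [mon, Finset.prod_subset h, Finset.prod_range]
  · refine Finset.prod_congr rfl fun k _ => ?_
    rw [tX, dif_pos k.2]
  · intro k _ hk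
    rw [Finsupp.notMem_support_iff.1 hk, pow_zero]

lemma gmon_eq {m : ℕ} {α β : ℕ →₀ ℕ} (h : α.support ⊆ Finset.range m) (h' : β.support ⊆ Finset.range m) (X : Fin m → ℂ) :
    (gwm X : ℂ) * (mon α (tX X) * star (mon β (tX X))) =
      ∏ k : Fin m, ((sqk k : ℂ) ^ α k * (sqk k : ℂ) ^ β k) * ((gw (X k) : ℂ) * (X k ^ α k * star (X k) ^ β k)) := by
  rw [mon_tX X h, mon_tX X h', gwm, star_prod, Complex.ofReal_prod, ← Finset.prod_mul_distrib, ← Finset.prod_mul_distrib]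
  refine Finset.prod_congr rfl fun k _ => ?_
  have : star ((sqk k : ℂ)) = (sqk k : ℂ) := Complex.conj_ofReal _
  rw [star_pow, star_mul', this, mul_pow, mul_pow]; ring

lemma gmon_int {m : ℕ} (α β : ℕ →₀ ℕ) :
    Integrable fun X : Fin m → ℂ => (gwm X : ℂ) * (mon α (tX X) * star (mon β (tX X))) := by
  by_cases h : α.support ⊆ Finset.range m
  · by_cases h' : β.support ⊆ Finset.range m
    · simp only [gmon_eq h h']
      exact Integrable.fintype_prod (f := fun (k : Fin m) (z : ℂ) => ((sqk k : ℂ) ^ α k * (sqk k : ℂ) ^ β k) * ((gw z : ℂ) * (z ^ α k * star z ^ β k)))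
        fun k => (gw_int _ _).const_mul _
    · simp [mon_tX_zero _ h']
  · simp [mon_tX_zero _ h]

lemma gmon_integral {m : ℕ} (α β : ℕ →₀ ℕ) :
    ∫ X : Fin m → ℂ, (gwm X : ℂ) * (mon α (tX X) * star (mon β (tX X))) =
      if α = β ∧ α.support ⊆ Finset.range m then (zz α : ℂ) else 0 := by
  by_cases h : α.support ⊆ Finset.range m
  · by_cases h' : β.support ⊆ Finset.range m
    · simp only [gmon_eq h h']
      rw [integral_fintype_prod_volume_eq_prod (f := fun (k : Fin m) (z : ℂ) => ((sqk k : ℂ) ^ α k * (sqk k : ℂ) ^ β k) * ((gw z : ℂ) * (z ^ α k * star z ^ β k)))]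
      simp only [integral_const_mul, gw_moment]
      by_cases hab : α = β
      · subst hab
        rw [if_pos ⟨rfl, h⟩, zz, Finsupp.prod, Finset.prod_subset h, Finset.prod_range]
        · push_cast
          refine Finset.prod_congr rfl fun k _ => ?_
          rw [if_pos rfl, ← mul_pow, sqk_sqkC]
        · intro k _ hk
          rw [Finsupp.notMem_support_iff.1 hk]; simp
      · rw [if_neg (fun h => hab h.1)]
        obtain ⟨k, hk⟩ := Finsupp.ne_iff.1 hab
        have hkm : k < m := by
          by_contra hkm
          have h1 : k ∉ α.support := fun hh => hkm (Finset.mem_range.1 (h hh))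
          have h2 : k ∉ β.support := fun hh => hkm (Finset.mem_range.1 (h' hh))
          rw [Finsupp.notMem_support_iff.1 h1, Finsupp.notMem_support_iff.1 h2] at hk
          exact hk rfl
        refine Finset.prod_eq_zero (Finset.mem_univ ⟨k, hkm⟩) ?_
        simp only
        rw [if_neg hk, mul_zero]
    · simp only [mon_tX_zero _ h', star_zero, mul_zero, integral_zero]
      rw [if_neg]
      rintro ⟨rfl, h2⟩; exact h' h2
  · simp only [mon_tX_zero _ h, zero_mul, mul_zero, integral_zero]
    rw [if_neg (fun hh => h hh.2)]

/-- truncated Hall norm -/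
noncomputable def HNm (m : ℕ) (P : MvPolynomial ℕ ℂ) : ℝ :=
  ∑ α ∈ P.support, if α.support ⊆ Finset.range m then zz α * ‖MvPolynomial.coeff α P‖ ^ 2 else 0

lemma gpoly_expand {m : ℕ} (P : MvPolynomial ℕ ℂ) (X : Fin m → ℂ) : ((gwm X * ‖MvPolynomial.eval (tX X) P‖ ^ 2 : ℝ) : ℂ) =
    ∑ α ∈ P.support, ∑ β ∈ P.support, (MvPolynomial.coeff α P * star (MvPolynomial.coeff β P)) * ((gwm X : ℂ) * (mon α (tX X) * star (mon β (tX X)))) := by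
  rw [Complex.ofReal_mul, ← star_mul_norm, eval_mon (Finset.Subset.refl _), star_sum, Finset.sum_mul_sum, Finset.mul_sum]
  refine Finset.sum_congr rfl fun α _ => ?_
  rw [Finset.mul_sum]
  refine Finset.sum_congr rfl fun β _ => ?_
  rw [star_mul']; ring

lemma gpoly_int {m : ℕ} (P : MvPolynomial ℕ ℂ) : Integrable fun X : Fin m → ℂ => gwm X * ‖MvPolynomial.eval (tX X) P‖ ^ 2 := by
  have : Integrable fun X : Fin m → ℂ => ((gwm X * ‖MvPolynomial.eval (tX X) P‖ ^ 2 : ℝ) : ℂ) := by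
    simp only [gpoly_expand]
    exact integrable_finsetSum _ fun α _ => integrable_finsetSum _ fun β _ => (gmon_int α β).const_mul _
  exact_mod_cast this.re

lemma gpoly_integral {m : ℕ} (P : MvPolynomial ℕ ℂ) : ∫ X : Fin m → ℂ, gwm X * ‖MvPolynomial.eval (tX X) P‖ ^ 2 = HNm m P := by
  apply Complex.ofReal_injective
  rw [← integral_complex_ofReal]
  simp only [gpoly_expand]
  rw [integral_finsetSum _ fun α _ => integrable_finsetSum _ fun β _ => (gmon_int α β).const_mul _, HNm, Complex.ofReal_sum]
  refine Finset.sum_congr rfl fun α hα => ?_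
  rw [integral_finsetSum _ fun β _ => (gmon_int α β).const_mul _]
  simp only [integral_const_mul, gmon_integral]
  rw [Finset.sum_eq_single α]
  · by_cases h : α.support ⊆ Finset.range m
    · rw [if_pos ⟨rfl, h⟩, if_pos h, star_mul_norm]; push_cast; ring
    · rw [if_neg (fun hh => h hh.2), if_neg h]; simp
  · intro β _ hb
    rw [if_neg (fun hh => hb hh.1.symm), mul_zero]
  · intro h; exact absurd hα h

/-- quadratic form -/
noncomputable def qf (a : ℕ → ℕ → ℂ) {m : ℕ} (X : Fin m → ℂ) : ℂ := ∑ k : Fin m, ∑ l : Fin m, bb a k l * X k * X l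

lemma tX_hasSum (a : ℕ → ℕ → ℂ) {m : ℕ} (X : Fin m → ℂ) (s : ℂ) :
    HasSum (fun p : ℕ × ℕ => a (p.1 + 1) (p.2 + 1) * tX X p.1 * tX X p.2 * s ^ (p.1 + p.2 + 2))
      (∑ p ∈ Finset.range m ×ˢ Finset.range m, a (p.1 + 1) (p.2 + 1) * tX X p.1 * tX X p.2 * s ^ (p.1 + p.2 + 2)) := by
  refine hasSum_sum_of_ne_finset_zero (L := SummationFilter.unconditional (ℕ × ℕ)) fun p hp => ?_
  have h : ¬ p.1 < m ∨ ¬ p.2 < m := by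
    by_contra hh
    push Not at hh
    exact hp (Finset.mem_product.2 ⟨Finset.mem_range.2 hh.1, Finset.mem_range.2 hh.2⟩)
  rcases h with h | h
  · rw [tX, dif_neg h]; ring
  · rw [show tX X p.2 = 0 by rw [tX, dif_neg h]]; ring

lemma tX_tsum (a : ℕ → ℕ → ℂ) {m : ℕ} (X : Fin m → ℂ) :
    ∑' p : ℕ × ℕ, a (p.1 + 1) (p.2 + 1) * tX X p.1 * tX X p.2 * 1 ^ (p.1 + p.2 + 2) = qf a X := by
  rw [(tX_hasSum a X 1).tsum_eq, Finset.sum_product, Finset.sum_range, qf]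
  refine Finset.sum_congr rfl fun k _ => ?_
  rw [Finset.sum_range]
  refine Finset.sum_congr rfl fun l _ => ?_
  rw [tX, dif_pos k.2, tX, dif_pos l.2, bb]
  push_cast
  ring

lemma tX_FP (a : ℕ → ℕ → ℂ) {m : ℕ} (X : Fin m → ℂ) :
    HasSum (fun j => MvPolynomial.eval (tX X) (FP a j)) (Complex.exp (-(1 / 2) * qf a X)) := by
  have := FP_hasSum a (tX X) (r := 2) two_pos (fun s _ => (tX_hasSum a X s).summable) (s := 1) (by simp)
  rw [tX_tsum] at this
  simpa using this

/-- rotation of the Gaussian variables -/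
noncomputable def grot {m : ℕ} (t : TT) (X : Fin m → ℂ) (k : Fin m) : ℂ := (fourier (-1) t) ^ ((k : ℕ) + 1) * X k

lemma grot_mp {m : ℕ} (t : TT) : MeasurePreserving (grot t : (Fin m → ℂ) → (Fin m → ℂ)) := by
  have := volume_preserving_pi (ι := Fin m) (α' := fun _ => ℂ) (β' := fun _ => ℂ) (f := fun k z => (fourier (-1) t : ℂ) ^ ((k : ℕ) + 1) * z)
    (fun k => rot_vp _ (by rw [norm_pow, norm_fourier_pt, one_pow]))
  exact this

lemma gauss_l2 (a : ℕ → ℕ → ℂ) (m : ℕ) :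
    ∫⁻ X : Fin m → ℂ, ENNReal.ofReal (gwm X * ‖Complex.exp (-(1 / 2) * qf a X)‖ ^ 2) = ∑' j, ENNReal.ofReal (HNm m (FP a j)) := by
  have hpol : ∀ P : MvPolynomial ℕ ℂ, Continuous fun X : Fin m → ℂ => MvPolynomial.eval (tX X) P := fun P => by
    simp only [MvPolynomial.eval_eq]
    exact continuous_finsetSum _ fun α _ => continuous_const.mul (continuous_finsetProd _ fun i _ => (tX_continuous i).pow _)
  have h := rotation_l2 (volume : Measure (Fin m → ℂ)) (fun X => ENNReal.ofReal (gwm X))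
    (ENNReal.measurable_ofReal.comp gwm_continuous.measurable)
    (fun j X => MvPolynomial.eval (tX X) (FP a j))
    (fun j => (hpol _).measurable) grot (by
      have : Continuous fun p : TT × (Fin m → ℂ) => grot p.1 p.2 := by unfold grot; fun_prop
      exact this.measurable) grot_mp ?_ ?_ ?_
  · have e : ∀ (X : Fin m → ℂ) (z : ℂ), ENNReal.ofReal (gwm X) * ‖z‖ₑ ^ 2 = ENNReal.ofReal (gwm X * ‖z‖ ^ 2) := fun X z => by
      rw [enorm_sq_ofReal, ← ENNReal.ofReal_mul (gwm_pos X).le]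
    simp only [e, (tX_FP a _).tsum_eq] at h
    rw [h]
    congr 1; ext j
    rw [← gpoly_integral, ofReal_integral_eq_lintegral_ofReal (gpoly_int _) (ae_of_all _ fun X => mul_nonneg (gwm_pos X).le (sq_nonneg _))]
  · intro t X
    have : gwm (grot t X) = gwm X := by
      unfold gwm grot gw
      refine Finset.prod_congr rfl fun k _ => ?_
      rw [norm_mul, norm_pow, norm_fourier_pt, one_pow, one_mul]
    simp only [this]
  · intro j t X
    have h1 : tX (grot t X) = fun i => (fourier (-1) t : ℂ) ^ (i + 1) * tX X i := by
      funext i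
      unfold tX grot
      split_ifs
      · ring
      · ring
    rw [h1, hom_scale (FP_hom a j), four_mpow]
  · intro X
    exact (tX_FP a X).summable.norm

lemma HNm_zero (a : ℕ → ℕ → ℂ) (m : ℕ) : HNm m (FP a 0) = 1 := by
  rw [FP_zero, HNm]
  rw [show (1 : MvPolynomial ℕ ℂ) = MvPolynomial.C 1 by simp, MvPolynomial.support_C, if_neg one_ne_zero]
  simp [zz]

lemma HN_zero (a : ℕ → ℕ → ℂ) : HN (FP a 0) = 1 := by
  rw [FP_zero, HN]
  rw [show (1 : MvPolynomial ℕ ℂ) = MvPolynomial.C 1 by simp, MvPolynomial.support_C, if_neg one_ne_zero]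
  simp [zz]

lemma HNm_nonneg (m : ℕ) (P : MvPolynomial ℕ ℂ) : 0 ≤ HNm m P :=
  Finset.sum_nonneg fun α _ => by
    split_ifs
    · exact mul_nonneg (zz_pos α).le (sq_nonneg _)
    · rfl

lemma HNm_le (m : ℕ) (P : MvPolynomial ℕ ℂ) : HNm m P ≤ HN P :=
  Finset.sum_le_sum fun α _ => by
    split_ifs
    · rfl
    · exact mul_nonneg (zz_pos α).le (sq_nonneg _)

lemma HNm_eq {m j : ℕ} {P : MvPolynomial ℕ ℂ} (hP : P.IsWeightedHomogeneous wt j) (h : j ≤ m) : HNm m P = HN P := by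
  refine Finset.sum_congr rfl fun α hα => if_pos ?_
  intro k hk
  have h1 : Finsupp.weight wt α = j := hP (MvPolynomial.mem_support_iff.1 hα)
  rw [weight_eq] at h1
  have h2 := Finset.single_le_sum (f := fun i => α i * (i + 1)) (fun _ _ => Nat.zero_le _) hk
  have h3 : 1 ≤ α k := Nat.one_le_iff_ne_zero.2 (Finsupp.mem_support_iff.1 hk)
  have h4 : 1 * (k + 1) ≤ α k * (k + 1) := Nat.mul_le_mul_right _ h3
  rw [Finset.mem_range]
  omega

open scoped MatrixOrder in
lemma posdef_factor {ι : Type*} [Fintype ι] [DecidableEq ι] {A : Matrix ι ι ℝ} (hA : A.PosDef) :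
    ∃ C : Matrix ι ι ℝ, A = Matrix.transpose C * C := by
  obtain ⟨C, hC⟩ := CStarAlgebra.nonneg_iff_eq_star_mul_self.mp hA.posSemidef.nonneg
  exact ⟨C, by rw [hC, Matrix.star_eq_conjTranspose, Matrix.conjTranspose_eq_transpose_of_trivial]⟩

lemma std_gauss (ι : Type*) [Fintype ι] :
    ∫⁻ x : ι → ℝ, ENNReal.ofReal (Real.exp (-(x ⬝ᵥ x))) = ENNReal.ofReal (Real.sqrt Real.pi ^ Fintype.card ι) := by
  have e : ∀ x : ι → ℝ, Real.exp (-(x ⬝ᵥ x)) = ∏ i, Real.exp (-1 * x i ^ 2) := fun x => by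
    rw [← Real.exp_sum, dotProduct, ← Finset.sum_neg_distrib]
    congr 1
    refine Finset.sum_congr rfl fun i _ => by ring
  simp only [e]
  rw [← ofReal_integral_eq_lintegral_ofReal]
  · rw [integral_fintype_prod_volume_eq_pow (fun t : ℝ => Real.exp (-1 * t ^ 2)), integral_gaussian, div_one]
  · exact Integrable.fintype_prod (f := fun (_ : ι) (t : ℝ) => Real.exp (-1 * t ^ 2)) fun _ => integrable_exp_neg_mul_sq one_pos
  · exact ae_of_all _ fun x => Finset.prod_nonneg fun i _ => (Real.exp_pos _).le

lemma real_gauss {ι : Type*} [Fintype ι] [DecidableEq ι] {A : Matrix ι ι ℝ} (hA : A.PosDef) :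
    ∫⁻ x : ι → ℝ, ENNReal.ofReal (Real.exp (-(x ⬝ᵥ A.mulVec x))) =
      ENNReal.ofReal ((Real.sqrt A.det)⁻¹ * Real.sqrt Real.pi ^ Fintype.card ι) := by
  obtain ⟨C, hC⟩ := posdef_factor hA
  have hd : A.det = C.det ^ 2 := by rw [hC, Matrix.det_mul, Matrix.det_transpose, sq]
  have hd0 : C.det ≠ 0 := by
    intro h
    have := hA.det_pos
    rw [hd, h] at this; simp at this
  have e : ∀ x : ι → ℝ, x ⬝ᵥ A.mulVec x = (Matrix.toLin' C x) ⬝ᵥ (Matrix.toLin' C x) := fun x => by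
    rw [hC, Matrix.toLin'_apply, ← Matrix.mulVec_mulVec, Matrix.dotProduct_mulVec, Matrix.vecMul_transpose]
  simp only [e]
  have hm1 : Measurable fun x : ι → ℝ => ENNReal.ofReal (Real.exp (-(x ⬝ᵥ x))) := by
    refine ENNReal.measurable_ofReal.comp ?_
    have : Continuous fun x : ι → ℝ => Real.exp (-(x ⬝ᵥ x)) := by unfold dotProduct; fun_prop
    exact this.measurable
  have h := lintegral_map (μ := (volume : Measure (ι → ℝ))) hm1 (g := Matrix.toLin' C) (LinearMap.continuous_of_finiteDimensional _).measurable
  rw [← h, Real.map_matrix_volume_pi_eq_smul_volume_pi hd0, lintegral_smul_measure, std_gauss, smul_eq_mul,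
    ← ENNReal.ofReal_mul (abs_nonneg _), hd, Real.sqrt_sq_eq_abs, abs_inv]

/-- real coordinates -/
def recoord {m : ℕ} (X : Fin m → ℂ) : Fin m ⊕ Fin m → ℝ := Sum.elim (fun k => (X k).re) (fun k => (X k).im)

lemma recoord_mp (m : ℕ) : MeasurePreserving (recoord (m := m)) := by
  have h1 := volume_preserving_pi (ι := Fin m) (α' := fun _ => ℂ) (β' := fun _ => ℝ × ℝ) (f := fun _ => Complex.measurableEquivRealProd)
    (fun _ => Complex.volume_preserving_equiv_real_prod)
  have h2 := volume_measurePreserving_arrowProdEquivProdArrow ℝ ℝ (Fin m)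
  have h3 := volume_measurePreserving_sumPiEquivProdPi_symm (ι := Fin m) (ι' := Fin m) (fun _ => ℝ)
  have h := (h3.comp h2).comp h1
  have e : (recoord (m := m)) = ((MeasurableEquiv.sumPiEquivProdPi fun _ : Fin m ⊕ Fin m => ℝ).symm ∘ (MeasurableEquiv.arrowProdEquivProdArrow ℝ ℝ (Fin m))) ∘
      fun a i => Complex.measurableEquivRealProd (a i) := by
    funext X i
    cases i <;> rfl
  rw [e]
  exact h

/-- real matrix of the quadratic form -/
noncomputable def RM {m : ℕ} (B : Matrix (Fin m) (Fin m) ℂ) : Matrix (Fin m ⊕ Fin m) (Fin m ⊕ Fin m) ℝ :=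
  Matrix.fromBlocks (1 + B.map Complex.re) (-(B.map Complex.im)) (-(B.map Complex.im)) (1 - B.map Complex.re)

lemma RM_quad {m : ℕ} (B : Matrix (Fin m) (Fin m) ℂ) (X : Fin m → ℂ) :
    recoord X ⬝ᵥ (RM B).mulVec (recoord X) = ∑ k, ‖X k‖ ^ 2 + (∑ k, ∑ l, B k l * X k * X l).re := by
  rw [RM, Matrix.fromBlocks_mulVec, recoord, sumElim_dotProduct_sumElim]
  simp only [Sum.elim_comp_inl, Sum.elim_comp_inr, Matrix.add_mulVec, Matrix.sub_mulVec, Matrix.neg_mulVec, Matrix.one_mulVec]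
  simp only [dotProduct, Pi.add_apply, Pi.sub_apply, Pi.neg_apply, Matrix.mulVec, Matrix.map_apply, Complex.re_sum]
  rw [← Finset.sum_add_distrib, ← Finset.sum_add_distrib]
  refine Finset.sum_congr rfl fun k _ => ?_
  have h1 : ∑ l, (B k l * X k * X l).re = (X k).re * (∑ l, (B k l).re * (X l).re) - (X k).re * (∑ l, (B k l).im * (X l).im)
      - (X k).im * (∑ l, (B k l).im * (X l).re) - (X k).im * (∑ l, (B k l).re * (X l).im) := by
    rw [Finset.mul_sum, Finset.mul_sum, Finset.mul_sum, Finset.mul_sum, ← Finset.sum_sub_distrib, ← Finset.sum_sub_distrib, ← Finset.sum_sub_distrib]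
    refine Finset.sum_congr rfl fun l _ => ?_
    simp only [Complex.mul_re, Complex.mul_im]; ring
  rw [h1, ← Complex.normSq_eq_norm_sq, Complex.normSq_apply]
  ring

lemma RM_det {m : ℕ} {B : Matrix (Fin m) (Fin m) ℂ} (hB : Matrix.transpose B = B) :
    ((RM B).det : ℂ) = (1 - Matrix.conjTranspose B * B).det := by
  obtain ⟨R, hR⟩ : ∃ R : Matrix (Fin m) (Fin m) ℂ, R = (B.map Complex.re).map Complex.ofReal := ⟨_, rfl⟩
  obtain ⟨S, hS⟩ : ∃ S : Matrix (Fin m) (Fin m) ℂ, S = (B.map Complex.im).map Complex.ofReal := ⟨_, rfl⟩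
  have h1 : B = R + Complex.I • S := by
    ext i j
    simp only [hR, hS, Matrix.add_apply, Matrix.smul_apply, Matrix.map_apply, smul_eq_mul]
    rw [mul_comm]; exact (Complex.re_add_im _).symm
  have h2 : Matrix.conjTranspose B = R - Complex.I • S := by
    have : Matrix.conjTranspose B = B.map star := by
      rw [Matrix.conjTranspose, hB]
    rw [this]
    ext i j
    simp only [hR, hS, Matrix.sub_apply, Matrix.smul_apply, Matrix.map_apply, smul_eq_mul]
    apply Complex.ext <;> simp
  have hc : ((RM B).det : ℂ) = (Matrix.fromBlocks (1 + R) (-S) (-S) (1 - R)).det := by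
    have := RingHom.map_det Complex.ofRealHom (RM B)
    rw [Complex.ofRealHom_eq_coe] at this
    rw [this]
    congr 1
    rw [RM, RingHom.mapMatrix_apply, Matrix.fromBlocks_map]
    congr 1
    · ext i j; simp [hR, Matrix.one_apply]; split_ifs <;> simp
    · ext i j; simp [hS]
    · ext i j; simp [hS]
    · ext i j; simp [hR, Matrix.one_apply]; split_ifs <;> simp
  rw [hc]
  have key : (Matrix.fromBlocks 1 (-(Complex.I • 1)) 0 1 * Matrix.fromBlocks (1 + R) (-S) (-S) (1 - R) * Matrix.fromBlocks 1 0 (Complex.I • 1) 1) *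
      Matrix.fromBlocks 1 ((Complex.I / 2) • (1 - B)) 0 1 =
      (Matrix.fromBlocks ((2 : ℂ) • (1 : Matrix (Fin m) (Fin m) ℂ)) 0 (Complex.I • (1 - Matrix.conjTranspose B)) ((1 / 2 : ℂ) • (1 - Matrix.conjTranspose B * B))) := by
    rw [h2, h1]
    simp only [Matrix.fromBlocks_multiply]
    have hI := Complex.I_mul_I
    congr 1
    all_goals
      simp only [Matrix.one_mul, Matrix.mul_one, Matrix.zero_mul, Matrix.mul_zero, Matrix.smul_mul, Matrix.mul_smul, neg_mul, mul_neg, add_mul, mul_add, sub_mul, mul_sub, smul_add, smul_sub, smul_neg, smul_smul, hI]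
      match_scalars <;> (ring_nf; try simp only [Complex.I_sq, Complex.I_pow_three]; try ring_nf)
  have := congrArg Matrix.det key
  simp only [Matrix.det_mul, Matrix.det_fromBlocks_zero₂₁, Matrix.det_fromBlocks_zero₁₂, Matrix.det_one, Matrix.det_smul, one_mul, mul_one, Fintype.card_fin] at this
  rw [this, ← mul_assoc, ← mul_pow]
  norm_num

/-- truncated Grunsky matrix -/
noncomputable def BM (a : ℕ → ℕ → ℂ) (m : ℕ) : Matrix (Fin m) (Fin m) ℂ := Matrix.of fun k l => bb a k l

section
variable {φ : ℂ → ℂ} {φ₀ : ℂ} {c : ℕ → ℂ} {a : ℕ → ℕ → ℂ}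

lemma GH.BM_sym (G : GH φ φ₀ c a) (m : ℕ) : Matrix.transpose (BM a m) = BM a m := by
  ext k l
  simp only [Matrix.transpose_apply, BM, Matrix.of_apply]
  exact G.bb_sym _ _

lemma strictF {q : ℝ} (hq : ∀ (N : ℕ) (x : ℕ → ℂ), ∑ l ∈ Finset.range N, ‖yy a N x l‖ ^ 2 ≤ q * ∑ k ∈ Finset.range N, ‖x k‖ ^ 2)
    {m : ℕ} (X : Fin m → ℂ) : ∑ l : Fin m, ‖∑ k : Fin m, bb a k l * X k‖ ^ 2 ≤ q * ∑ k, ‖X k‖ ^ 2 := by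
  have h := hq m (fun k => if h : k < m then X ⟨k, h⟩ else 0)
  simp only [yy, Finset.sum_range, Fin.is_lt, dite_true, Fin.eta] at h
  exact h

lemma qf_bound {q : ℝ} (hq : ∀ (N : ℕ) (x : ℕ → ℂ), ∑ l ∈ Finset.range N, ‖yy a N x l‖ ^ 2 ≤ q * ∑ k ∈ Finset.range N, ‖x k‖ ^ 2)
    {m : ℕ} (X : Fin m → ℂ) : ‖qf a X‖ ≤ (1 + q) / 2 * ∑ k, ‖X k‖ ^ 2 := by
  have h := strictF hq X
  have e : qf a X = ∑ l : Fin m, (∑ k : Fin m, bb a k l * X k) * X l := by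
    rw [qf, Finset.sum_comm]
    simp only [Finset.sum_mul]
  rw [e]
  refine (norm_sum_le _ _).trans ?_
  have h2 : ∑ l : Fin m, ‖(∑ k : Fin m, bb a k l * X k) * X l‖ ≤ ∑ l : Fin m, (‖∑ k : Fin m, bb a k l * X k‖ ^ 2 + ‖X l‖ ^ 2) / 2 := by
    refine Finset.sum_le_sum fun l _ => ?_
    rw [norm_mul]
    nlinarith [sq_nonneg (‖∑ k : Fin m, bb a k l * X k‖ - ‖X l‖)]
  rw [← Finset.sum_div, Finset.sum_add_distrib] at h2
  linarith

lemma GH.RM_posDef (G : GH φ φ₀ c a) (m : ℕ) : (RM (BM a m)).PosDef := by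
  obtain ⟨q, _, hq1, hq⟩ := G.strict
  refine Matrix.PosDef.of_dotProduct_mulVec_pos ?_ fun u hu => ?_
  · rw [Matrix.IsHermitian, Matrix.conjTranspose_eq_transpose_of_trivial, RM, Matrix.fromBlocks_transpose]
    have h1 : ∀ f : ℂ → ℝ, Matrix.transpose ((BM a m).map f) = (BM a m).map f := fun f => by
      rw [← Matrix.transpose_map, G.BM_sym]
    simp only [Matrix.transpose_add, Matrix.transpose_sub, Matrix.transpose_neg, Matrix.transpose_one, h1]
  · rw [star_trivial]
    obtain ⟨X, hX⟩ : ∃ X : Fin m → ℂ, recoord X = u := by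
      refine ⟨fun k => ⟨u (Sum.inl k), u (Sum.inr k)⟩, ?_⟩
      funext i
      cases i <;> rfl
    rw [← hX, RM_quad]
    have h1 := qf_bound hq X
    have h2 : (∑ k, ∑ l, BM a m k l * X k * X l) = qf a X := rfl
    rw [h2]
    have h3 := (abs_le.1 ((Complex.abs_re_le_norm (qf a X)).trans h1)).1
    have h4 : 0 < ∑ k, ‖X k‖ ^ 2 := by
      refine (Finset.sum_nonneg fun k _ => sq_nonneg _).lt_of_ne fun h => hu ?_
      have h5 := (Finset.sum_eq_zero_iff_of_nonneg fun k _ => sq_nonneg _).1 h.symm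
      have h6 : ∀ k, X k = 0 := fun k => by simpa using h5 k (Finset.mem_univ k)
      rw [← hX]
      funext i
      cases i <;> simp [recoord, h6]
    nlinarith

/-- the determinant -/
noncomputable def detd (a : ℕ → ℕ → ℂ) (m : ℕ) : ℝ := (RM (BM a m)).det

lemma GH.detd_eq (G : GH φ φ₀ c a) (m : ℕ) : (detd a m : ℂ) = (1 - Matrix.conjTranspose (BM a m) * BM a m).det :=
  RM_det (G.BM_sym m)

lemma GH.detd_pos (G : GH φ φ₀ c a) (m : ℕ) : 0 < detd a m := (G.RM_posDef m).det_pos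

lemma GH.detd_gauss (G : GH φ φ₀ c a) (m : ℕ) :
    ∑' j, ENNReal.ofReal (HNm m (FP a j)) = ENNReal.ofReal ((Real.sqrt (detd a m))⁻¹) := by
  rw [← gauss_l2]
  have e : ∀ X : Fin m → ℂ, ENNReal.ofReal (gwm X * ‖Complex.exp (-(1 / 2) * qf a X)‖ ^ 2) =
      ENNReal.ofReal ((Real.pi⁻¹) ^ m) * (fun u : Fin m ⊕ Fin m → ℝ => ENNReal.ofReal (Real.exp (-(u ⬝ᵥ (RM (BM a m)).mulVec u)))) (recoord X) := fun X => by
    have h2 : (∑ k, ∑ l, BM a m k l * X k * X l) = qf a X := rfl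
    simp only
    rw [← ENNReal.ofReal_mul (by positivity), RM_quad, h2]
    congr 1
    rw [gwm, ← norm_pow, ← Complex.exp_nat_mul, Complex.norm_exp]
    simp only [gw, Finset.prod_div_distrib]
    rw [← Real.exp_sum, neg_add, Real.exp_add, Finset.sum_neg_distrib]
    have h3 : ((2 : ℕ) * (-(1 / 2) * qf a X) : ℂ).re = -(qf a X).re := by
      rw [← Complex.neg_re]; congr 1; push_cast; ring
    rw [h3]
    simp only [Finset.prod_const, Finset.card_univ, Fintype.card_fin]
    rw [inv_pow]; ring
  simp only [e]
  have hmeas : Measurable fun u : Fin m ⊕ Fin m → ℝ => ENNReal.ofReal (Real.exp (-(u ⬝ᵥ (RM (BM a m)).mulVec u))) := by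
    refine ENNReal.measurable_ofReal.comp ?_
    have : Continuous fun u : Fin m ⊕ Fin m → ℝ => Real.exp (-(u ⬝ᵥ (RM (BM a m)).mulVec u)) := by
      unfold dotProduct Matrix.mulVec dotProduct; fun_prop
    exact this.measurable
  have hl := (recoord_mp m).lintegral_comp hmeas
  have hc := hmeas.comp (recoord_mp m).measurable
  simp only [Function.comp_def] at hc
  rw [lintegral_const_mul _ hc, hl, real_gauss (G.RM_posDef m),
    ← ENNReal.ofReal_mul (by positivity)]
  congr 1
  rw [Fintype.card_sum, Fintype.card_fin, ← two_mul, pow_mul, Real.sq_sqrt Real.pi_pos.le, mul_left_comm, ← mul_pow, inv_mul_cancel₀ Real.pi_ne_zero, one_pow, mul_one]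
  rfl

lemma GH.detd_hasSum (G : GH φ φ₀ c a) (m : ℕ) : HasSum (fun j => HNm m (FP a j)) ((Real.sqrt (detd a m))⁻¹) := by
  have h := G.detd_gauss m
  have hs : Summable fun j => HNm m (FP a j) := by
    have : ∑' j, ENNReal.ofReal (HNm m (FP a j)) ≠ ⊤ := by rw [h]; exact ENNReal.ofReal_ne_top
    have h2 := ENNReal.summable_toReal this
    refine h2.congr fun j => ?_
    rw [ENNReal.toReal_ofReal (HNm_nonneg _ _)]
  rw [← ENNReal.ofReal_tsum_of_nonneg (fun j => HNm_nonneg _ _) hs] at h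
  rw [ENNReal.ofReal_eq_ofReal_iff (tsum_nonneg fun j => HNm_nonneg _ _) (inv_nonneg.2 (Real.sqrt_nonneg _))] at h
  rw [← h]; exact hs.hasSum

lemma GH.detd_le_one (G : GH φ φ₀ c a) (m : ℕ) : detd a m ≤ 1 := by
  have h := G.detd_hasSum m
  have h1 := h.summable.le_tsum 0 (fun j _ => HNm_nonneg m (FP a j))
  rw [h.tsum_eq, HNm_zero] at h1
  have h2 := inv_le_one_of_one_le₀ h1
  rw [inv_inv] at h2
  have := G.detd_pos m
  have h3 := Real.sq_sqrt this.le
  nlinarith [Real.sqrt_nonneg (detd a m)]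

lemma GH.detd_lower (G : GH φ φ₀ c a) : ∃ δ : ℝ, 0 < δ ∧ ∀ m, δ ≤ detd a m := by
  obtain ⟨q, hq0, hq1, hq⟩ := G.strict
  obtain ⟨H, hH⟩ : ∃ H, H = ∑' p : ℕ × ℕ, ‖bb a p.1 p.2‖ ^ 2 := ⟨_, rfl⟩
  refine ⟨Real.exp (-(H / (1 - q))), Real.exp_pos _, fun m => ?_⟩
  have hh := Matrix.isHermitian_conjTranspose_mul_self (BM a m)
  have hdet : (detd a m : ℂ) = ((∏ i, (1 - hh.eigenvalues i) : ℝ) : ℂ) := by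
    rw [G.detd_eq]
    have h1 := Matrix.eval_charpoly (Matrix.conjTranspose (BM a m) * BM a m) 1
    rw [hh.charpoly_eq, Polynomial.eval_prod] at h1
    simp only [Polynomial.eval_sub, Polynomial.eval_X, Polynomial.eval_C, map_one] at h1
    rw [← h1]; push_cast; rfl
  have hdet' := Complex.ofReal_injective hdet
  have hl : ∀ i, 0 ≤ hh.eigenvalues i := Matrix.eigenvalues_conjTranspose_mul_self_nonneg _
  have hu : ∀ i, hh.eigenvalues i ≤ q := by
    intro i
    rw [hh.eigenvalues_eq]
    obtain ⟨v, hv⟩ : ∃ v : Fin m → ℂ, v = (hh.eigenvectorBasis i) := ⟨_, rfl⟩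
    rw [← hv]
    have hn : ∑ k, ‖v k‖ ^ 2 = 1 := by
      have := hh.eigenvectorBasis.orthonormal.1 i
      rw [EuclideanSpace.norm_eq, Real.sqrt_eq_one] at this
      rw [hv]; exact this
    have h1 := strictF hq v
    rw [hn, mul_one] at h1
    refine le_trans (le_of_eq ?_) h1
    rw [← Matrix.mulVec_mulVec, Matrix.dotProduct_mulVec, ← Matrix.star_mulVec, dotProduct]
    have h2 : ∀ l, (BM a m).mulVec v l = ∑ k : Fin m, bb a k l * v k := fun l => by
      simp only [Matrix.mulVec, dotProduct, BM, Matrix.of_apply]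
      exact Finset.sum_congr rfl fun k _ => by rw [G.bb_sym]
    rw [map_sum]
    refine Finset.sum_congr rfl fun l _ => ?_
    rw [Pi.star_apply, mul_comm, star_mul_norm, h2]
    exact Complex.ofReal_re _
  have htr : ∑ i, hh.eigenvalues i ≤ H := by
    have h1 := hh.trace_eq_sum_eigenvalues
    have h2 : (Matrix.conjTranspose (BM a m) * BM a m).trace = ((∑ p ∈ Finset.range m ×ˢ Finset.range m, ‖bb a p.1 p.2‖ ^ 2 : ℝ) : ℂ) := by
      rw [Finset.sum_product_right, Finset.sum_range, Matrix.trace, Complex.ofReal_sum]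
      refine Finset.sum_congr rfl fun l _ => ?_
      rw [Finset.sum_range, Matrix.diag_apply, Matrix.mul_apply, Complex.ofReal_sum]
      refine Finset.sum_congr rfl fun k _ => ?_
      rw [Matrix.conjTranspose_apply, mul_comm, star_mul_norm]; rfl
    rw [h2] at h1
    have h3 : ∑ p ∈ Finset.range m ×ˢ Finset.range m, ‖bb a p.1 p.2‖ ^ 2 = ∑ i, hh.eigenvalues i := by
      apply Complex.ofReal_injective
      rw [h1]; push_cast; rfl
    rw [← h3, hH]
    exact G.bb_summ.sum_le_tsum _ fun p _ => sq_nonneg _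
  rw [hdet']
  have h1q : 0 < 1 - q := by linarith
  calc Real.exp (-(H / (1 - q))) ≤ Real.exp (∑ i, -(hh.eigenvalues i / (1 - q))) := by
        apply Real.exp_le_exp.2
        rw [Finset.sum_neg_distrib, ← Finset.sum_div]
        exact neg_le_neg (div_le_div_of_nonneg_right htr h1q.le)
    _ = ∏ i, Real.exp (-(hh.eigenvalues i / (1 - q))) := Real.exp_sum _ _
    _ ≤ ∏ i, (1 - hh.eigenvalues i) := by
        refine Finset.prod_le_prod (fun i _ => (Real.exp_pos _).le) fun i _ => ?_
        have hp : 0 < 1 - hh.eigenvalues i := by have := hu i; linarith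
        rw [← Real.le_log_iff_exp_le hp]
        refine le_trans ?_ (Real.one_sub_inv_le_log_of_pos hp)
        have : 1 - (1 - hh.eigenvalues i)⁻¹ = -(hh.eigenvalues i / (1 - hh.eigenvalues i)) := by field_simp; ring
        rw [this]
        refine neg_le_neg (div_le_div_of_nonneg_left (hl i) h1q ?_)
        have := hu i; linarith

end

open Matrix

/-- For a Weil–Petersson quasicircle (capacity 1) with Grunsky
coefficients `a_{kℓ}`, `b_{kℓ} = √(kℓ) a_{kℓ}` and truncations `B_m`, the determinants
`det(I − B_m* B_m)` lie in `(0,1]` and converge to some `D ∈ (0,1]`, each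
`Z̃_n = lim_{r→1+} Z_n(r)/(2π)^n` is finite, and `log Z̃_n → −(1/2) log D`. -/
theorem stmt17 (φ : ℂ → ℂ) (φ₀ : ℂ) (c : ℕ → ℂ) (a : ℕ → ℕ → ℂ)
    (hφ : DifferentiableOn ℂ φ {z : ℂ | 1 < norm z})
    (hinj : Set.InjOn φ {z : ℂ | 1 < norm z})
    (hLaurent : ∀ z : ℂ, 1 < norm z →
      Summable (fun k : ℕ => norm (c k * z ^ (-(k : ℤ) - 1))) ∧
      φ z = z + φ₀ + ∑' k : ℕ, c k * z ^ (-(k : ℤ) - 1))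
    (hsym : ∀ k l, a k l = a l k)
    (hGrunsky : ∀ z ζ : ℂ, 1 < norm z → 1 < norm ζ →
      Summable (fun p : ℕ × ℕ =>
        norm (a (p.1 + 1) (p.2 + 1) * ζ ^ (-(p.1 : ℤ) - 1) * z ^ (-(p.2 : ℤ) - 1))) ∧
      φ ζ - φ z = (ζ - z) * Complex.exp
        (-∑' p : ℕ × ℕ, a (p.1 + 1) (p.2 + 1) * ζ ^ (-(p.1 : ℤ) - 1) * z ^ (-(p.2 : ℤ) - 1)))
    (hWP : Summable (fun p : ℕ × ℕ =>
      (((p.1 + 1) * (p.2 + 1) : ℕ) : ℝ) * norm (a (p.1 + 1) (p.2 + 1)) ^ 2))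
    (B : (m : ℕ) → Matrix (Fin m) (Fin m) ℂ)
    (hB : ∀ m : ℕ, B m = Matrix.of fun k l : Fin m =>
      (Real.sqrt ((((k : ℕ) + 1) * ((l : ℕ) + 1) : ℕ)) : ℂ) * a ((k : ℕ) + 1) ((l : ℕ) + 1)) :
    ∃ (d : ℕ → ℝ) (D : ℝ) (Zt : ℕ → ℝ),
      (∀ m : ℕ, ((d m : ℂ) = (1 - (B m)ᴴ * B m).det ∧ d m ∈ Set.Ioc (0 : ℝ) 1)) ∧
      D ∈ Set.Ioc (0 : ℝ) 1 ∧ Tendsto d atTop (nhds D) ∧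
      (∀ n : ℕ, 1 ≤ n → 0 < Zt n ∧
        Tendsto (fun r : ℝ => Zn φ n r / (2 * Real.pi) ^ n)
          (nhdsWithin 1 (Set.Ioi 1)) (nhds (Zt n))) ∧
      Tendsto (fun n : ℕ => Real.log (Zt n)) atTop (nhds (-(1 / 2) * Real.log D)) := by
  have G : GH φ φ₀ c a := ⟨hφ, hinj, hLaurent, hsym, hGrunsky, hWP⟩
  have hBM : ∀ m, B m = BM a m := by
    intro m
    rw [hB, BM]
    congr 1
    funext k l
    rw [bb, sqk, sqk, ← Real.sqrt_mul (by positivity)]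
    push_cast
    rfl
  obtain ⟨δ, hδ0, hδ⟩ := G.detd_lower
  have hHN0 : ∀ j, 0 ≤ HN (FP a j) := fun j => (HNm_nonneg 0 _).trans (HNm_le 0 _)
  have hs : Summable fun j => HN (FP a j) := by
    refine summable_of_sum_range_le (c := (Real.sqrt δ)⁻¹) hHN0 fun N => ?_
    have h1 : ∑ j ∈ Finset.range N, HN (FP a j) = ∑ j ∈ Finset.range N, HNm N (FP a j) :=
      Finset.sum_congr rfl fun j hj => (HNm_eq (FP_hom a j) (Finset.mem_range.1 hj).le).symm
    have h2 := G.detd_hasSum N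
    have h3 := h2.summable.sum_le_tsum (Finset.range N) (fun j _ => HNm_nonneg N (FP a j))
    rw [h2.tsum_eq] at h3
    rw [h1]
    refine h3.trans ?_
    exact inv_anti₀ (Real.sqrt_pos.2 hδ0) (Real.sqrt_le_sqrt (hδ N))
  obtain ⟨S, hS⟩ : ∃ S, S = ∑' j, HN (FP a j) := ⟨_, rfl⟩
  have hS1 : 1 ≤ S := by
    have := hs.le_tsum 0 (fun j _ => hHN0 j)
    rwa [HN_zero, ← hS] at this
  have hS0 : 0 < S := by linarith
  have hlimS : Tendsto (fun m => (Real.sqrt (detd a m))⁻¹) atTop (nhds S) := by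
    have h1 : Tendsto (fun m => ∑' j, HNm m (FP a j)) atTop (nhds (∑' j, HN (FP a j))) := by
      refine tendsto_tsum_of_dominated_convergence hs (fun j => ?_)
        (Eventually.of_forall fun m j => ?_)
      · refine tendsto_const_nhds.congr' ?_
        filter_upwards [eventually_ge_atTop j] with m hm
        exact (HNm_eq (FP_hom a j) hm).symm
      · rw [Real.norm_eq_abs, abs_of_nonneg (HNm_nonneg _ _)]
        exact HNm_le _ _
    rw [← hS] at h1
    exact h1.congr fun m => (G.detd_hasSum m).tsum_eq
  have hEs : ∀ n, Summable fun j => EN n (FP a j) := fun n =>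
    Summable.of_nonneg_of_le (fun j => EN_nonneg _ _) (fun j => cue_le (FP_hom a j)) hs
  refine ⟨detd a, (S⁻¹) ^ 2, fun n => ∑' j, EN n (FP a j), fun m => ⟨?_, G.detd_pos m, G.detd_le_one m⟩,
    ⟨by positivity, ?_⟩, ?_, fun n _ => ⟨?_, ?_⟩, ?_⟩
  · rw [hBM]; exact G.detd_eq m
  · exact pow_le_one₀ (by positivity) (inv_le_one_of_one_le₀ hS1)
  · refine ((hlimS.inv₀ hS0.ne').pow 2).congr fun m => ?_
    rw [inv_inv, Real.sq_sqrt (G.detd_pos m).le]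
  · have := (hEs n).le_tsum 0 (fun j _ => EN_nonneg _ _)
    rw [EN_FP_zero, HN_zero] at this
    linarith
  · refine (tsum_limit (fun j => EN_nonneg n (FP a j)) (hEs n)).congr' ?_
    filter_upwards [self_mem_nhdsWithin] with r hr
    exact (G.Zn_raw n hr).symm
  · have h1 := (Zt_limit a hs)
    rw [← hS] at h1
    have h2 := h1.log hS0.ne'
    have h3 : -(1 / 2) * Real.log ((S⁻¹) ^ 2) = Real.log S := by
      rw [Real.log_pow, Real.log_inv]; push_cast; ring
    rw [h3]; exact h2
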